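/- For any bounded measurable function φ on X, with v̂_{p,n}^N(φ) = v_{p,n}^N(φ̂) / η_n^N(G_n)² and v̂_n^N(φ) = Σ_{p=0}^n c_p^{−1} v̂_{p,n}^N(φ): (1) E[γ̂_n^N(1)² v̂_{p,n}^N(φ)] = γ̂_n(1)² v̂_{p,n}(φ) for all N ≥ 1 and each p ∈ {0, …, n}; (2) v̂_{p,n}^N(φ) → v̂_{p,n}(φ) in probability and v̂_{p,n}^N(φ − η̂_n^N(φ)) → v̂_{p,n}(φ − η̂_n(φ)) in probability as N → ∞; (3) E[γ̂_n^N(1)² v̂_n^N(φ)] = γ̂_n(1)² σ̂_n²(φ) for all N ≥ 1, and v̂_n^N(φ) → σ̂_n²(φ) in probability as N → ∞. -/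

import Mathlib

open MeasureTheory ProbabilityTheory Filter
open scoped ENNReal NNReal Classical

noncomputable section

namespace PFVar

variable {X : Type*} [MeasurableSpace X]

/-- The unnormalized Feynman–Kac measures `γ_p`. -/
def gammaFK (M0 : Measure X) (M : ℕ → Kernel X X) (G : ℕ → X → ℝ) : ℕ → Measure X
  | 0 => M0
  | p + 1 =>
      ((gammaFK M0 M G p).withDensity fun x => ENNReal.ofReal (G p x)).bind
        (fun x => M (p + 1) x)

/-- `γ_n(φ)`. -/
def gInt (M0 : Measure X) (M : ℕ → Kernel X X) (G : ℕ → X → ℝ) (n : ℕ) (φ : X → ℝ) : ℝ :=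
  ∫ x, φ x ∂(gammaFK M0 M G n)

/-- `η_n(φ) = γ_n(φ)/γ_n(1)`. -/
def eInt (M0 : Measure X) (M : ℕ → Kernel X X) (G : ℕ → X → ℝ) (n : ℕ) (φ : X → ℝ) : ℝ :=
  gInt M0 M G n φ / gInt M0 M G n 1

/-- Law of the path `(X_0,…,X_k)` of an inhomogeneous Markov chain with initial law `μ0` and
transitions `κ`, recorded as an element of `ℕ → Y` (coordinates beyond `k` are junk). -/
def markovPath {Y : Type*} [MeasurableSpace Y] (μ0 : Measure Y) (κ : ℕ → Y → Measure Y) :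
    ℕ → Measure (ℕ → Y)
  | 0 => μ0.map fun y _ => y
  | k + 1 =>
      (markovPath μ0 κ k).bind fun ω =>
        (κ (k + 1) (ω k)).map fun y => Function.update ω (k + 1) y

/-- Categorical distribution on `{0,…,m−1} ⊆ ℕ` with weights `w`. -/
def cat (m : ℕ) (w : ℕ → ℝ) : Measure ℕ :=
  (∑ j ∈ Finset.range m, ENNReal.ofReal (w j))⁻¹ •
    ∑ j ∈ Finset.range m, ENNReal.ofReal (w j) • Measure.dirac j

/-- Uniform distribution on `{0,…,m−1}`. -/
def unif (m : ℕ) : Measure ℕ := cat m fun _ => 1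

/-- Extend a finite tuple to `ℕ` with junk values. -/
def padF {Y : Type*} [Nonempty Y] {m : ℕ} (f : Fin m → Y) : ℕ → Y := fun i =>
  if h : i < m then f ⟨i, h⟩ else Classical.arbitrary Y

/-- One resampling/mutation step of the particle filter: given the time-`p` configuration `z`,
the joint law of the ancestor indices `A_p` and the time-`p+1` particle configuration;
each of the `Np (p+1)` new particles independently draws an ancestor from the categorical
distribution with weights `G p (z j)`, `j < Np p`, and then moves according to `M (p+1)`. -/
def pfStep [Nonempty X] (M : ℕ → Kernel X X) (G : ℕ → X → ℝ) (Np : ℕ → ℕ) (p : ℕ)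
    (z : ℕ → X) : Measure ((ℕ → ℕ) × (ℕ → X)) :=
  (Measure.pi fun _ : Fin (Np (p + 1)) =>
      (cat (Np p) fun j => G p (z j)).bind fun a =>
        (M (p + 1) (z a)).map fun x => (a, x)).map fun f =>
    (padF fun i => (f i).1, padF fun i => (f i).2)

/-- The law of the particle system `(ζ, A)` run up to time `k`: the first component is
`ζ : time → particle index → X`, the second is `A : time → particle index → ℕ`, where
`A p i` is the ancestor index of particle `i` of generation `p+1`. -/
def pfLaw [Nonempty X] (M0 : Measure X) (M : ℕ → Kernel X X) (G : ℕ → X → ℝ)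
    (Np : ℕ → ℕ) : ℕ → Measure ((ℕ → ℕ → X) × (ℕ → ℕ → ℕ))
  | 0 =>
      (Measure.pi fun _ : Fin (Np 0) => M0).map fun f =>
        (fun p => if p = 0 then padF f else fun _ => Classical.arbitrary X, fun _ _ => 0)
  | k + 1 =>
      (pfLaw M0 M G Np k).bind fun ω =>
        (pfStep M G Np k (ω.1 k)).map fun az =>
          (Function.update ω.1 (k + 1) az.2, Function.update ω.2 k az.1)

/-- Eve indices: `eve A 0 i = i` and `eve A (p+1) i = eve A p (A p i)`. -/
def eve (A : ℕ → ℕ → ℕ) : ℕ → ℕ → ℕ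
  | 0 => fun i => i
  | p + 1 => fun i => eve A p (A p i)

/-- `η_n^N(φ)`. -/
def etaN (Np : ℕ → ℕ) (n : ℕ) (φ : X → ℝ) (ω : (ℕ → ℕ → X) × (ℕ → ℕ → ℕ)) : ℝ :=
  (Np n : ℝ)⁻¹ * ∑ i ∈ Finset.range (Np n), φ (ω.1 n i)

/-- `γ_n^N(φ)`. -/
def gammaN (G : ℕ → X → ℝ) (Np : ℕ → ℕ) (n : ℕ) (φ : X → ℝ)
    (ω : (ℕ → ℕ → X) × (ℕ → ℕ → ℕ)) : ℝ :=
  (∏ p ∈ Finset.range n, etaN Np p (G p) ω) * etaN Np n φ ω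

/-- The variance estimator `V_n^N(φ)`. -/
def Vest (Np : ℕ → ℕ) (n : ℕ) (φ : X → ℝ) (ω : (ℕ → ℕ → X) × (ℕ → ℕ → ℕ)) : ℝ :=
  etaN Np n φ ω ^ 2 -
    (∏ p ∈ Finset.range n, (Np p : ℝ) / ((Np p : ℝ) - 1)) *
      ((Np n : ℝ) * ((Np n : ℝ) - 1))⁻¹ *
      ∑ i ∈ Finset.range (Np n), ∑ j ∈ Finset.range (Np n),
        if eve ω.2 n i ≠ eve ω.2 n j then φ (ω.1 n i) * φ (ω.1 n j) else 0

/-- Initial law of the doubled chain used to define `μ_b`. -/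
def pairInit (M0 : Measure X) (b : ℕ → Bool) : Measure (X × X) :=
  if b 0 then M0.map fun x => (x, x) else M0.prod M0

/-- Transitions of the doubled chain used to define `μ_b`. -/
def pairKer (M : ℕ → Kernel X X) (b : ℕ → Bool) (p : ℕ) (q : X × X) : Measure (X × X) :=
  if b p then (M p q.1).map fun y => (y, y) else (M p q.1).prod (M p q.2)

/-- `μ_b(φ) = E_b[φ(X_n, X_n') ∏_{p<n} G_p(X_p) G_p(X_p')]`. -/
def muB (M0 : Measure X) (M : ℕ → Kernel X X) (G : ℕ → X → ℝ) (n : ℕ) (b : ℕ → Bool)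
    (φ : X × X → ℝ) : ℝ :=
  ∫ ω, φ (ω n) * ∏ p ∈ Finset.range n, G p (ω p).1 * G p (ω p).2
    ∂(markovPath (pairInit M0 b) (pairKer M b) n)

/-- `φ ⊗ φ`. -/
def tens (φ : X → ℝ) : X × X → ℝ := fun q => φ q.1 * φ q.2

/-- The binary string `e_p`. -/
def eVec (p : ℕ) : ℕ → Bool := fun q => q == p

/-- The zero binary string `0_n`. -/
def zeroVec : ℕ → Bool := fun _ => false

/-- Extension of a finite binary string to `ℕ → Bool`. -/
def extB (n : ℕ) (b : Fin (n + 1) → Bool) : ℕ → Bool := fun p =>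
  if h : p < n + 1 then b ⟨p, h⟩ else false

/-- `v_{p,n}(φ) = (μ_{e_p}(φ⊗φ) − μ_{0_n}(φ⊗φ)) / γ_n(1)²`. -/
def vpn (M0 : Measure X) (M : ℕ → Kernel X X) (G : ℕ → X → ℝ) (n p : ℕ) (φ : X → ℝ) : ℝ :=
  (muB M0 M G n (eVec p) (tens φ) - muB M0 M G n zeroVec (tens φ)) / gInt M0 M G n 1 ^ 2

/-- `σ_n²(φ) = Σ_{p=0}^n c_p⁻¹ v_{p,n}(φ)`. -/
def sigma2 (M0 : Measure X) (M : ℕ → Kernel X X) (G : ℕ → X → ℝ) (c : ℕ → ℝ) (n : ℕ)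
    (φ : X → ℝ) : ℝ :=
  ∑ p ∈ Finset.range (n + 1), (c p)⁻¹ * vpn M0 M G n p φ

/-- Particle numbers `N_p = ⌈c_p N⌉`. -/
def npart (c : ℕ → ℝ) (N : ℕ) (p : ℕ) : ℕ := ⌈c p * (N : ℝ)⌉₊

/-- Backward tracing: `traceAux A n kn j = K_{n-j}` where `K_n = kn`, `K_p = A p (K_{p+1})`. -/
def traceAux (A : ℕ → ℕ → ℕ) (n kn : ℕ) : ℕ → ℕ
  | 0 => kn
  | j + 1 => A (n - (j + 1)) (traceAux A n kn j)

/-- The deterministic ancestral trace `K¹`: `trace A n kn p = K_p¹` given `K_n¹ = kn`. -/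
def trace (A : ℕ → ℕ → ℕ) (n kn : ℕ) : ℕ → ℕ := fun p => traceAux A n kn (n - p)

/-- Conditional law of the broken-lineage trace `(K_0²,…,K_p²)` given `K_p² = v`
(entries above `p` are junk, to be overwritten). -/
def k2Law (G : ℕ → X → ℝ) (Np : ℕ → ℕ) (ω : (ℕ → ℕ → X) × (ℕ → ℕ → ℕ)) (K1 : ℕ → ℕ) :
    ℕ → ℕ → Measure (ℕ → ℕ)
  | 0 => fun v => Measure.dirac fun q => if q = 0 then v else 0
  | p + 1 => fun v =>
      ((if v = K1 (p + 1) then cat (Np p) fun j => G p (ω.1 p j)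
          else Measure.dirac (ω.2 p v)).bind fun w =>
        (k2Law G Np ω K1 p w).map fun f => Function.update f (p + 1) v)

/-- Conditional law of `(K¹, K²)` given the particle system `ω = (ζ, A)`. -/
def kLaw (G : ℕ → X → ℝ) (Np : ℕ → ℕ) (n : ℕ) (ω : (ℕ → ℕ → X) × (ℕ → ℕ → ℕ)) :
    Measure ((ℕ → ℕ) × (ℕ → ℕ)) :=
  (unif (Np n)).bind fun k1n =>
    (unif (Np n)).bind fun k2n =>
      (k2Law G Np ω (trace ω.2 n k1n) n k2n).map fun k2 => (trace ω.2 n k1n, k2)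

/-- Joint law of the particle system together with the tracing variables `(K¹, K²)`. -/
def pfkLaw [Nonempty X] (M0 : Measure X) (M : ℕ → Kernel X X) (G : ℕ → X → ℝ)
    (Np : ℕ → ℕ) (n : ℕ) :
    Measure (((ℕ → ℕ → X) × (ℕ → ℕ → ℕ)) × ((ℕ → ℕ) × (ℕ → ℕ))) :=
  (pfLaw M0 M G Np n).bind fun ω => (kLaw G Np n ω).map fun k => (ω, k)

/-- `(k¹, k²) ∈ I(b)`. -/
def inI (Np : ℕ → ℕ) (n : ℕ) (b : ℕ → Bool) (k : (ℕ → ℕ) × (ℕ → ℕ)) : Prop :=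
  ∀ p ≤ n, k.1 p < Np p ∧ k.2 p < Np p ∧ (k.1 p = k.2 p ↔ b p = true)

/-- The particle approximation `μ_b^N(φ)` (a function of the realization `ω = (ζ, A)`);
the conditional expectation given `(A, ζ)` is the integral with respect to `kLaw`. -/
def muBN (G : ℕ → X → ℝ) (Np : ℕ → ℕ) (n : ℕ) (b : ℕ → Bool) (φ : X × X → ℝ)
    (ω : (ℕ → ℕ → X) × (ℕ → ℕ → ℕ)) : ℝ :=
  (∏ p ∈ Finset.range (n + 1),
      if b p then (Np p : ℝ) else (Np p : ℝ) / ((Np p : ℝ) - 1)) *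
    gammaN G Np n 1 ω ^ 2 *
    ∫ k, (if inI Np n b k then (1 : ℝ) else 0) * φ (ω.1 n (k.1 n), ω.1 n (k.2 n))
      ∂(kLaw G Np n ω)

/-- `v_{p,n}^N(φ)`. -/
def vpnN (G : ℕ → X → ℝ) (Np : ℕ → ℕ) (n p : ℕ) (φ : X → ℝ)
    (ω : (ℕ → ℕ → X) × (ℕ → ℕ → ℕ)) : ℝ :=
  (muBN G Np n (eVec p) (tens φ) ω - muBN G Np n zeroVec (tens φ) ω) / gammaN G Np n 1 ω ^ 2

/-- `v_n^N(φ) = Σ_{p=0}^n c_p⁻¹ v_{p,n}^N(φ)`. -/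
def vnN (G : ℕ → X → ℝ) (Np : ℕ → ℕ) (c : ℕ → ℝ) (n : ℕ) (φ : X → ℝ)
    (ω : (ℕ → ℕ → X) × (ℕ → ℕ → ℕ)) : ℝ :=
  ∑ p ∈ Finset.range (n + 1), (c p)⁻¹ * vpnN G Np n p φ ω

/-- `QAux M G n φ j = Q_{n-j,n}(φ)`. -/
def QAux (M : ℕ → Kernel X X) (G : ℕ → X → ℝ) (n : ℕ) (φ : X → ℝ) : ℕ → X → ℝ
  | 0 => φ
  | j + 1 => fun x => G (n - (j + 1)) x * ∫ y, QAux M G n φ j y ∂(M (n - j) x)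

/-- `Q_{p,n}(φ)` where `Q_p(x, dx') = G_{p-1}(x) M_p(x, dx')`, `Q_{n,n} = Id`,
`Q_{p,n} = Q_{p+1} ⋯ Q_n`. -/
def Qpn (M : ℕ → Kernel X X) (G : ℕ → X → ℝ) (n p : ℕ) (φ : X → ℝ) : X → ℝ :=
  QAux M G n φ (n - p)

/-- `φ̂ = G_n · φ`. -/
def hatf (G : ℕ → X → ℝ) (n : ℕ) (φ : X → ℝ) : X → ℝ := fun x => G n x * φ x

/-- `γ̂_n(φ) = γ_n(G_n φ)`. -/
def gHatInt (M0 : Measure X) (M : ℕ → Kernel X X) (G : ℕ → X → ℝ) (n : ℕ) (φ : X → ℝ) : ℝ :=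
  gInt M0 M G n (hatf G n φ)

/-- `η̂_n(φ) = γ̂_n(φ)/γ̂_n(1)`. -/
def eHatInt (M0 : Measure X) (M : ℕ → Kernel X X) (G : ℕ → X → ℝ) (n : ℕ) (φ : X → ℝ) : ℝ :=
  gHatInt M0 M G n φ / gHatInt M0 M G n 1

/-- `γ̂_n^N(φ) = γ_n^N(G_n φ)`. -/
def gammaHatN (G : ℕ → X → ℝ) (Np : ℕ → ℕ) (n : ℕ) (φ : X → ℝ)
    (ω : (ℕ → ℕ → X) × (ℕ → ℕ → ℕ)) : ℝ :=
  gammaN G Np n (hatf G n φ) ω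

/-- `η̂_n^N(φ) = γ̂_n^N(φ)/γ̂_n^N(1)`. -/
def etaHatN (G : ℕ → X → ℝ) (Np : ℕ → ℕ) (n : ℕ) (φ : X → ℝ)
    (ω : (ℕ → ℕ → X) × (ℕ → ℕ → ℕ)) : ℝ :=
  gammaHatN G Np n φ ω / gammaHatN G Np n 1 ω

/-- `v̂_{p,n}(φ) = v_{p,n}(φ̂)/η_n(G_n)²`. -/
def vpnHat (M0 : Measure X) (M : ℕ → Kernel X X) (G : ℕ → X → ℝ) (n p : ℕ) (φ : X → ℝ) : ℝ :=
  vpn M0 M G n p (hatf G n φ) / eInt M0 M G n (G n) ^ 2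

/-- `σ̂_n²(φ) = Σ_{p=0}^n c_p⁻¹ v̂_{p,n}(φ)`. -/
def sigma2Hat (M0 : Measure X) (M : ℕ → Kernel X X) (G : ℕ → X → ℝ) (c : ℕ → ℝ) (n : ℕ)
    (φ : X → ℝ) : ℝ :=
  ∑ p ∈ Finset.range (n + 1), (c p)⁻¹ * vpnHat M0 M G n p φ

/-- `V̂_n^N(φ) = V_n^N(φ̂)/η_n^N(G_n)²`. -/
def VestHat (G : ℕ → X → ℝ) (Np : ℕ → ℕ) (n : ℕ) (φ : X → ℝ)
    (ω : (ℕ → ℕ → X) × (ℕ → ℕ → ℕ)) : ℝ :=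
  Vest Np n (hatf G n φ) ω / etaN Np n (G n) ω ^ 2

/-- `v̂_{p,n}^N(φ) = v_{p,n}^N(φ̂)/η_n^N(G_n)²`. -/
def vpnHatN (G : ℕ → X → ℝ) (Np : ℕ → ℕ) (n p : ℕ) (φ : X → ℝ)
    (ω : (ℕ → ℕ → X) × (ℕ → ℕ → ℕ)) : ℝ :=
  vpnN G Np n p (hatf G n φ) ω / etaN Np n (G n) ω ^ 2

/-- `v̂_n^N(φ) = Σ_{p=0}^n c_p⁻¹ v̂_{p,n}^N(φ)`. -/
def vnHatN (G : ℕ → X → ℝ) (Np : ℕ → ℕ) (c : ℕ → ℝ) (n : ℕ) (φ : X → ℝ)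
    (ω : (ℕ → ℕ → X) × (ℕ → ℕ → ℕ)) : ℝ :=
  ∑ p ∈ Finset.range (n + 1), (c p)⁻¹ * vpnHatN G Np n p φ ω

open PFVar MeasureTheory ProbabilityTheory Filter

/-- Bounded measurable real functions. -/
structure BddMeas {Y : Type*} [MeasurableSpace Y] (f : Y → ℝ) : Prop where
  meas : Measurable f
  bdd : ∃ C, ∀ y, |f y| ≤ C

namespace BddMeas

variable {Y Z : Type*} [MeasurableSpace Y] [MeasurableSpace Z] {f g : Y → ℝ}

lemma exists_pos (hf : BddMeas f) : ∃ C, 0 < C ∧ ∀ y, |f y| ≤ C := by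
  obtain ⟨C, hC⟩ := hf.bdd
  exact ⟨max C 1, by positivity, fun y => (hC y).trans (le_max_left _ _)⟩

lemma const (a : ℝ) : BddMeas fun _ : Y => a := ⟨measurable_const, |a|, fun _ => le_rfl⟩

lemma add (hf : BddMeas f) (hg : BddMeas g) : BddMeas fun y => f y + g y := by
  obtain ⟨C, hC⟩ := hf.bdd
  obtain ⟨D, hD⟩ := hg.bdd
  exact ⟨hf.meas.add hg.meas, C + D, fun y => (abs_add_le _ _).trans (add_le_add (hC y) (hD y))⟩

lemma mul (hf : BddMeas f) (hg : BddMeas g) : BddMeas fun y => f y * g y := by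
  obtain ⟨C, hC0, hC⟩ := hf.exists_pos
  obtain ⟨D, hD⟩ := hg.bdd
  refine ⟨hf.meas.mul hg.meas, C * D, fun y => ?_⟩
  rw [abs_mul]
  exact mul_le_mul (hC y) (hD y) (abs_nonneg _) hC0.le

lemma pow (hf : BddMeas f) (k : ℕ) : BddMeas fun y => f y ^ k := by
  induction k with
  | zero => simpa using const 1
  | succ k ih => simpa only [pow_succ] using ih.mul hf

lemma sum {ι : Type*} (s : Finset ι) {f : ι → Y → ℝ} (hf : ∀ i ∈ s, BddMeas (f i)) :
    BddMeas fun y => ∑ i ∈ s, f i y := by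
  induction s using Finset.induction_on with
  | empty => simpa using const 0
  | insert a s ha ih =>
    simp only [Finset.sum_insert ha]
    exact (hf a (by simp)).add (ih fun i hi => hf i (by simp [hi]))

lemma prod {ι : Type*} (s : Finset ι) {f : ι → Y → ℝ} (hf : ∀ i ∈ s, BddMeas (f i)) :
    BddMeas fun y => ∏ i ∈ s, f i y := by
  induction s using Finset.induction_on with
  | empty => simpa using const 1
  | insert a s ha ih =>
    simp only [Finset.prod_insert ha]
    exact (hf a (by simp)).mul (ih fun i hi => hf i (by simp [hi]))

lemma comp (hf : BddMeas f) {u : Z → Y} (hu : Measurable u) : BddMeas fun z => f (u z) :=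
  ⟨hf.meas.comp hu, hf.bdd.imp fun _ h z => h (u z)⟩

lemma integrable (hf : BddMeas f) (μ : Measure Y) [IsFiniteMeasure μ] : Integrable f μ := by
  obtain ⟨C, hC⟩ := hf.bdd
  exact Integrable.of_bound hf.meas.aestronglyMeasurable C (Eventually.of_forall hC)

lemma integral_kernel {F : Z × Y → ℝ} (hF : BddMeas F) {κ : Z → Measure Y} (hκ : Measurable κ)
    (hp : ∀ z, IsProbabilityMeasure (κ z)) : BddMeas fun z => ∫ y, F (z, y) ∂(κ z) := by
  let k : Kernel Z Y := ⟨κ, hκ⟩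
  have hk : IsMarkovKernel k := ⟨hp⟩
  refine ⟨?_, ?_⟩
  · exact (StronglyMeasurable.integral_kernel_prod_right' (κ := k)
      hF.meas.stronglyMeasurable).measurable
  · obtain ⟨C, hC⟩ := hF.bdd
    refine ⟨C, fun z => ?_⟩
    have h := norm_integral_le_of_norm_le_const (μ := κ z) (f := fun y => F (z, y)) (C := C)
      (Eventually.of_forall fun y => hC (z, y))
    simpa using h

end BddMeas

lemma integral_bind_of_bddMeas {Y Z : Type*} [MeasurableSpace Y] [MeasurableSpace Z]
    {μ : Measure Y} [IsFiniteMeasure μ] {κ : Y → Measure Z} (hκ : Measurable κ)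
    (hp : ∀ y, IsProbabilityMeasure (κ y)) {F : Z → ℝ} (hF : BddMeas F) :
    ∫ z, F z ∂(μ.bind κ) = ∫ y, ∫ z, F z ∂(κ y) ∂μ := by
  let k : Kernel Y Z := ⟨κ, hκ⟩
  have hk : IsMarkovKernel k := ⟨hp⟩
  have h := Kernel.integral_comp (η := k) (κ := Kernel.const Unit μ) (a := ()) (f := F)
    (hF.integrable _)
  rw [Kernel.comp_apply, Kernel.const_apply] at h
  exact h

lemma isProbabilityMeasure_bind {Y Z : Type*} [MeasurableSpace Y] [MeasurableSpace Z]
    {μ : Measure Y} [IsProbabilityMeasure μ] {κ : Y → Measure Z} (hκ : Measurable κ)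
    (hp : ∀ y, IsProbabilityMeasure (κ y)) : IsProbabilityMeasure (μ.bind κ) :=
  ⟨by rw [Measure.bind_apply MeasurableSet.univ hκ.aemeasurable]; simp⟩

lemma measurable_map_kernel {Y Z W : Type*} [MeasurableSpace Y] [MeasurableSpace Z]
    [MeasurableSpace W] {κ : Y → Measure Z} (hκ : Measurable κ)
    (hp : ∀ y, IsProbabilityMeasure (κ y)) {f : Y → Z → W}
    (hf : Measurable fun q : Y × Z => f q.1 q.2) : Measurable fun y => (κ y).map (f y) := by
  let k : Kernel Y Z := ⟨κ, hκ⟩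
  have hk : IsMarkovKernel k := ⟨hp⟩
  refine Measure.measurable_of_measurable_coe _ fun s hs => ?_
  have : ∀ y, (κ y).map (f y) s = k y (Prod.mk y ⁻¹' ((fun q : Y × Z => f q.1 q.2) ⁻¹' s)) := by
    intro y
    rw [Measure.map_apply (f := f y) (hf.comp measurable_prodMk_left) hs]
    rfl
  simp_rw [this]
  exact Kernel.measurable_kernel_prodMk_left (hf hs)

section Sampling

variable {Y : Type*} [MeasurableSpace Y] (ρ : Measure Y) [IsProbabilityMeasure ρ] {N : ℕ}

lemma iIndepFun_eval : iIndepFun (fun (i : Fin N) (y : Fin N → Y) => y i)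
    (Measure.pi fun _ : Fin N => ρ) :=
  iIndepFun_pi (X := fun _ => id) fun _ => aemeasurable_id

lemma map_eval_pi (i : Fin N) : (Measure.pi fun _ : Fin N => ρ).map (fun y => y i) = ρ :=
  (measurePreserving_eval (fun _ : Fin N => ρ) i).map_eq

lemma map_eval_pair {i j : Fin N} (hij : i ≠ j) :
    (Measure.pi fun _ : Fin N => ρ).map (fun y => (y i, y j)) = ρ.prod ρ := by
  have h := ((iIndepFun_eval ρ (N := N)).indepFun hij)
  rw [indepFun_iff_map_prod_eq_prod_map_map
      (Measurable.aemeasurable (by fun_prop)) (Measurable.aemeasurable (by fun_prop)), map_eval_pi,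
    map_eval_pi] at h
  exact h

lemma map_eval_triple {i j k : Fin N} (hij : i ≠ j) (hik : i ≠ k) (hjk : j ≠ k) :
    (Measure.pi fun _ : Fin N => ρ).map (fun y => ((y j, y k), y i)) = (ρ.prod ρ).prod ρ := by
  have h := ((iIndepFun_eval ρ (N := N)).indepFun_prodMk (by fun_prop) j k i hij.symm hik.symm)
  rw [indepFun_iff_map_prod_eq_prod_map_map
      (Measurable.aemeasurable (by fun_prop)) (Measurable.aemeasurable (by fun_prop)), map_eval_pi,
    map_eval_pair ρ hjk] at h
  exact h

lemma integral_eval {f : Y → ℝ} (hf : Measurable f) (i : Fin N) :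
    ∫ y, f (y i) ∂(Measure.pi fun _ : Fin N => ρ) = ∫ x, f x ∂ρ := by
  conv_rhs => rw [← map_eval_pi ρ i]
  rw [integral_map (Measurable.aemeasurable (by fun_prop)) hf.aestronglyMeasurable]

lemma integral_eval_pair {f : Y × Y → ℝ} (hf : Measurable f) {i j : Fin N} (hij : i ≠ j) :
    ∫ y, f (y i, y j) ∂(Measure.pi fun _ : Fin N => ρ) = ∫ x, f x ∂(ρ.prod ρ) := by
  rw [← map_eval_pair ρ hij, integral_map (Measurable.aemeasurable (by fun_prop)) hf.aestronglyMeasurable]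

lemma integral_eval_triple {g : Y × Y → ℝ} (hg : BddMeas g) {i j k : Fin N}
    (hij : i ≠ j) (hik : i ≠ k) (hjk : j ≠ k) :
    ∫ y, g (y i, y j) * g (y i, y k) ∂(Measure.pi fun _ : Fin N => ρ)
      = ∫ x, (∫ y, g (x, y) ∂ρ) ^ 2 ∂ρ := by
  have hF : BddMeas fun q : (Y × Y) × Y => g (q.2, q.1.1) * g (q.2, q.1.2) :=
    (hg.comp (u := fun q : (Y × Y) × Y => (q.2, q.1.1)) (by fun_prop)).mul
      (hg.comp (u := fun q : (Y × Y) × Y => (q.2, q.1.2)) (by fun_prop))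
  have h1 : ∫ y, g (y i, y j) * g (y i, y k) ∂(Measure.pi fun _ : Fin N => ρ)
      = ∫ q, g (q.2, q.1.1) * g (q.2, q.1.2) ∂((ρ.prod ρ).prod ρ) := by
    rw [← map_eval_triple ρ hij hik hjk, integral_map (by fun_prop)
      hF.meas.aestronglyMeasurable]
  rw [h1, integral_prod_symm _ (hF.integrable _)]
  refine integral_congr_ae (Eventually.of_forall fun x => ?_)
  simp only
  rw [integral_prod_mul (μ := ρ) (ν := ρ) (fun y => g (x, y)) (fun y => g (x, y)), sq]

lemma integral_sum_eval {f : Y → ℝ} (hf : BddMeas f) :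
    ∫ y, ∑ i, f (y i) ∂(Measure.pi fun _ : Fin N => ρ) = N * ∫ x, f x ∂ρ := by
  rw [integral_finsetSum _ fun i _ => (hf.comp (measurable_pi_apply i)).integrable _]
  simp [integral_eval ρ hf.meas]

lemma integral_sum_offDiag {h : Y × Y → ℝ} (hh : BddMeas h) :
    ∫ y, ∑ a ∈ (Finset.univ : Finset (Fin N)).offDiag, h (y a.1, y a.2)
        ∂(Measure.pi fun _ : Fin N => ρ) = N * (N - 1) * ∫ x, h x ∂(ρ.prod ρ) := by
  rw [integral_finsetSum _ fun a _ =>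
    (hh.comp (u := fun y : Fin N → Y => (y a.1, y a.2)) (by fun_prop)).integrable _]
  rw [Finset.sum_congr rfl fun a ha => integral_eval_pair ρ hh.meas (Finset.mem_offDiag.1 ha).2.2]
  rw [Finset.sum_const, Finset.offDiag_card, nsmul_eq_mul, Finset.card_univ, Fintype.card_fin,
    Nat.cast_sub (Nat.le_mul_self N)]
  push_cast
  ring

lemma integral_sum_eval_sq_le {f : Y → ℝ} (hf : BddMeas f) :
    ∫ y, (∑ i, f (y i)) ^ 2 ∂(Measure.pi fun _ : Fin N => ρ)
      ≤ (N * ∫ x, f x ∂ρ) ^ 2 + N * ∫ x, f x ^ 2 ∂ρ := by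
  set s := ∫ x, f x ^ 2 ∂ρ with hs
  set t := ∫ x, f x ∂ρ with ht
  have hs0 : 0 ≤ s := integral_nonneg fun x => sq_nonneg _
  have hb : ∀ i j : Fin N, BddMeas fun y : Fin N → Y => f (y i) * f (y j) := fun i j =>
    (hf.comp (measurable_pi_apply i)).mul (hf.comp (measurable_pi_apply j))
  have key : ∀ i j : Fin N, ∫ y, f (y i) * f (y j) ∂(Measure.pi fun _ : Fin N => ρ)
      ≤ t ^ 2 + if i = j then s else 0 := by
    intro i j
    split_ifs with hij
    · subst hij
      have := integral_eval ρ (hf.pow 2).meas i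
      simp only [sq] at this hs ⊢
      rw [this, ← hs]
      nlinarith [mul_self_nonneg t]
    · have := integral_eval_pair ρ (f := fun q => f q.1 * f q.2)
        ((hf.meas.comp measurable_fst).mul (hf.meas.comp measurable_snd)) hij
      rw [this, integral_prod_mul (μ := ρ) (ν := ρ) f f, ← ht, add_zero, sq]
  simp_rw [sq (∑ i, f _), Finset.sum_mul_sum]
  rw [integral_finsetSum _ fun i _ => (BddMeas.sum _ fun j _ => hb i j).integrable _]
  simp_rw [integral_finsetSum _ fun j _ => (hb _ j).integrable _]
  refine (Finset.sum_le_sum fun i _ => Finset.sum_le_sum fun j _ => key i j).trans (le_of_eq ?_)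
  simp [Finset.sum_add_distrib]
  ring

lemma integral_sum_offDiag_sq_le {h g : Y × Y → ℝ} (hh : BddMeas h) (hg : BddMeas g)
    (hhg : ∀ q, |h q| ≤ g q) (hsymm : ∀ q, g q.swap = g q) :
    ∫ y, (∑ a ∈ (Finset.univ : Finset (Fin N)).offDiag, h (y a.1, y a.2)) ^ 2
        ∂(Measure.pi fun _ : Fin N => ρ)
      ≤ (N * (N - 1) * ∫ x, h x ∂(ρ.prod ρ)) ^ 2
        + 4 * N ^ 3 * ∫ x, (∫ y, g (x, y) ∂ρ) ^ 2 ∂ρ + 2 * N ^ 2 * ∫ x, g x ^ 2 ∂(ρ.prod ρ) := by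
  set s := ∫ x, g x ^ 2 ∂(ρ.prod ρ) with hs
  set t := ∫ x, h x ∂(ρ.prod ρ) with ht
  set r := ∫ x, (∫ y, g (x, y) ∂ρ) ^ 2 ∂ρ with hr
  have hs0 : 0 ≤ s := integral_nonneg fun x => sq_nonneg _
  have hr0 : 0 ≤ r := integral_nonneg fun x => sq_nonneg _
  have ht0 : 0 ≤ t ^ 2 := sq_nonneg _
  have hev : ∀ {f : Y × Y → ℝ}, BddMeas f → ∀ a : Fin N × Fin N,
      BddMeas fun y : Fin N → Y => f (y a.1, y a.2) := fun hf a =>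
    hf.comp (u := fun y : Fin N → Y => (y a.1, y a.2)) (by fun_prop)
  have hb : ∀ {f : Y × Y → ℝ}, BddMeas f → ∀ a b : Fin N × Fin N,
      BddMeas fun y : Fin N → Y => f (y a.1, y a.2) * f (y b.1, y b.2) :=
    fun hf a b => (hev hf a).mul (hev hf b)
  have hle : ∀ a b : Fin N × Fin N,
      ∫ y, h (y a.1, y a.2) * h (y b.1, y b.2) ∂(Measure.pi fun _ : Fin N => ρ)
        ≤ ∫ y, g (y a.1, y a.2) * g (y b.1, y b.2) ∂(Measure.pi fun _ : Fin N => ρ) := by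
    intro a b
    refine integral_mono ((hb hh a b).integrable _) ((hb hg a b).integrable _) fun y => ?_
    refine (le_abs_self _).trans ?_
    rw [abs_mul]
    exact mul_le_mul (hhg _) (hhg _) (abs_nonneg _) ((abs_nonneg _).trans (hhg _))
  have hsw : ∀ (y : Fin N → Y) (i j : Fin N), g (y i, y j) = g (y j, y i) := fun y i j =>
    (hsymm (y i, y j)).symm
  have key : ∀ a ∈ (Finset.univ : Finset (Fin N)).offDiag,
      ∀ b ∈ (Finset.univ : Finset (Fin N)).offDiag,
      ∫ y, h (y a.1, y a.2) * h (y b.1, y b.2) ∂(Measure.pi fun _ : Fin N => ρ)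
      ≤ t ^ 2 + (((if a.1 = b.1 then r else 0) + (if a.2 = b.2 then r else 0)
          + (if a.1 = b.2 then r else 0) + (if a.2 = b.1 then r else 0))
        + ((if a.1 = b.1 then (if a.2 = b.2 then s else 0) else 0)
          + (if a.1 = b.2 then (if a.2 = b.1 then s else 0) else 0))) := by
    rintro ⟨i, j⟩ ha ⟨k, l⟩ hb'
    have hij : i ≠ j := (Finset.mem_offDiag.1 ha).2.2
    have hkl : k ≠ l := (Finset.mem_offDiag.1 hb').2.2
    have hpair : ∫ y, g (y i, y j) * g (y i, y j) ∂(Measure.pi fun _ : Fin N => ρ) = s := by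
      have := integral_eval_pair ρ (hg.pow 2).meas hij
      simp only [sq] at this hs ⊢
      rw [this, hs]
    have htriple : ∀ {a b c : Fin N}, a ≠ b → a ≠ c → b ≠ c →
        ∫ y, g (y a, y b) * g (y a, y c) ∂(Measure.pi fun _ : Fin N => ρ) = r :=
      fun hab hac hbc => integral_eval_triple ρ hg hab hac hbc
    dsimp only
    by_cases hdisj : i ≠ k ∧ i ≠ l ∧ j ≠ k ∧ j ≠ l
    · obtain ⟨h1, h2, h3, h4⟩ := hdisj
      have hind := (iIndepFun_eval ρ (N := N)).indepFun_prodMk_prodMk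
        (fun i => measurable_pi_apply i) i j k l h1 h2 h3 h4
      rw [hind.integral_fun_comp_mul_comp (f := h) (g := h)
        (Measurable.aemeasurable (by fun_prop)) (Measurable.aemeasurable (by fun_prop))
        hh.meas.aestronglyMeasurable hh.meas.aestronglyMeasurable,
        integral_eval_pair ρ hh.meas hij, integral_eval_pair ρ hh.meas hkl, ← ht]
      simp [h1, h2, h3, h4, sq]
    refine (hle (i, j) (k, l)).trans ?_
    dsimp only
    by_cases h1 : i = k
    · subst h1
      by_cases h2 : j = l
      · subst h2
        rw [hpair]
        split_ifs <;> first | linarith | simp_all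
      · rw [htriple hij hkl h2]
        split_ifs <;> first | linarith | simp_all
    by_cases h2 : j = l
    · subst h2
      simp_rw [hsw _ i j, hsw _ k j]
      rw [htriple hij.symm hkl.symm h1]
      split_ifs <;> first | linarith | simp_all
    by_cases h3 : i = l
    · subst h3
      by_cases h4 : j = k
      · subst h4
        simp_rw [hsw _ j i]
        rw [hpair]
        split_ifs <;> first | linarith | simp_all
      · simp_rw [hsw _ k i]
        rw [htriple hij hkl.symm h4]
        split_ifs <;> first | linarith | simp_all
    by_cases h4 : j = k
    · subst h4
      simp_rw [hsw _ i j]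
      rw [htriple hij.symm hkl h3]
      split_ifs <;> first | linarith | simp_all
    exact absurd ⟨h1, h3, h4, h2⟩ hdisj
  simp_rw [sq (∑ a ∈ _, h _), Finset.sum_mul_sum]
  rw [integral_finsetSum _ fun a _ => (BddMeas.sum _ fun b _ => hb hh a b).integrable _]
  simp_rw [integral_finsetSum _ fun b _ => (hb hh _ b).integrable _]
  refine (Finset.sum_le_sum fun a ha => Finset.sum_le_sum fun b hb => key a ha b hb).trans ?_
  have hsplit : ∀ (S : Finset (Fin N × Fin N)) (F : Fin N × Fin N → Fin N × Fin N → ℝ),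
      ∑ a ∈ S, ∑ b ∈ S, (t ^ 2 + F a b) = ∑ a ∈ S, ∑ b ∈ S, t ^ 2 + ∑ a ∈ S, ∑ b ∈ S, F a b := by
    intro S F
    simp only [Finset.sum_add_distrib]
  rw [hsplit, add_assoc]
  refine add_le_add (le_of_eq ?_) ?_
  · simp only [Finset.sum_const, Finset.offDiag_card, nsmul_eq_mul, Finset.card_univ,
      Fintype.card_fin, Nat.cast_sub (Nat.le_mul_self N)]
    push_cast
    ring
  · have hpos : ∀ a b : Fin N × Fin N, 0 ≤
        (((if a.1 = b.1 then r else 0) + (if a.2 = b.2 then r else 0)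
          + (if a.1 = b.2 then r else 0) + (if a.2 = b.1 then r else 0))
        + ((if a.1 = b.1 then (if a.2 = b.2 then s else 0) else 0)
          + (if a.1 = b.2 then (if a.2 = b.1 then s else 0) else 0))) := by
      intro a b
      split_ifs <;> linarith
    calc _ ≤ ∑ a : Fin N × Fin N, ∑ b : Fin N × Fin N,
        (((if a.1 = b.1 then r else 0) + (if a.2 = b.2 then r else 0)
          + (if a.1 = b.2 then r else 0) + (if a.2 = b.1 then r else 0))
        + ((if a.1 = b.1 then (if a.2 = b.2 then s else 0) else 0)
          + (if a.1 = b.2 then (if a.2 = b.1 then s else 0) else 0))) := by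
          refine le_trans (Finset.sum_le_sum fun a _ => ?_)
            (Finset.sum_le_sum_of_subset_of_nonneg (Finset.subset_univ _)
              fun a _ _ => Finset.sum_nonneg fun b _ => hpos a b)
          exact Finset.sum_le_sum_of_subset_of_nonneg (Finset.subset_univ _)
            fun b _ _ => hpos a b
      _ = _ := by
          have hc : ∀ F : Fin N → Fin N → Fin N → Fin N → ℝ,
              ∑ a : Fin N × Fin N, ∑ b : Fin N × Fin N, F a.1 a.2 b.1 b.2
                = ∑ i, ∑ j, ∑ k, ∑ l, F i j k l := by
            intro F
            simp only [Fintype.sum_prod_type]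
          rw [hc fun i j k l => (((if i = k then r else 0) + (if j = l then r else 0)
            + (if i = l then r else 0) + (if j = k then r else 0))
            + ((if i = k then (if j = l then s else 0) else 0)
              + (if i = l then (if j = k then s else 0) else 0)))]
          simp [Finset.sum_add_distrib, ← Finset.mul_sum]
          ring

lemma integral_sum_sq_sum_offDiag_le {g : Y × Y → ℝ} (hg : BddMeas g) :
    ∫ y, ∑ i, (∑ j, if i = j then 0 else g (y i, y j)) ^ 2 ∂(Measure.pi fun _ : Fin N => ρ)
      ≤ N ^ 3 * ∫ x, (∫ y, g (x, y) ∂ρ) ^ 2 ∂ρ + N ^ 2 * ∫ x, g x ^ 2 ∂(ρ.prod ρ) := by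
  set s := ∫ x, g x ^ 2 ∂(ρ.prod ρ) with hs
  set r := ∫ x, (∫ y, g (x, y) ∂ρ) ^ 2 ∂ρ with hr
  have hs0 : 0 ≤ s := integral_nonneg fun x => sq_nonneg _
  have hr0 : 0 ≤ r := integral_nonneg fun x => sq_nonneg _
  have hev : ∀ i j : Fin N, BddMeas fun y : Fin N → Y => if i = j then 0 else g (y i, y j) := by
    intro i j
    split_ifs
    · exact BddMeas.const 0
    · exact hg.comp (u := fun y : Fin N → Y => (y i, y j)) (by fun_prop)
  have key : ∀ i j k : Fin N, ∫ y, (if i = j then 0 else g (y i, y j)) *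
      (if i = k then 0 else g (y i, y k)) ∂(Measure.pi fun _ : Fin N => ρ)
        ≤ r + if j = k then s else 0 := by
    intro i j k
    by_cases hij : i = j
    · simp only [hij, if_true, zero_mul, integral_zero]
      split_ifs <;> linarith
    by_cases hik : i = k
    · simp only [hik, if_true, mul_zero, integral_zero]
      split_ifs <;> linarith
    simp only [hij, hik, if_false]
    by_cases hjk : j = k
    · subst hjk
      have := integral_eval_pair ρ (hg.pow 2).meas hij
      simp only [sq] at this hs ⊢
      rw [this, ← hs]
      simpa using hr0
    · rw [integral_eval_triple ρ hg hij hik hjk]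
      simp [hjk, hr]
  simp_rw [sq (∑ j, ite _ _ _), Finset.sum_mul_sum]
  rw [integral_finsetSum _ fun i _ => (BddMeas.sum _ fun j _ => BddMeas.sum _ fun k _ =>
    (hev i j).mul (hev i k)).integrable _]
  simp_rw [integral_finsetSum _ fun j _ => (BddMeas.sum _ fun k _ =>
    (hev _ j).mul (hev _ k)).integrable _, integral_finsetSum _ fun k _ =>
    ((hev _ _).mul (hev _ k)).integrable _]
  refine (Finset.sum_le_sum fun i _ => Finset.sum_le_sum fun j _ => Finset.sum_le_sum fun k _ =>
    key i j k).trans (le_of_eq ?_)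
  simp [Finset.sum_add_distrib]
  ring

end Sampling

section Cat

lemma sum_ofReal_ne_zero {m : ℕ} {w : ℕ → ℝ} (hs : 0 < ∑ j ∈ Finset.range m, w j) :
    ∑ j ∈ Finset.range m, ENNReal.ofReal (w j) ≠ 0 := by
  intro h
  rw [Finset.sum_eq_zero_iff] at h
  exact absurd hs (not_lt.2 (Finset.sum_nonpos fun j hj => ENNReal.ofReal_eq_zero.1 (h j hj)))

lemma sum_ofReal_ne_top (m : ℕ) (w : ℕ → ℝ) :
    ∑ j ∈ Finset.range m, ENNReal.ofReal (w j) ≠ ∞ :=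
  (ENNReal.sum_lt_top.2 fun _ _ => ENNReal.ofReal_lt_top).ne

lemma isProbabilityMeasure_cat {m : ℕ} {w : ℕ → ℝ} (hs : 0 < ∑ j ∈ Finset.range m, w j) :
    IsProbabilityMeasure (cat m w) := by
  refine ⟨?_⟩
  simp only [cat, Measure.smul_apply, Measure.finsetSum_apply, measure_univ, smul_eq_mul, mul_one]
  exact ENNReal.inv_mul_cancel (sum_ofReal_ne_zero hs) (sum_ofReal_ne_top m w)

lemma integral_cat {m : ℕ} {w : ℕ → ℝ} (hw : ∀ j < m, 0 ≤ w j) (F : ℕ → ℝ) :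
    ∫ a, F a ∂(cat m w)
      = (∑ j ∈ Finset.range m, w j)⁻¹ * ∑ j ∈ Finset.range m, w j * F j := by
  have hF : ∀ j, Integrable F (ENNReal.ofReal (w j) • Measure.dirac j) := fun j =>
    (integrable_dirac (by finiteness)).smul_measure ENNReal.ofReal_ne_top
  rw [cat, integral_smul_measure, integral_finsetSum_measure fun j _ => hF j, smul_eq_mul,
    ENNReal.toReal_inv, ENNReal.toReal_sum fun _ _ => ENNReal.ofReal_ne_top]
  congr 1
  · congr 1
    exact Finset.sum_congr rfl fun j hj => ENNReal.toReal_ofReal (hw j (Finset.mem_range.1 hj))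
  · refine Finset.sum_congr rfl fun j hj => ?_
    rw [integral_smul_measure, integral_dirac, smul_eq_mul,
      ENNReal.toReal_ofReal (hw j (Finset.mem_range.1 hj))]

lemma cat_bind_apply {Z : Type*} [MeasurableSpace Z] (m : ℕ) (w : ℕ → ℝ) (κ : ℕ → Measure Z)
    {s : Set Z} (hs : MeasurableSet s) :
    (cat m w).bind κ s = (∑ j ∈ Finset.range m, ENNReal.ofReal (w j))⁻¹ *
      ∑ j ∈ Finset.range m, ENNReal.ofReal (w j) * κ j s := by
  rw [Measure.bind_apply hs (Measurable.of_discrete).aemeasurable, cat, lintegral_smul_measure,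
    lintegral_finsetSum_measure]
  simp [lintegral_smul_measure]

end Cat

/-- Standing assumptions on the potentials and the particle numbers up to time `n`. -/
structure Setup (n : ℕ) (G : ℕ → X → ℝ) (Np : ℕ → ℕ) : Prop where
  meas : ∀ p ≤ n, Measurable (G p)
  pos : ∀ p ≤ n, ∀ x, 0 < G p x
  bd : ∀ p ≤ n, ∃ C, ∀ x, G p x ≤ C
  two : ∀ p ≤ n, 2 ≤ Np p

namespace Setup

variable {n : ℕ} {G : ℕ → X → ℝ} {Np : ℕ → ℕ}

lemma bddMeas (h : Setup n G Np) {p : ℕ} (hp : p ≤ n) : BddMeas (G p) := by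
  obtain ⟨C, hC⟩ := h.bd p hp
  exact ⟨h.meas p hp, C, fun y => by rw [abs_of_pos (h.pos p hp y)]; exact hC y⟩

lemma sum_pos (h : Setup n G Np) {p : ℕ} (hp : p ≤ n) (z : ℕ → X) :
    0 < ∑ j ∈ Finset.range (Np p), G p (z j) :=
  Finset.sum_pos (fun j _ => h.pos p hp _)
    ⟨0, Finset.mem_range.2 (by have := h.two p hp; omega)⟩

end Setup

/-- Law of the ancestor index and position of a new particle, given the configuration `z`. -/
def newLaw (M : ℕ → Kernel X X) (G : ℕ → X → ℝ) (Np : ℕ → ℕ) (p : ℕ) (z : ℕ → X) :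
    Measure (ℕ × X) :=
  (cat (Np p) fun j => G p (z j)).bind fun a => (M (p + 1) (z a)).map fun x => (a, x)

/-- The particle system after appending a generation. -/
def append [Nonempty X] {N : ℕ} (k : ℕ) (ω : (ℕ → ℕ → X) × (ℕ → ℕ → ℕ)) (y : Fin N → ℕ × X) :
    (ℕ → ℕ → X) × (ℕ → ℕ → ℕ) :=
  (Function.update ω.1 (k + 1) (padF fun i => (y i).2),
    Function.update ω.2 k (padF fun i => (y i).1))

lemma measurable_padF {Y Z : Type*} [MeasurableSpace Y] [MeasurableSpace Z] [Nonempty Y] {m : ℕ}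
    {f : Z → Fin m → Y} (hf : Measurable f) : Measurable fun z => padF (f z) := by
  refine measurable_pi_lambda _ fun i => ?_
  unfold padF
  split_ifs with h
  · exact (measurable_pi_apply _).comp hf
  · exact measurable_const

section Dynamics

variable {n : ℕ} {G : ℕ → X → ℝ} {Np : ℕ → ℕ} (M : ℕ → Kernel X X) [∀ p, IsMarkovKernel (M p)]

lemma isProbabilityMeasure_newLaw (h : Setup n G Np) {p : ℕ} (hp : p ≤ n) (z : ℕ → X) :
    IsProbabilityMeasure (newLaw M G Np p z) := by
  have := isProbabilityMeasure_cat (h.sum_pos hp z)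
  exact isProbabilityMeasure_bind Measurable.of_discrete fun a =>
    Measure.isProbabilityMeasure_map (measurable_prodMk_left).aemeasurable

lemma integral_newLaw (h : Setup n G Np) {p : ℕ} (hp : p ≤ n) (z : ℕ → X) {F : ℕ × X → ℝ}
    (hF : BddMeas F) :
    ∫ y, F y ∂(newLaw M G Np p z) = (∑ j ∈ Finset.range (Np p), G p (z j))⁻¹ *
      ∑ j ∈ Finset.range (Np p), G p (z j) * ∫ x, F (j, x) ∂(M (p + 1) (z j)) := by
  have := isProbabilityMeasure_cat (h.sum_pos hp z)
  rw [newLaw, integral_bind_of_bddMeas Measurable.of_discrete (fun a =>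
    Measure.isProbabilityMeasure_map (measurable_prodMk_left).aemeasurable) hF,
    integral_cat fun j _ => (h.pos p hp _).le]
  simp_rw [integral_map (measurable_prodMk_left).aemeasurable hF.meas.aestronglyMeasurable]

lemma measurable_newLaw (h : Setup n G Np) {p : ℕ} (hp : p ≤ n) :
    Measurable (newLaw M G Np p) := by
  refine Measure.measurable_of_measurable_coe _ fun s hs => ?_
  simp_rw [newLaw, cat_bind_apply _ _ _ hs]
  have hG := h.meas p hp
  have h1 : ∀ j, Measurable fun z : ℕ → X => ENNReal.ofReal (G p (z j)) := fun j =>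
    ENNReal.measurable_ofReal.comp (hG.comp (measurable_pi_apply j))
  refine (Finset.measurable_sum _ fun j _ => h1 j).inv.mul
    (Finset.measurable_sum _ fun j _ => (h1 j).mul ?_)
  simp_rw [Measure.map_apply measurable_prodMk_left hs]
  exact ((M (p + 1)).measurable_coe (measurable_prodMk_left hs)).comp (measurable_pi_apply j)

lemma measurable_measure_pi {Y Z : Type*} [MeasurableSpace Y] [MeasurableSpace Z] {N : ℕ}
    {κ : Z → Measure Y} (hκ : Measurable κ) (hp : ∀ z, IsProbabilityMeasure (κ z)) :
    Measurable fun z => Measure.pi fun _ : Fin N => κ z := by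
  refine Measurable.measure_of_isPiSystem_of_isProbabilityMeasure
    (S := Set.pi Set.univ '' Set.pi Set.univ fun _ : Fin N => {s : Set Y | MeasurableSet s})
    generateFrom_pi.symm isPiSystem_pi ?_
  rintro _ ⟨s, hs, rfl⟩
  simp_rw [Measure.pi_pi]
  exact Finset.measurable_prod _ fun i _ => (Measure.measurable_coe (hs i trivial)).comp hκ

variable [Nonempty X]

lemma measurable_append (N k : ℕ) : Measurable
    fun q : ((ℕ → ℕ → X) × (ℕ → ℕ → ℕ)) × (Fin N → ℕ × X) => append k q.1 q.2 := by
  refine Measurable.prodMk ?_ ?_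
  · exact (measurable_update' (a := k + 1)).comp
      (g := fun q : (ℕ → ℕ → X) × (ℕ → X) => Function.update q.1 (k + 1) q.2)
      (f := fun q : ((ℕ → ℕ → X) × (ℕ → ℕ → ℕ)) × (Fin N → ℕ × X) =>
        (q.1.1, padF fun i => (q.2 i).2))
      (Measurable.prodMk (by fun_prop) (measurable_padF (by fun_prop)))
  · exact (measurable_update' (a := k)).comp
      (g := fun q : (ℕ → ℕ → ℕ) × (ℕ → ℕ) => Function.update q.1 k q.2)
      (f := fun q : ((ℕ → ℕ → X) × (ℕ → ℕ → ℕ)) × (Fin N → ℕ × X) =>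
        (q.1.2, padF fun i => (q.2 i).1))
      (Measurable.prodMk (by fun_prop) (measurable_padF (by fun_prop)))

lemma pfLaw_succ (M0 : Measure X) (k : ℕ) :
    pfLaw M0 M G Np (k + 1) = (pfLaw M0 M G Np k).bind fun ω =>
      (Measure.pi fun _ : Fin (Np (k + 1)) => newLaw M G Np k (ω.1 k)).map (append k ω) := by
  rw [pfLaw]
  congr 1
  funext ω
  rw [pfStep, Measure.map_map]
  · rfl
  · refine Measurable.prodMk ?_ ?_
    · exact (measurable_update _).comp measurable_snd
    · exact (measurable_update _).comp measurable_fst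
  · exact Measurable.prodMk (measurable_padF (by fun_prop)) (measurable_padF (by fun_prop))

lemma measurable_step (h : Setup n G Np) {k : ℕ} (hk : k ≤ n) : Measurable
    fun ω : (ℕ → ℕ → X) × (ℕ → ℕ → ℕ) =>
      (Measure.pi fun _ : Fin (Np (k + 1)) => newLaw M G Np k (ω.1 k)).map (append k ω) :=
  measurable_map_kernel
    (measurable_measure_pi (κ := fun ω : (ℕ → ℕ → X) × (ℕ → ℕ → ℕ) => newLaw M G Np k (ω.1 k))
      ((measurable_newLaw M h hk).comp (by fun_prop)) fun ω => isProbabilityMeasure_newLaw M h hk _)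
    (fun ω => by
      have := isProbabilityMeasure_newLaw M h hk (ω.1 k)
      infer_instance)
    (measurable_append _ k)

lemma isProbabilityMeasure_step (h : Setup n G Np) {k : ℕ} (hk : k ≤ n)
    (ω : (ℕ → ℕ → X) × (ℕ → ℕ → ℕ)) : IsProbabilityMeasure
      ((Measure.pi fun _ : Fin (Np (k + 1)) => newLaw M G Np k (ω.1 k)).map (append k ω)) := by
  have := isProbabilityMeasure_newLaw M h hk (ω.1 k)
  exact Measure.isProbabilityMeasure_map
    ((measurable_append _ k).comp measurable_prodMk_left).aemeasurable

variable (M0 : Measure X) [IsProbabilityMeasure M0]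

lemma measurable_initial (N : ℕ) : Measurable fun f : Fin N → X =>
    ((fun p => if p = 0 then padF f else fun _ => Classical.arbitrary X, fun _ _ => 0) :
      (ℕ → ℕ → X) × (ℕ → ℕ → ℕ)) := by
  refine Measurable.prodMk (measurable_pi_lambda _ fun p => ?_) measurable_const
  split_ifs
  · exact measurable_padF measurable_id
  · exact measurable_const

lemma isProbabilityMeasure_pfLaw (h : Setup n G Np) {k : ℕ} (hk : k ≤ n) :
    IsProbabilityMeasure (pfLaw M0 M G Np k) := by
  induction k with
  | zero => exact Measure.isProbabilityMeasure_map (measurable_initial _).aemeasurable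
  | succ k ih =>
    have := ih (by omega)
    rw [pfLaw_succ]
    exact isProbabilityMeasure_bind (measurable_step M h (by omega))
      (isProbabilityMeasure_step M h (by omega))

lemma integral_pfLaw_zero {F : (ℕ → ℕ → X) × (ℕ → ℕ → ℕ) → ℝ} (hF : Measurable F) :
    ∫ ω, F ω ∂(pfLaw M0 M G Np 0) = ∫ f, F (fun p => if p = 0 then padF f else
      fun _ => Classical.arbitrary X, fun _ _ => 0) ∂(Measure.pi fun _ : Fin (Np 0) => M0) := by
  rw [pfLaw, integral_map (measurable_initial _).aemeasurable hF.aestronglyMeasurable]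

lemma integral_pfLaw_succ (h : Setup n G Np) {k : ℕ} (hk : k + 1 ≤ n)
    {F : (ℕ → ℕ → X) × (ℕ → ℕ → ℕ) → ℝ} (hF : BddMeas F) :
    ∫ ω, F ω ∂(pfLaw M0 M G Np (k + 1)) = ∫ ω, ∫ y, F (append k ω y)
      ∂(Measure.pi fun _ : Fin (Np (k + 1)) => newLaw M G Np k (ω.1 k)) ∂(pfLaw M0 M G Np k) := by
  have := isProbabilityMeasure_pfLaw M M0 h (k := k) (by omega)
  rw [pfLaw_succ, integral_bind_of_bddMeas (measurable_step M h (by omega))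
    (isProbabilityMeasure_step M h (by omega)) hF]
  refine integral_congr_ae (Eventually.of_forall fun ω => ?_)
  exact integral_map ((measurable_append _ k).comp measurable_prodMk_left).aemeasurable
    hF.meas.aestronglyMeasurable

end Dynamics

/-- The weight that `μ_b^N` puts on the pair of particles `(i, j)` at time `p`. -/
def wt (G : ℕ → X → ℝ) (Np : ℕ → ℕ) (b : ℕ → Bool) (ω : (ℕ → ℕ → X) × (ℕ → ℕ → ℕ)) :
    ℕ → ℕ → ℕ → ℝ
  | 0 => fun i j =>
      if i < Np 0 ∧ j < Np 0 ∧ (i = j ↔ b 0 = true) then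
        if b 0 then (Np 0 : ℝ)⁻¹ else ((Np 0 : ℝ) * ((Np 0 : ℝ) - 1))⁻¹
      else 0
  | p + 1 => fun i j =>
      if i < Np (p + 1) ∧ j < Np (p + 1) ∧ (i = j ↔ b (p + 1) = true) then
        if b (p + 1) then
          (Np (p + 1) : ℝ)⁻¹ * ((∑ l ∈ Finset.range (Np p), G p (ω.1 p l)) *
            ∑ l ∈ Finset.range (Np p), G p (ω.1 p l) * wt G Np b ω p (ω.2 p i) l)
        else
          ((Np (p + 1) : ℝ) * ((Np (p + 1) : ℝ) - 1))⁻¹ *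
            ((∑ l ∈ Finset.range (Np p), G p (ω.1 p l)) ^ 2 *
              wt G Np b ω p (ω.2 p i) (ω.2 p j))
      else 0

/-- The pair approximation at time `p` built from the weights `wt`. -/
def pairSum (G : ℕ → X → ℝ) (Np : ℕ → ℕ) (b : ℕ → Bool) (p : ℕ) (f : X × X → ℝ)
    (ω : (ℕ → ℕ → X) × (ℕ → ℕ → ℕ)) : ℝ :=
  ∑ i ∈ Finset.range (Np p), ∑ j ∈ Finset.range (Np p),
    wt G Np b ω p i j * f (ω.1 p i, ω.1 p j)

/-- Normalized sum of squares of the row sums of the weights. -/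
def rowSq (G : ℕ → X → ℝ) (Np : ℕ → ℕ) (b : ℕ → Bool) (p : ℕ)
    (ω : (ℕ → ℕ → X) × (ℕ → ℕ → ℕ)) : ℝ :=
  Np p * ∑ i ∈ Finset.range (Np p), (∑ j ∈ Finset.range (Np p), wt G Np b ω p i j) ^ 2

/-- Normalized sum of squares of the weights. -/
def entSq (G : ℕ → X → ℝ) (Np : ℕ → ℕ) (b : ℕ → Bool) (p : ℕ)
    (ω : (ℕ → ℕ → X) × (ℕ → ℕ → ℕ)) : ℝ :=
  (Np p : ℝ) ^ 2 *
    ∑ i ∈ Finset.range (Np p), ∑ j ∈ Finset.range (Np p), wt G Np b ω p i j ^ 2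

/-- One step of the doubled Feynman–Kac semigroup. -/
def pairQ (M : ℕ → Kernel X X) (G : ℕ → X → ℝ) (b : ℕ → Bool) (p : ℕ) (f : X × X → ℝ)
    (q : X × X) : ℝ :=
  G p q.1 * G p q.2 * ∫ y, f y ∂(pairKer M b (p + 1) q)

lemma wt_congr {G : ℕ → X → ℝ} {Np : ℕ → ℕ} {b : ℕ → Bool}
    {ω ω' : (ℕ → ℕ → X) × (ℕ → ℕ → ℕ)} {p : ℕ}
    (h : ∀ q < p, ω.1 q = ω'.1 q ∧ ω.2 q = ω'.2 q) : wt G Np b ω p = wt G Np b ω' p := by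
  induction p with
  | zero => rfl
  | succ p ih =>
    simp only [wt, ih fun q hq => h q (by omega), (h p (by omega)).1, (h p (by omega)).2]

lemma wt_symm (G : ℕ → X → ℝ) (Np : ℕ → ℕ) (b : ℕ → Bool) (ω : (ℕ → ℕ → X) × (ℕ → ℕ → ℕ))
    (p i j : ℕ) : wt G Np b ω p i j = wt G Np b ω p j i := by
  induction p generalizing i j with
  | zero =>
    have : (i < Np 0 ∧ j < Np 0 ∧ (i = j ↔ b 0 = true))
        ↔ (j < Np 0 ∧ i < Np 0 ∧ (j = i ↔ b 0 = true)) := by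
      rw [eq_comm (a := i)]; tauto
    simp only [wt, this]
  | succ p ih =>
    have : (i < Np (p + 1) ∧ j < Np (p + 1) ∧ (i = j ↔ b (p + 1) = true))
        ↔ (j < Np (p + 1) ∧ i < Np (p + 1) ∧ (j = i ↔ b (p + 1) = true)) := by
      rw [eq_comm (a := i)]; tauto
    simp only [wt, this]
    split_ifs with h1 h2
    · rw [h1.2.2.2 h2]
    · rw [ih]
    · rfl

section Weights

variable {n : ℕ} {G : ℕ → X → ℝ} {Np : ℕ → ℕ}

lemma Setup.one_lt (h : Setup n G Np) {p : ℕ} (hp : p ≤ n) : (1 : ℝ) ≤ (Np p : ℝ) - 1 := by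
  have : (2 : ℝ) ≤ Np p := by exact_mod_cast h.two p hp
  linarith

lemma Setup.cast_pos (h : Setup n G Np) {p : ℕ} (hp : p ≤ n) : (0 : ℝ) < (Np p : ℝ) := by
  have := h.one_lt hp
  linarith

lemma wt_nonneg (h : Setup n G Np) (b : ℕ → Bool) (ω : (ℕ → ℕ → X) × (ℕ → ℕ → ℕ)) {p : ℕ}
    (hp : p ≤ n) (i j : ℕ) : 0 ≤ wt G Np b ω p i j := by
  induction p generalizing i j with
  | zero =>
    have h1 := h.one_lt hp
    have h2 := h.cast_pos hp
    have h3 : (0 : ℝ) < (Np 0 : ℝ) - 1 := by linarith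
    simp only [wt]
    split_ifs <;> positivity
  | succ p ih =>
    have h1 := h.one_lt hp
    have h2 := h.cast_pos hp
    have h3 : (0 : ℝ) < (Np (p + 1) : ℝ) - 1 := by linarith
    have h4 := (h.sum_pos (p := p) (by omega) (ω.1 p)).le
    have h5 := fun i j => ih (by omega) i j
    have h6 : 0 ≤ ∑ l ∈ Finset.range (Np p), G p (ω.1 p l) * wt G Np b ω p (ω.2 p i) l :=
      Finset.sum_nonneg fun l _ => mul_nonneg (h.pos p (by omega) _).le (h5 _ _)
    have h7 := h5 (ω.2 p i) (ω.2 p j)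
    simp only [wt]
    split_ifs <;> positivity

lemma BddMeas.ite_set {Y : Type*} [MeasurableSpace Y] {f : Y → ℝ} (hf : BddMeas f) {P : Y → Prop}
    [DecidablePred P] (hP : MeasurableSet {y | P y}) : BddMeas fun y => if P y then f y else 0 := by
  refine ⟨Measurable.ite hP hf.meas measurable_const, ?_⟩
  obtain ⟨C, hC0, hC⟩ := hf.exists_pos
  refine ⟨C, fun y => ?_⟩
  split_ifs
  · exact hC y
  · simpa using hC0.le

lemma measurable_apply_nat {Y : Type*} [MeasurableSpace Y] :
    Measurable fun q : (ℕ → Y) × ℕ => q.1 q.2 :=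
  measurable_from_prod_countable_left fun j => measurable_pi_apply j

lemma bddMeas_wt (h : Setup n G Np) (b : ℕ → Bool) {p : ℕ} (hp : p ≤ n) :
    BddMeas fun q : ((ℕ → ℕ → X) × (ℕ → ℕ → ℕ)) × ℕ × ℕ => wt G Np b q.1 p q.2.1 q.2.2 := by
  induction p with
  | zero =>
    simp only [wt]
    refine (BddMeas.const _).ite_set ?_
    exact measurableSet_preimage measurable_snd (MeasurableSet.of_discrete (s := {q : ℕ × ℕ |
      q.1 < Np 0 ∧ q.2 < Np 0 ∧ (q.1 = q.2 ↔ b 0 = true)}))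
  | succ p ih =>
    have ih := ih (by omega)
    have hG : ∀ l, BddMeas fun q : ((ℕ → ℕ → X) × (ℕ → ℕ → ℕ)) × ℕ × ℕ => G p (q.1.1 p l) :=
      fun l => (h.bddMeas (p := p) (by omega)).comp
        (u := fun q : ((ℕ → ℕ → X) × (ℕ → ℕ → ℕ)) × ℕ × ℕ => q.1.1 p l) (by fun_prop)
    have hS := BddMeas.sum (Finset.range (Np p)) fun l _ => hG l
    have hA1 : Measurable fun q : ((ℕ → ℕ → X) × (ℕ → ℕ → ℕ)) × ℕ × ℕ => q.1.2 p q.2.1 :=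
      measurable_apply_nat.comp (g := fun q : (ℕ → ℕ) × ℕ => q.1 q.2)
        (f := fun q : ((ℕ → ℕ → X) × (ℕ → ℕ → ℕ)) × ℕ × ℕ => (q.1.2 p, q.2.1)) (by fun_prop)
    have hA2 : Measurable fun q : ((ℕ → ℕ → X) × (ℕ → ℕ → ℕ)) × ℕ × ℕ => q.1.2 p q.2.2 :=
      measurable_apply_nat.comp (g := fun q : (ℕ → ℕ) × ℕ => q.1 q.2)
        (f := fun q : ((ℕ → ℕ → X) × (ℕ → ℕ → ℕ)) × ℕ × ℕ => (q.1.2 p, q.2.2)) (by fun_prop)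
    simp only [wt]
    refine BddMeas.ite_set ?_ ?_
    · split_ifs
      · refine (BddMeas.const _).mul (hS.mul (BddMeas.sum _ fun l _ => (hG l).mul ?_))
        exact ih.comp (u := fun q : ((ℕ → ℕ → X) × (ℕ → ℕ → ℕ)) × ℕ × ℕ => (q.1, q.1.2 p q.2.1, l))
          (by fun_prop)
      · refine (BddMeas.const _).mul ((hS.pow 2).mul ?_)
        exact ih.comp (u := fun q : ((ℕ → ℕ → X) × (ℕ → ℕ → ℕ)) × ℕ × ℕ =>
          (q.1, q.1.2 p q.2.1, q.1.2 p q.2.2)) (by fun_prop)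
    · exact measurableSet_preimage measurable_snd (MeasurableSet.of_discrete (s := {q : ℕ × ℕ |
        q.1 < Np (p + 1) ∧ q.2 < Np (p + 1) ∧ (q.1 = q.2 ↔ b (p + 1) = true)}))

lemma bddMeas_wt_apply (h : Setup n G Np) (b : ℕ → Bool) {p : ℕ} (hp : p ≤ n) (i j : ℕ) :
    BddMeas fun ω => wt G Np b ω p i j :=
  (bddMeas_wt h b hp).comp (u := fun ω => (ω, i, j)) (by fun_prop)

lemma bddMeas_pairSum (h : Setup n G Np) (b : ℕ → Bool) {p : ℕ} (hp : p ≤ n) {f : X × X → ℝ}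
    (hf : BddMeas f) : BddMeas (pairSum G Np b p f) :=
  BddMeas.sum _ fun i _ => BddMeas.sum _ fun j _ => (bddMeas_wt_apply h b hp i j).mul
    (hf.comp (u := fun ω : (ℕ → ℕ → X) × (ℕ → ℕ → ℕ) => (ω.1 p i, ω.1 p j)) (by fun_prop))

lemma bddMeas_rowSq (h : Setup n G Np) (b : ℕ → Bool) {p : ℕ} (hp : p ≤ n) :
    BddMeas (rowSq G Np b p) :=
  (BddMeas.const _).mul (BddMeas.sum _ fun i _ =>
    (BddMeas.sum _ fun j _ => bddMeas_wt_apply h b hp i j).pow 2)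

lemma bddMeas_entSq (h : Setup n G Np) (b : ℕ → Bool) {p : ℕ} (hp : p ≤ n) :
    BddMeas (entSq G Np b p) :=
  (BddMeas.const _).mul (BddMeas.sum _ fun i _ =>
    BddMeas.sum _ fun j _ => (bddMeas_wt_apply h b hp i j).pow 2)

lemma rowSq_nonneg (G : ℕ → X → ℝ) (Np : ℕ → ℕ) (b : ℕ → Bool) (p : ℕ)
    (ω : (ℕ → ℕ → X) × (ℕ → ℕ → ℕ)) : 0 ≤ rowSq G Np b p ω := by
  unfold rowSq
  positivity

lemma entSq_nonneg (G : ℕ → X → ℝ) (Np : ℕ → ℕ) (b : ℕ → Bool) (p : ℕ)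
    (ω : (ℕ → ℕ → X) × (ℕ → ℕ → ℕ)) : 0 ≤ entSq G Np b p ω := by
  unfold entSq
  positivity

section Append

variable [Nonempty X]

lemma append_fst_of_ne {N k q : ℕ} (hq : q ≠ k + 1) (ω : (ℕ → ℕ → X) × (ℕ → ℕ → ℕ))
    (y : Fin N → ℕ × X) : (append k ω y).1 q = ω.1 q := by
  simp [append, hq]

lemma append_fst_self {N k : ℕ} (ω : (ℕ → ℕ → X) × (ℕ → ℕ → ℕ))
    (y : Fin N → ℕ × X) (i : Fin N) : (append k ω y).1 (k + 1) i = (y i).2 := by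
  simp [append, padF]

lemma append_snd_of_ne {N k q : ℕ} (hq : q ≠ k) (ω : (ℕ → ℕ → X) × (ℕ → ℕ → ℕ))
    (y : Fin N → ℕ × X) : (append k ω y).2 q = ω.2 q := by
  simp [append, hq]

lemma append_snd_self {N k : ℕ} (ω : (ℕ → ℕ → X) × (ℕ → ℕ → ℕ))
    (y : Fin N → ℕ × X) (i : Fin N) : (append k ω y).2 k i = (y i).1 := by
  simp [append, padF]

lemma wt_append (b : ℕ → Bool) (p : ℕ) (ω : (ℕ → ℕ → X) × (ℕ → ℕ → ℕ))
    (y : Fin (Np (p + 1)) → ℕ × X) (i j : Fin (Np (p + 1))) :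
    wt G Np b (append p ω y) (p + 1) i j = if (i = j ↔ b (p + 1) = true) then
        if b (p + 1) then
          (Np (p + 1) : ℝ)⁻¹ * ((∑ l ∈ Finset.range (Np p), G p (ω.1 p l)) *
            ∑ l ∈ Finset.range (Np p), G p (ω.1 p l) * wt G Np b ω p (y i).1 l)
        else
          ((Np (p + 1) : ℝ) * ((Np (p + 1) : ℝ) - 1))⁻¹ *
            ((∑ l ∈ Finset.range (Np p), G p (ω.1 p l)) ^ 2 *
              wt G Np b ω p (y i).1 (y j).1)
      else 0 := by
  have hw : wt G Np b (append p ω y) p = wt G Np b ω p := wt_congr fun q hq =>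
    ⟨append_fst_of_ne (by omega) ω y, append_snd_of_ne (by omega) ω y⟩
  simp only [wt, hw, append_snd_self, append_fst_of_ne (show p ≠ p + 1 by omega), i.2, j.2,
    true_and, Fin.val_inj]

end Append

end Weights

section OneStep

variable {n : ℕ} {G : ℕ → X → ℝ} {Np : ℕ → ℕ} (M : ℕ → Kernel X X) [∀ p, IsMarkovKernel (M p)]

lemma integral_newLaw_prod (h : Setup n G Np) {p : ℕ} (hp : p ≤ n) (z : ℕ → X)
    {F : (ℕ × X) × ℕ × X → ℝ} (hF : BddMeas F) :
    ∫ q, F q ∂((newLaw M G Np p z).prod (newLaw M G Np p z))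
      = ((∑ j ∈ Finset.range (Np p), G p (z j)) ^ 2)⁻¹ *
        ∑ k ∈ Finset.range (Np p), ∑ l ∈ Finset.range (Np p), G p (z k) * G p (z l) *
          ∫ q, F ((k, q.1), (l, q.2)) ∂((M (p + 1) (z k)).prod (M (p + 1) (z l))) := by
  have := isProbabilityMeasure_newLaw M h hp z
  rw [integral_prod _ (hF.integrable _), integral_newLaw M h hp z
    (F := fun a => ∫ b, F (a, b) ∂(newLaw M G Np p z))
    (hF.integral_kernel measurable_const fun _ => this)]
  have hsq : ∀ (A : ℝ) (T : ℕ → ℝ), (A ^ 2)⁻¹ * ∑ k ∈ Finset.range (Np p), T k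
      = A⁻¹ * ∑ k ∈ Finset.range (Np p), A⁻¹ * T k := fun A T => by
    rw [← Finset.mul_sum]; ring
  rw [hsq]
  refine congrArg _ ?_
  refine Finset.sum_congr rfl fun k _ => ?_
  have hFk : BddMeas fun q : X × ℕ × X => F ((k, q.1), q.2) :=
    hF.comp (u := fun q : X × ℕ × X => ((k, q.1), q.2)) (by fun_prop)
  have hx : ∀ x, ∫ b, F ((k, x), b) ∂(newLaw M G Np p z)
      = (∑ j ∈ Finset.range (Np p), G p (z j))⁻¹ * ∑ l ∈ Finset.range (Np p), G p (z l) *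
        ∫ y, F ((k, x), (l, y)) ∂(M (p + 1) (z l)) := fun x =>
    integral_newLaw M h hp z (F := fun b => F ((k, x), b))
      (hF.comp (u := fun b => ((k, x), b)) (by fun_prop))
  have hFkl : ∀ l, BddMeas fun q : X × X => F ((k, q.1), (l, q.2)) := fun l =>
    hF.comp (u := fun q : X × X => ((k, q.1), (l, q.2))) (by fun_prop)
  simp_rw [hx]
  rw [integral_const_mul, integral_finsetSum _ fun l _ =>
    ((hFkl l).integral_kernel (κ := fun _ => M (p + 1) (z l)) measurable_const
      fun _ => inferInstance).integrable _ |>.const_mul _]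
  rw [mul_left_comm, Finset.mul_sum]
  refine congrArg _ ?_
  refine Finset.sum_congr rfl fun l _ => ?_
  rw [integral_const_mul, integral_prod _ ((hFkl l).integrable _), mul_assoc]

lemma measurable_pairKer (b : ℕ → Bool) (p : ℕ) : Measurable (pairKer M b p) := by
  unfold pairKer
  split_ifs
  · exact measurable_map_kernel (κ := fun q : X × X => M p q.1) (f := fun _ y => (y, y))
      ((M p).measurable.comp measurable_fst) (fun _ => inferInstance) (by fun_prop)
  · have h := (((M p).comap Prod.fst measurable_fst) ×ₖ
      ((M p).comap (Prod.snd : X × X → X) measurable_snd)).measurable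
    convert h using 1
    funext q
    rw [Kernel.prod_apply]
    rfl

lemma isProbabilityMeasure_pairKer (b : ℕ → Bool) (p : ℕ) (q : X × X) :
    IsProbabilityMeasure (pairKer M b p q) := by
  unfold pairKer
  split_ifs
  · exact Measure.isProbabilityMeasure_map (by fun_prop)
  · infer_instance

lemma bddMeas_pairQ (h : Setup n G Np) (b : ℕ → Bool) {p : ℕ} (hp : p ≤ n) {f : X × X → ℝ}
    (hf : BddMeas f) : BddMeas (pairQ M G b p f) :=
  (((h.bddMeas hp).comp measurable_fst).mul ((h.bddMeas hp).comp measurable_snd)).mul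
    (BddMeas.integral_kernel (F := fun q : (X × X) × X × X => f q.2) (hf.comp measurable_snd)
      (measurable_pairKer M b (p + 1)) (isProbabilityMeasure_pairKer M b (p + 1)))

lemma sum_sum_ite_eq_offDiag {N : ℕ} (F : Fin N → Fin N → ℝ) :
    ∑ i, ∑ j, (if i = j then 0 else F i j)
      = ∑ a ∈ (Finset.univ : Finset (Fin N)).offDiag, F a.1 a.2 := by
  rw [← Finset.sum_product', Finset.univ_product_univ, Finset.sum_ite, Finset.sum_const_zero,
    zero_add]
  refine Finset.sum_congr ?_ fun _ _ => rfl
  ext a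
  simp

variable [Nonempty X]

/-- Total potential of generation `p`. -/
def totG (G : ℕ → X → ℝ) (Np : ℕ → ℕ) (p : ℕ) (ω : (ℕ → ℕ → X) × (ℕ → ℕ → ℕ)) : ℝ :=
  ∑ l ∈ Finset.range (Np p), G p (ω.1 p l)

/-- Potential-weighted row sum of the weights. -/
def rowG (G : ℕ → X → ℝ) (Np : ℕ → ℕ) (b : ℕ → Bool) (p : ℕ)
    (ω : (ℕ → ℕ → X) × (ℕ → ℕ → ℕ)) (k : ℕ) : ℝ :=
  ∑ l ∈ Finset.range (Np p), G p (ω.1 p l) * wt G Np b ω p k l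

variable {b : ℕ → Bool} {p : ℕ}

lemma pairSum_append_of_true (hb : b (p + 1) = true) (f : X × X → ℝ)
    (ω : (ℕ → ℕ → X) × (ℕ → ℕ → ℕ)) (y : Fin (Np (p + 1)) → ℕ × X) :
    pairSum G Np b (p + 1) f (append p ω y) = (Np (p + 1) : ℝ)⁻¹ *
      ∑ i, totG G Np p ω * rowG G Np b p ω (y i).1 * f ((y i).2, (y i).2) := by
  simp only [pairSum, Finset.sum_range, wt_append, append_fst_self, hb, if_true, iff_true,
    ite_mul, zero_mul, Finset.sum_ite_eq, Finset.mem_univ, Finset.mul_sum]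
  refine Finset.sum_congr rfl fun i _ => ?_
  have h : ∑ l : Fin (Np p), G p (ω.1 p l) * wt G Np b ω p (y i).1 l = rowG G Np b p ω (y i).1 := by
    rw [rowG, Finset.sum_range]
  have h' : ∑ l : Fin (Np p), G p (ω.1 p l) = totG G Np p ω := by
    rw [totG, Finset.sum_range]
  simp only [mul_assoc, ← Finset.mul_sum, h, h']

lemma pairSum_append_of_false (hb : b (p + 1) = false) (f : X × X → ℝ)
    (ω : (ℕ → ℕ → X) × (ℕ → ℕ → ℕ)) (y : Fin (Np (p + 1)) → ℕ × X) :
    pairSum G Np b (p + 1) f (append p ω y)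
      = ((Np (p + 1) : ℝ) * ((Np (p + 1) : ℝ) - 1))⁻¹ *
        ∑ a ∈ (Finset.univ : Finset (Fin (Np (p + 1)))).offDiag,
          totG G Np p ω ^ 2 * wt G Np b ω p (y a.1).1 (y a.2).1 * f ((y a.1).2, (y a.2).2) := by
  rw [← sum_sum_ite_eq_offDiag (fun i j => totG G Np p ω ^ 2 * wt G Np b ω p (y i).1 (y j).1 *
    f ((y i).2, (y j).2))]
  simp only [pairSum, Finset.sum_range (n := Np (p + 1)), wt_append, append_fst_self, hb,
    Finset.mul_sum]
  refine Finset.sum_congr rfl fun i _ => Finset.sum_congr rfl fun j _ => ?_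
  by_cases hij : i = j
  · simp [hij]
  · simp [hij, totG]
    ring

lemma rowSq_append_of_true (h : Setup n G Np) (hp : p + 1 ≤ n) (hb : b (p + 1) = true)
    (ω : (ℕ → ℕ → X) × (ℕ → ℕ → ℕ)) (y : Fin (Np (p + 1)) → ℕ × X) :
    rowSq G Np b (p + 1) (append p ω y) = (Np (p + 1) : ℝ)⁻¹ *
      ∑ i, (totG G Np p ω * rowG G Np b p ω (y i).1) ^ 2 := by
  have hN := (h.cast_pos hp).ne'
  simp only [rowSq, Finset.sum_range (n := Np (p + 1)), wt_append, hb, if_true, iff_true,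
    Finset.sum_ite_eq, Finset.mem_univ, Finset.mul_sum (s := (Finset.univ : Finset (Fin _)))]
  refine Finset.sum_congr rfl fun i _ => ?_
  simp only [totG, rowG]
  field_simp

lemma entSq_append_of_true (h : Setup n G Np) (hp : p + 1 ≤ n) (hb : b (p + 1) = true)
    (ω : (ℕ → ℕ → X) × (ℕ → ℕ → ℕ)) (y : Fin (Np (p + 1)) → ℕ × X) :
    entSq G Np b (p + 1) (append p ω y) =
      ∑ i, (totG G Np p ω * rowG G Np b p ω (y i).1) ^ 2 := by
  have hN := (h.cast_pos hp).ne'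
  simp only [entSq, Finset.sum_range (n := Np (p + 1)), wt_append, hb, if_true, iff_true,
    ite_pow, ne_eq, OfNat.ofNat_ne_zero, not_false_eq_true, zero_pow,
    Finset.sum_ite_eq, Finset.mem_univ, Finset.mul_sum (s := (Finset.univ : Finset (Fin _)))]
  refine Finset.sum_congr rfl fun i _ => ?_
  simp only [totG, rowG]
  field_simp

lemma rowSq_append_of_false (hb : b (p + 1) = false)
    (ω : (ℕ → ℕ → X) × (ℕ → ℕ → ℕ)) (y : Fin (Np (p + 1)) → ℕ × X) :
    rowSq G Np b (p + 1) (append p ω y)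
      = Np (p + 1) * (((Np (p + 1) : ℝ) * ((Np (p + 1) : ℝ) - 1))⁻¹ ^ 2 *
        ∑ i, (∑ j, if i = j then 0 else
          totG G Np p ω ^ 2 * wt G Np b ω p (y i).1 (y j).1) ^ 2) := by
  simp only [rowSq, Finset.sum_range (n := Np (p + 1)), wt_append, hb, Bool.false_eq_true, if_false]
  refine congrArg _ ?_
  rw [Finset.mul_sum]
  refine Finset.sum_congr rfl fun i _ => ?_
  rw [← mul_pow, Finset.mul_sum]
  refine congrArg (· ^ 2) ?_
  refine Finset.sum_congr rfl fun j _ => ?_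
  by_cases hij : i = j
  · simp [hij]
  · simp [hij, totG]

lemma entSq_append_of_false (hb : b (p + 1) = false)
    (ω : (ℕ → ℕ → X) × (ℕ → ℕ → ℕ)) (y : Fin (Np (p + 1)) → ℕ × X) :
    entSq G Np b (p + 1) (append p ω y)
      = (Np (p + 1) : ℝ) ^ 2 * (((Np (p + 1) : ℝ) * ((Np (p + 1) : ℝ) - 1))⁻¹ ^ 2 *
        ∑ a ∈ (Finset.univ : Finset (Fin (Np (p + 1)))).offDiag,
          (totG G Np p ω ^ 2 * wt G Np b ω p (y a.1).1 (y a.2).1) ^ 2) := by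
  rw [← sum_sum_ite_eq_offDiag (fun i j => (totG G Np p ω ^ 2 *
    wt G Np b ω p (y i).1 (y j).1) ^ 2)]
  simp only [entSq, Finset.sum_range (n := Np (p + 1)), wt_append, hb,
    Finset.mul_sum (s := (Finset.univ : Finset (Fin _)))]
  refine Finset.sum_congr rfl fun i _ => Finset.sum_congr rfl fun j _ => ?_
  by_cases hij : i = j
  · simp [hij]
  · simp only [hij, totG, Bool.false_eq_true, if_true, if_false]
    ring

lemma bddMeas_totG_rowG (h : Setup n G Np) (b : ℕ → Bool) (hp : p ≤ n)
    (ω : (ℕ → ℕ → X) × (ℕ → ℕ → ℕ)) :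
    BddMeas fun q : ℕ × X => totG G Np p ω * rowG G Np b p ω q.1 :=
  (BddMeas.const _).mul (BddMeas.sum _ fun l _ => (BddMeas.const _).mul
    ((bddMeas_wt h b hp).comp (u := fun q : ℕ × X => (ω, q.1, l)) (by fun_prop)))

lemma bddMeas_totG_wt (h : Setup n G Np) (b : ℕ → Bool) (hp : p ≤ n)
    (ω : (ℕ → ℕ → X) × (ℕ → ℕ → ℕ)) :
    BddMeas fun q : (ℕ × X) × ℕ × X => totG G Np p ω ^ 2 * wt G Np b ω p q.1.1 q.2.1 :=
  (BddMeas.const _).mul ((bddMeas_wt h b hp).comp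
    (u := fun q : (ℕ × X) × ℕ × X => (ω, q.1.1, q.2.1)) (by fun_prop))

lemma totG_pos (h : Setup n G Np) (hp : p ≤ n) (ω : (ℕ → ℕ → X) × (ℕ → ℕ → ℕ)) :
    0 < totG G Np p ω := h.sum_pos hp _

/-- One-step variance proxies bounded by the row sums. -/
lemma integral_totG_rowG_sq_le (h : Setup n G Np) (b : ℕ → Bool) (hp : p ≤ n) {Γ : ℝ}
    (hΓ : ∀ x, G p x ≤ Γ) (ω : (ℕ → ℕ → X) × (ℕ → ℕ → ℕ)) :
    ∫ q, (totG G Np p ω * rowG G Np b p ω q.1) ^ 2 ∂(newLaw M G Np p (ω.1 p))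
      ≤ Γ ^ 4 * rowSq G Np b p ω := by
  have hS := totG_pos h hp ω
  have hΓ0 : 0 ≤ Γ := (h.pos p hp (ω.1 p 0)).le.trans (hΓ _)
  rw [integral_newLaw M h hp _ ((bddMeas_totG_rowG h b hp ω).pow 2)]
  simp only [integral_const, probReal_univ, one_smul]
  change (totG G Np p ω)⁻¹ * _ ≤ _
  have hSle : totG G Np p ω ≤ Np p * Γ := by
    have := Finset.sum_le_sum fun l (_ : l ∈ Finset.range (Np p)) => hΓ (ω.1 p l)
    simpa [totG] using this
  have hrow : ∀ k, 0 ≤ rowG G Np b p ω k ∧ rowG G Np b p ω k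
      ≤ Γ * ∑ j ∈ Finset.range (Np p), wt G Np b ω p k j := by
    intro k
    refine ⟨Finset.sum_nonneg fun l _ => mul_nonneg (h.pos p hp _).le (wt_nonneg h b ω hp _ _), ?_⟩
    rw [Finset.mul_sum]
    exact Finset.sum_le_sum fun l _ => mul_le_mul_of_nonneg_right (hΓ _) (wt_nonneg h b ω hp _ _)
  have hterm : ∀ k ∈ Finset.range (Np p),
      G p (ω.1 p k) * (totG G Np p ω * rowG G Np b p ω k) ^ 2
      ≤ totG G Np p ω ^ 2 * (Γ ^ 3 * (∑ j ∈ Finset.range (Np p), wt G Np b ω p k j) ^ 2) := by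
    intro k _
    obtain ⟨h0, h1⟩ := hrow k
    calc G p (ω.1 p k) * (totG G Np p ω * rowG G Np b p ω k) ^ 2
        ≤ Γ * (totG G Np p ω * (Γ * ∑ j ∈ Finset.range (Np p), wt G Np b ω p k j)) ^ 2 := by
          gcongr
          exact hΓ _
      _ = _ := by ring
  calc (totG G Np p ω)⁻¹ * ∑ k ∈ Finset.range (Np p),
        G p (ω.1 p k) * (totG G Np p ω * rowG G Np b p ω k) ^ 2
      ≤ (totG G Np p ω)⁻¹ * ∑ k ∈ Finset.range (Np p),
        totG G Np p ω ^ 2 * (Γ ^ 3 * (∑ j ∈ Finset.range (Np p), wt G Np b ω p k j) ^ 2) := by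
        gcongr (totG G Np p ω)⁻¹ * ?_
        exact Finset.sum_le_sum hterm
    _ = totG G Np p ω * (Γ ^ 3 * ∑ k ∈ Finset.range (Np p),
          (∑ j ∈ Finset.range (Np p), wt G Np b ω p k j) ^ 2) := by
        rw [← Finset.mul_sum, ← Finset.mul_sum]
        field_simp
    _ ≤ (Np p * Γ) * (Γ ^ 3 * ∑ k ∈ Finset.range (Np p),
          (∑ j ∈ Finset.range (Np p), wt G Np b ω p k j) ^ 2) := by
        gcongr
    _ = Γ ^ 4 * rowSq G Np b p ω := by rw [rowSq]; ring

lemma integral_totG_wt (h : Setup n G Np) (b : ℕ → Bool) (hp : p ≤ n)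
    (ω : (ℕ → ℕ → X) × (ℕ → ℕ → ℕ)) (k : ℕ) :
    ∫ q, totG G Np p ω ^ 2 * wt G Np b ω p k q.1 ∂(newLaw M G Np p (ω.1 p))
      = totG G Np p ω * rowG G Np b p ω k := by
  have hS := totG_pos h hp ω
  rw [integral_newLaw M h hp _ (F := fun q => totG G Np p ω ^ 2 * wt G Np b ω p k q.1)
    ((bddMeas_totG_wt h b hp ω).comp (u := fun q : ℕ × X => ((k, ω.1 p 0), q)) (by fun_prop))]
  simp only [integral_const, probReal_univ, one_smul]
  change (totG G Np p ω)⁻¹ * _ = _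
  rw [Finset.sum_congr rfl fun j _ => mul_left_comm _ _ _, ← Finset.mul_sum, rowG]
  field_simp

lemma integral_totG_wt_sq_le (h : Setup n G Np) (b : ℕ → Bool) (hp : p ≤ n) {Γ : ℝ}
    (hΓ : ∀ x, G p x ≤ Γ) (ω : (ℕ → ℕ → X) × (ℕ → ℕ → ℕ)) :
    ∫ q, (totG G Np p ω ^ 2 * wt G Np b ω p q.1.1 q.2.1) ^ 2
        ∂((newLaw M G Np p (ω.1 p)).prod (newLaw M G Np p (ω.1 p)))
      ≤ Γ ^ 4 * entSq G Np b p ω := by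
  have hS := totG_pos h hp ω
  have hΓ0 : 0 ≤ Γ := (h.pos p hp (ω.1 p 0)).le.trans (hΓ _)
  rw [integral_newLaw_prod M h hp _ ((bddMeas_totG_wt h b hp ω).pow 2)]
  simp only [integral_const, probReal_univ, one_smul]
  change (totG G Np p ω ^ 2)⁻¹ * _ ≤ _
  have hSle : totG G Np p ω ≤ Np p * Γ := by
    have := Finset.sum_le_sum fun l (_ : l ∈ Finset.range (Np p)) => hΓ (ω.1 p l)
    simpa [totG] using this
  calc (totG G Np p ω ^ 2)⁻¹ * ∑ k ∈ Finset.range (Np p), ∑ l ∈ Finset.range (Np p),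
        G p (ω.1 p k) * G p (ω.1 p l) * (totG G Np p ω ^ 2 * wt G Np b ω p k l) ^ 2
      ≤ (totG G Np p ω ^ 2)⁻¹ * ∑ k ∈ Finset.range (Np p), ∑ l ∈ Finset.range (Np p),
        totG G Np p ω ^ 4 * (Γ ^ 2 * wt G Np b ω p k l ^ 2) := by
        gcongr (totG G Np p ω ^ 2)⁻¹ * ?_
        refine Finset.sum_le_sum fun k _ => Finset.sum_le_sum fun l _ => ?_
        calc G p (ω.1 p k) * G p (ω.1 p l) * (totG G Np p ω ^ 2 * wt G Np b ω p k l) ^ 2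
            ≤ Γ * Γ * (totG G Np p ω ^ 2 * wt G Np b ω p k l) ^ 2 := by
              gcongr
              · exact (h.pos p hp _).le
              · exact hΓ _
              · exact hΓ _
          _ = _ := by ring
    _ = totG G Np p ω ^ 2 * (Γ ^ 2 * ∑ k ∈ Finset.range (Np p), ∑ l ∈ Finset.range (Np p),
          wt G Np b ω p k l ^ 2) := by
        simp only [← Finset.mul_sum]
        field_simp
    _ ≤ (Np p * Γ) ^ 2 * (Γ ^ 2 * ∑ k ∈ Finset.range (Np p), ∑ l ∈ Finset.range (Np p),
          wt G Np b ω p k l ^ 2) := by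
        gcongr
    _ = Γ ^ 4 * entSq G Np b p ω := by rw [entSq]; ring

lemma integral_diag_newLaw (h : Setup n G Np) (hp : p ≤ n) (hb : b (p + 1) = true)
    {f : X × X → ℝ} (hf : BddMeas f) (ω : (ℕ → ℕ → X) × (ℕ → ℕ → ℕ)) :
    ∫ q, totG G Np p ω * rowG G Np b p ω q.1 * f (q.2, q.2) ∂(newLaw M G Np p (ω.1 p))
      = pairSum G Np b p (pairQ M G b p f) ω := by
  have hS := totG_pos h hp ω
  have hf' : BddMeas fun q : ℕ × X => f (q.2, q.2) :=
    hf.comp (u := fun q : ℕ × X => (q.2, q.2)) (by fun_prop)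
  rw [integral_newLaw M h hp _ ((bddMeas_totG_rowG h b hp ω).mul hf')]
  simp only [integral_const_mul]
  change (totG G Np p ω)⁻¹ * _ = _
  rw [Finset.mul_sum, pairSum]
  refine Finset.sum_congr rfl fun k _ => ?_
  have hk : ∀ y, ∫ q, f q ∂(pairKer M b (p + 1) (ω.1 p k, y))
      = ∫ x, f (x, x) ∂(M (p + 1) (ω.1 p k)) := by
    intro y
    rw [pairKer, if_pos hb, integral_map (by fun_prop) hf.meas.aestronglyMeasurable]
  simp only [pairQ, hk]
  rw [rowG]
  generalize ∫ x, f (x, x) ∂(M (p + 1) (ω.1 p k)) = I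
  have : ∀ l ∈ Finset.range (Np p), wt G Np b ω p k l * (G p (ω.1 p k) * G p (ω.1 p l) * I)
      = G p (ω.1 p k) * I * (G p (ω.1 p l) * wt G Np b ω p k l) := fun l _ => by ring
  rw [Finset.sum_congr rfl this, ← Finset.mul_sum]
  field_simp

lemma integral_offDiag_newLaw (h : Setup n G Np) (hp : p ≤ n) (hb : b (p + 1) = false)
    {f : X × X → ℝ} (hf : BddMeas f) (ω : (ℕ → ℕ → X) × (ℕ → ℕ → ℕ)) :
    ∫ q, totG G Np p ω ^ 2 * wt G Np b ω p q.1.1 q.2.1 * f (q.1.2, q.2.2)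
        ∂((newLaw M G Np p (ω.1 p)).prod (newLaw M G Np p (ω.1 p)))
      = pairSum G Np b p (pairQ M G b p f) ω := by
  have hS := totG_pos h hp ω
  have hf' : BddMeas fun q : (ℕ × X) × ℕ × X => f (q.1.2, q.2.2) :=
    hf.comp (u := fun q : (ℕ × X) × ℕ × X => (q.1.2, q.2.2)) (by fun_prop)
  rw [integral_newLaw_prod M h hp _ ((bddMeas_totG_wt h b hp ω).mul hf')]
  simp only [integral_const_mul]
  change (totG G Np p ω ^ 2)⁻¹ * _ = _
  rw [Finset.mul_sum, pairSum]
  refine Finset.sum_congr rfl fun k _ => ?_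
  rw [Finset.mul_sum]
  refine Finset.sum_congr rfl fun l _ => ?_
  have hq : ∫ q, f q ∂(pairKer M b (p + 1) (ω.1 p k, ω.1 p l))
      = ∫ q, f (q.1, q.2) ∂((M (p + 1) (ω.1 p k)).prod (M (p + 1) (ω.1 p l))) := by
    rw [pairKer, hb]; rfl
  rw [pairQ, hq]
  field_simp

end OneStep

section StepBounds

variable {n : ℕ} {G : ℕ → X → ℝ} {Np : ℕ → ℕ} (M : ℕ → Kernel X X) [∀ p, IsMarkovKernel (M p)]
  [Nonempty X] {p : ℕ}

lemma inv_mul_sub_one_sq_le {N : ℝ} (hN : 1 ≤ N - 1) : (N * (N - 1))⁻¹ ^ 2 ≤ 4 * (N ^ 4)⁻¹ := by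
  have h1 : 0 < N := by linarith
  have h2 : 0 < N - 1 := by linarith
  rw [inv_pow, ← div_eq_mul_inv, inv_le_comm₀ (by positivity) (by positivity), inv_div,
    div_le_iff₀ (by positivity)]
  have h3 : N ≤ 2 * (N - 1) := by linarith
  have h4 : N ^ 2 ≤ (2 * (N - 1)) ^ 2 := by gcongr
  nlinarith [sq_nonneg N]

lemma integral_pairSum_append (h : Setup n G Np) (b : ℕ → Bool) (hp : p + 1 ≤ n)
    {f : X × X → ℝ} (hf : BddMeas f) (ω : (ℕ → ℕ → X) × (ℕ → ℕ → ℕ)) :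
    ∫ y, pairSum G Np b (p + 1) f (append p ω y)
        ∂(Measure.pi fun _ : Fin (Np (p + 1)) => newLaw M G Np p (ω.1 p))
      = pairSum G Np b p (pairQ M G b p f) ω := by
  have hp' : p ≤ n := by omega
  have := isProbabilityMeasure_newLaw M h hp' (ω.1 p)
  have hN := (h.cast_pos hp).ne'
  have hN1 : (Np (p + 1) : ℝ) - 1 ≠ 0 := by
    have := h.one_lt hp
    linarith
  cases hb : b (p + 1) with
  | true =>
    simp_rw [pairSum_append_of_true hb]
    rw [integral_const_mul, integral_sum_eval _ ((bddMeas_totG_rowG h b hp' ω).mul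
      (hf.comp (u := fun q : ℕ × X => (q.2, q.2)) (by fun_prop))),
      integral_diag_newLaw M h hp' hb hf]
    field_simp
  | false =>
    simp_rw [pairSum_append_of_false hb]
    rw [integral_const_mul, integral_sum_offDiag _ ((bddMeas_totG_wt h b hp' ω).mul
      (hf.comp (u := fun q : (ℕ × X) × ℕ × X => (q.1.2, q.2.2)) (by fun_prop))),
      integral_offDiag_newLaw M h hp' hb hf]
    field_simp

lemma integral_pairSum_append_sq_le (h : Setup n G Np) (b : ℕ → Bool) (hp : p + 1 ≤ n) {Γ K : ℝ}
    (hΓ : ∀ x, G p x ≤ Γ) {f : X × X → ℝ} (hf : BddMeas f) (hK : ∀ q, |f q| ≤ K)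
    (ω : (ℕ → ℕ → X) × (ℕ → ℕ → ℕ)) :
    ∫ y, pairSum G Np b (p + 1) f (append p ω y) ^ 2
        ∂(Measure.pi fun _ : Fin (Np (p + 1)) => newLaw M G Np p (ω.1 p))
      ≤ pairSum G Np b p (pairQ M G b p f) ω ^ 2 + 16 * K ^ 2 * Γ ^ 4 *
        (rowSq G Np b p ω / Np (p + 1) + entSq G Np b p ω / (Np (p + 1) : ℝ) ^ 2) := by
  have hp' : p ≤ n := by omega
  have := isProbabilityMeasure_newLaw M h hp' (ω.1 p)
  have hN := h.cast_pos hp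
  have hN1 := h.one_lt hp
  have hN1' : (Np (p + 1) : ℝ) - 1 ≠ 0 := by linarith
  have hR := rowSq_nonneg G Np b p ω
  have hE := entSq_nonneg G Np b p ω
  have hrow := integral_totG_rowG_sq_le M h b hp' hΓ ω
  have hent := integral_totG_wt_sq_le M h b hp' hΓ ω
  have hS := totG_pos h hp' ω
  have hK0 : 0 ≤ K := (abs_nonneg _).trans (hK (ω.1 p 0, ω.1 p 0))
  set N : ℝ := (Np (p + 1) : ℝ) with hNdef
  set ρ := newLaw M G Np p (ω.1 p) with hρ
  have hB1 := bddMeas_totG_rowG h b hp' ω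
  have hB2 := bddMeas_totG_wt h b hp' ω
  cases hb : b (p + 1) with
  | true =>
    simp_rw [pairSum_append_of_true hb, mul_pow _ (∑ i, _)]
    have hF := hB1.mul (hf.comp (u := fun q : ℕ × X => (q.2, q.2)) (by fun_prop))
    rw [integral_const_mul]
    have h1 := integral_sum_eval_sq_le ρ (N := Np (p + 1)) hF
    rw [integral_diag_newLaw M h hp' hb hf] at h1
    have h2 : ∫ q, (totG G Np p ω * rowG G Np b p ω q.1 * f (q.2, q.2)) ^ 2 ∂ρ
        ≤ K ^ 2 * (Γ ^ 4 * rowSq G Np b p ω) := by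
      refine le_trans ?_ (mul_le_mul_of_nonneg_left hrow (sq_nonneg K))
      rw [← integral_const_mul]
      refine integral_mono ((hF.pow 2).integrable _) (((hB1.pow 2).integrable _).const_mul _) ?_
      intro q
      dsimp only
      rw [mul_pow, mul_comm (K ^ 2)]
      exact mul_le_mul_of_nonneg_left (sq_le_sq' (abs_le.1 (hK _)).1 (abs_le.1 (hK _)).2)
        (sq_nonneg _)
    calc N⁻¹ ^ 2 * _ ≤ N⁻¹ ^ 2 * ((N * pairSum G Np b p (pairQ M G b p f) ω) ^ 2
          + N * (K ^ 2 * (Γ ^ 4 * rowSq G Np b p ω))) := by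
          gcongr
          exact h1.trans (by gcongr)
      _ = pairSum G Np b p (pairQ M G b p f) ω ^ 2
          + 1 * K ^ 2 * Γ ^ 4 * (rowSq G Np b p ω / N + 0) := by
          field_simp
          ring
      _ ≤ _ := by
          gcongr
          · norm_num
          · positivity
  | false =>
    simp_rw [pairSum_append_of_false hb, mul_pow _ (∑ i ∈ _, _)]
    have hF := hB2.mul (hf.comp (u := fun q : (ℕ × X) × ℕ × X => (q.1.2, q.2.2)) (by fun_prop))
    rw [integral_const_mul]
    have h1 := integral_sum_offDiag_sq_le ρ (N := Np (p + 1)) hF ((BddMeas.const K).mul hB2)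
      (fun q => by
        rw [abs_mul, mul_comm, abs_of_nonneg (mul_nonneg (sq_nonneg _) (wt_nonneg h b ω hp' _ _))]
        exact mul_le_mul_of_nonneg_right (hK _)
          (mul_nonneg (sq_nonneg _) (wt_nonneg h b ω hp' _ _)))
      (fun q => by simp only [Prod.fst_swap, Prod.snd_swap, wt_symm G Np b ω p q.2.1 q.1.1])
    rw [integral_offDiag_newLaw M h hp' hb hf] at h1
    have hr : ∫ x, (∫ y, K * (totG G Np p ω ^ 2 * wt G Np b ω p x.1 y.1) ∂ρ) ^ 2 ∂ρ
        ≤ K ^ 2 * (Γ ^ 4 * rowSq G Np b p ω) := by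
      have : ∀ x : ℕ × X, (∫ y, K * (totG G Np p ω ^ 2 * wt G Np b ω p x.1 y.1) ∂ρ) ^ 2
          = K ^ 2 * (totG G Np p ω * rowG G Np b p ω x.1) ^ 2 := fun x => by
        rw [integral_const_mul, integral_totG_wt M h b hp', mul_pow]
      simp_rw [this]
      rw [integral_const_mul]
      exact mul_le_mul_of_nonneg_left hrow (sq_nonneg K)
    have hs : ∫ x, (K * (totG G Np p ω ^ 2 * wt G Np b ω p x.1.1 x.2.1)) ^ 2 ∂(ρ.prod ρ)
        ≤ K ^ 2 * (Γ ^ 4 * entSq G Np b p ω) := by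
      simp_rw [mul_pow K]
      rw [integral_const_mul]
      exact mul_le_mul_of_nonneg_left hent (sq_nonneg K)
    have hc := inv_mul_sub_one_sq_le hN1
    calc (N * (N - 1))⁻¹ ^ 2 * _
        ≤ (N * (N - 1))⁻¹ ^ 2 * ((N * (N - 1) * pairSum G Np b p (pairQ M G b p f) ω) ^ 2
          + 4 * N ^ 3 * (K ^ 2 * (Γ ^ 4 * rowSq G Np b p ω))
          + 2 * N ^ 2 * (K ^ 2 * (Γ ^ 4 * entSq G Np b p ω))) := by
          gcongr
          exact h1.trans (by gcongr)
      _ = pairSum G Np b p (pairQ M G b p f) ω ^ 2 + (N * (N - 1))⁻¹ ^ 2 *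
          (4 * N ^ 3 * (K ^ 2 * (Γ ^ 4 * rowSq G Np b p ω))
          + 2 * N ^ 2 * (K ^ 2 * (Γ ^ 4 * entSq G Np b p ω))) := by
          field_simp
          ring
      _ ≤ pairSum G Np b p (pairQ M G b p f) ω ^ 2 + 4 * (N ^ 4)⁻¹ *
          (4 * N ^ 3 * (K ^ 2 * (Γ ^ 4 * rowSq G Np b p ω))
          + 4 * N ^ 2 * (K ^ 2 * (Γ ^ 4 * entSq G Np b p ω))) := by
          gcongr
          norm_num
      _ = _ := by
          field_simp
          ring

lemma integral_rowSq_append_le (h : Setup n G Np) (b : ℕ → Bool) (hp : p + 1 ≤ n) {Γ : ℝ}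
    (hΓ : ∀ x, G p x ≤ Γ) (ω : (ℕ → ℕ → X) × (ℕ → ℕ → ℕ)) :
    ∫ y, rowSq G Np b (p + 1) (append p ω y)
        ∂(Measure.pi fun _ : Fin (Np (p + 1)) => newLaw M G Np p (ω.1 p))
      ≤ 4 * Γ ^ 4 * (rowSq G Np b p ω + entSq G Np b p ω / Np (p + 1)) := by
  have hp' : p ≤ n := by omega
  have := isProbabilityMeasure_newLaw M h hp' (ω.1 p)
  have hN := h.cast_pos hp
  have hN1 := h.one_lt hp
  have hR := rowSq_nonneg G Np b p ω
  have hE := entSq_nonneg G Np b p ω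
  have hrow := integral_totG_rowG_sq_le M h b hp' hΓ ω
  have hent := integral_totG_wt_sq_le M h b hp' hΓ ω
  have hB1 := bddMeas_totG_rowG h b hp' ω
  have hB2 := bddMeas_totG_wt h b hp' ω
  set N : ℝ := (Np (p + 1) : ℝ) with hNdef
  set ρ := newLaw M G Np p (ω.1 p) with hρ
  cases hb : b (p + 1) with
  | true =>
    simp_rw [rowSq_append_of_true h hp hb]
    rw [integral_const_mul, integral_sum_eval _ (hB1.pow 2), inv_mul_cancel_left₀ hN.ne']
    calc _ ≤ 1 * Γ ^ 4 * (rowSq G Np b p ω + 0) := by rw [one_mul, add_zero]; exact hrow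
      _ ≤ _ := by
        gcongr
        · norm_num
        · positivity
  | false =>
    simp_rw [rowSq_append_of_false hb]
    rw [integral_const_mul, integral_const_mul]
    have h1 := integral_sum_sq_sum_offDiag_le ρ (N := Np (p + 1)) hB2
    have hx : ∀ x : ℕ × X, ∫ y, totG G Np p ω ^ 2 * wt G Np b ω p x.1 y.1 ∂ρ
        = totG G Np p ω * rowG G Np b p ω x.1 := fun x => integral_totG_wt M h b hp' ω x.1
    dsimp only at h1
    simp_rw [hx] at h1
    calc N * ((N * (N - 1))⁻¹ ^ 2 * _)
        ≤ N * ((4 * (N ^ 4)⁻¹) * (N ^ 3 * (Γ ^ 4 * rowSq G Np b p ω)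
          + N ^ 2 * (Γ ^ 4 * entSq G Np b p ω))) := by
          gcongr N * ?_
          refine mul_le_mul (inv_mul_sub_one_sq_le hN1) (h1.trans (by gcongr)) ?_ (by positivity)
          exact integral_nonneg fun _ => Finset.sum_nonneg fun _ _ => sq_nonneg _
      _ = _ := by
          field_simp

lemma integral_entSq_append_le (h : Setup n G Np) (b : ℕ → Bool) (hp : p + 1 ≤ n) {Γ : ℝ}
    (hΓ : ∀ x, G p x ≤ Γ) (ω : (ℕ → ℕ → X) × (ℕ → ℕ → ℕ)) :
    ∫ y, entSq G Np b (p + 1) (append p ω y)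
        ∂(Measure.pi fun _ : Fin (Np (p + 1)) => newLaw M G Np p (ω.1 p))
      ≤ 4 * Γ ^ 4 * (entSq G Np b p ω + Np (p + 1) * rowSq G Np b p ω) := by
  have hp' : p ≤ n := by omega
  have := isProbabilityMeasure_newLaw M h hp' (ω.1 p)
  have hN := h.cast_pos hp
  have hN1 := h.one_lt hp
  have hR := rowSq_nonneg G Np b p ω
  have hE := entSq_nonneg G Np b p ω
  have hrow := integral_totG_rowG_sq_le M h b hp' hΓ ω
  have hent := integral_totG_wt_sq_le M h b hp' hΓ ω
  have hB1 := bddMeas_totG_rowG h b hp' ω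
  have hB2 := bddMeas_totG_wt h b hp' ω
  set N : ℝ := (Np (p + 1) : ℝ) with hNdef
  set ρ := newLaw M G Np p (ω.1 p) with hρ
  cases hb : b (p + 1) with
  | true =>
    simp_rw [entSq_append_of_true h hp hb]
    rw [integral_sum_eval _ (hB1.pow 2)]
    calc _ ≤ N * (Γ ^ 4 * rowSq G Np b p ω) := by gcongr
      _ = 1 * Γ ^ 4 * (0 + N * rowSq G Np b p ω) := by ring
      _ ≤ _ := by
        gcongr
        norm_num
  | false =>
    simp_rw [entSq_append_of_false hb]
    rw [integral_const_mul, integral_const_mul, integral_sum_offDiag _ (hB2.pow 2)]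
    calc N ^ 2 * ((N * (N - 1))⁻¹ ^ 2 * _)
        ≤ N ^ 2 * (4 * (N ^ 4)⁻¹ * (N * N * (Γ ^ 4 * entSq G Np b p ω))) := by
          gcongr N ^ 2 * ?_
          refine mul_le_mul (inv_mul_sub_one_sq_le hN1) ?_ ?_ (by positivity)
          · refine mul_le_mul ?_ hent (integral_nonneg fun _ => sq_nonneg _) (by positivity)
            gcongr
            linarith
          · refine mul_nonneg (by rw [← hNdef]; nlinarith) (integral_nonneg fun _ => sq_nonneg _)
      _ = 4 * Γ ^ 4 * (entSq G Np b p ω + 0) := by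
          field_simp
          ring
      _ ≤ _ := by
          gcongr
          positivity

end StepBounds

lemma measure_abs_sub_ge_le {Ω : Type*} [MeasurableSpace Ω] {μ : Measure Ω}
    [IsProbabilityMeasure μ] {Y : Ω → ℝ} (hY : BddMeas Y) {m v : ℝ} (hm : ∫ ω, Y ω ∂μ = m)
    (hv : ∫ ω, Y ω ^ 2 ∂μ ≤ m ^ 2 + v) {ε : ℝ} (hε : 0 < ε) :
    μ {ω | ε ≤ |Y ω - m|} ≤ ENNReal.ofReal (v / ε ^ 2) := by
  have hd : BddMeas fun ω => (Y ω - m) ^ 2 := (hY.add (BddMeas.const (-m))).pow 2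
  have h1 := mul_meas_ge_le_integral_of_nonneg (μ := μ) (f := fun ω => (Y ω - m) ^ 2)
    (Eventually.of_forall fun _ => sq_nonneg _) (hd.integrable _) (ε ^ 2)
  have h2 : ∫ ω, (Y ω - m) ^ 2 ∂μ ≤ v := by
    have : ∀ ω, (Y ω - m) ^ 2 = Y ω ^ 2 - 2 * m * Y ω + m ^ 2 := fun ω => by ring
    simp_rw [this]
    rw [integral_add (f := fun ω => Y ω ^ 2 - 2 * m * Y ω)
      (((hY.pow 2).integrable _).sub ((hY.integrable _).const_mul _))
      (integrable_const _), integral_sub ((hY.pow 2).integrable _)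
      ((hY.integrable _).const_mul _), integral_const_mul, hm]
    simp only [integral_const, probReal_univ, one_smul]
    linarith
  have hset : {ω | ε ≤ |Y ω - m|} = {ω | ε ^ 2 ≤ (Y ω - m) ^ 2} := by
    ext ω
    simp only [Set.mem_ofPred_eq]
    rw [← sq_abs (Y ω - m)]
    exact (pow_le_pow_iff_left₀ hε.le (abs_nonneg _) two_ne_zero).symm
  rw [hset, ← ofReal_measureReal (measure_ne_top _ _)]
  refine ENNReal.ofReal_le_ofReal ?_
  rw [le_div_iff₀ (by positivity), mul_comm]
  exact h1.trans h2

section Limit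

variable {n : ℕ} {G : ℕ → X → ℝ} {Np : ℕ → ℕ}

lemma bddMeas_tail (h : Setup n G Np) {p : ℕ} (hp : p ≤ n) {f : X × X → ℝ} (hf : BddMeas f) :
    BddMeas fun ω : ℕ → X × X => f (ω p) * ∏ q ∈ Finset.range p, G q (ω q).1 * G q (ω q).2 := by
  refine (hf.comp (measurable_pi_apply p)).mul (BddMeas.prod _ fun q hq => ?_)
  have hq' : q ≤ n := by have := Finset.mem_range.1 hq; omega
  exact ((h.bddMeas hq').comp (u := fun ω : ℕ → X × X => (ω q).1) (by fun_prop)).mul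
    ((h.bddMeas hq').comp (u := fun ω : ℕ → X × X => (ω q).2) (by fun_prop))

variable (M0 : Measure X) [IsProbabilityMeasure M0] (M : ℕ → Kernel X X) [∀ p, IsMarkovKernel (M p)]

lemma isProbabilityMeasure_pairInit (b : ℕ → Bool) : IsProbabilityMeasure (pairInit M0 b) := by
  unfold pairInit
  split_ifs
  · exact Measure.isProbabilityMeasure_map (by fun_prop)
  · infer_instance

lemma measurable_markovStep (b : ℕ → Bool) (k : ℕ) : Measurable fun ω : ℕ → X × X =>
    (pairKer M b (k + 1) (ω k)).map fun y => Function.update ω (k + 1) y :=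
  measurable_map_kernel (κ := fun ω : ℕ → X × X => pairKer M b (k + 1) (ω k))
    ((measurable_pairKer M b (k + 1)).comp (measurable_pi_apply k))
    (fun _ => isProbabilityMeasure_pairKer M b _ _) measurable_update'

lemma isProbabilityMeasure_markovPath (b : ℕ → Bool) (k : ℕ) :
    IsProbabilityMeasure (markovPath (pairInit M0 b) (pairKer M b) k) := by
  induction k with
  | zero =>
    have := isProbabilityMeasure_pairInit M0 b
    exact Measure.isProbabilityMeasure_map
      (measurable_pi_lambda _ fun _ => measurable_id).aemeasurable
  | succ k ih =>
    refine isProbabilityMeasure_bind (measurable_markovStep M b k) fun ω => ?_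
    have := isProbabilityMeasure_pairKer M b (k + 1) (ω k)
    exact Measure.isProbabilityMeasure_map (measurable_update ω).aemeasurable

lemma muB_zero (b : ℕ → Bool) {f : X × X → ℝ} (hf : BddMeas f) :
    muB M0 M G 0 b f = ∫ q, f q ∂(pairInit M0 b) := by
  simp only [muB, Finset.range_zero, Finset.prod_empty, mul_one, markovPath]
  exact integral_map (f := fun ω : ℕ → X × X => f (ω 0))
    (measurable_pi_lambda _ fun _ => measurable_id).aemeasurable
    (hf.meas.comp (measurable_pi_apply 0)).aestronglyMeasurable

lemma muB_succ (h : Setup n G Np) (b : ℕ → Bool) {k : ℕ} (hk : k + 1 ≤ n) {f : X × X → ℝ}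
    (hf : BddMeas f) : muB M0 M G (k + 1) b f = muB M0 M G k b (pairQ M G b k f) := by
  have hp := isProbabilityMeasure_markovPath M0 M b k
  rw [muB, markovPath, integral_bind_of_bddMeas (measurable_markovStep M b k) (fun ω => by
    have := isProbabilityMeasure_pairKer M b (k + 1) (ω k)
    exact Measure.isProbabilityMeasure_map (measurable_update ω).aemeasurable)
    (bddMeas_tail h hk hf), muB]
  refine integral_congr_ae (Eventually.of_forall fun ω => ?_)
  dsimp only
  rw [integral_map (measurable_update ω).aemeasurable
    (bddMeas_tail h hk hf).meas.aestronglyMeasurable]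
  simp only [Function.update_self, Finset.prod_range_succ,
    Function.update_of_ne (show k ≠ k + 1 by omega), pairQ]
  have : ∀ y, ∏ q ∈ Finset.range k, G q (Function.update ω (k + 1) y q).1 *
      G q (Function.update ω (k + 1) y q).2
      = ∏ q ∈ Finset.range k, G q (ω q).1 * G q (ω q).2 := fun y =>
    Finset.prod_congr rfl fun q hq => by
      rw [Function.update_of_ne (show q ≠ k + 1 by have := Finset.mem_range.1 hq; omega)]
  simp_rw [this]
  rw [integral_mul_const]
  ring

lemma sum_wt_zero (h : Setup n G Np) (b : ℕ → Bool) (ω : (ℕ → ℕ → X) × (ℕ → ℕ → ℕ)) {i : ℕ}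
    (hi : i < Np 0) : ∑ j ∈ Finset.range (Np 0), wt G Np b ω 0 i j = (Np 0 : ℝ)⁻¹ := by
  have hN := (h.cast_pos (Nat.zero_le n)).ne'
  have hN1 : (Np 0 : ℝ) - 1 ≠ 0 := by
    have := h.one_lt (Nat.zero_le n)
    linarith
  have key : ∀ j ∈ Finset.range (Np 0), wt G Np b ω 0 i j
      = (if b 0 then 0 else ((Np 0 : ℝ) * ((Np 0 : ℝ) - 1))⁻¹) + if i = j then
        (if b 0 then (Np 0 : ℝ)⁻¹ else -((Np 0 : ℝ) * ((Np 0 : ℝ) - 1))⁻¹) else 0 := by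
    intro j hj
    simp only [wt, hi, Finset.mem_range.1 hj, true_and]
    by_cases hij : i = j <;> cases b 0 <;> simp [hij]
  rw [Finset.sum_congr rfl key, Finset.sum_add_distrib, Finset.sum_ite_eq,
    if_pos (Finset.mem_range.2 hi), Finset.sum_const, Finset.card_range, nsmul_eq_mul]
  split_ifs
  · ring
  · field_simp
    ring

lemma rowSq_zero (h : Setup n G Np) (b : ℕ → Bool) (ω : (ℕ → ℕ → X) × (ℕ → ℕ → ℕ)) :
    rowSq G Np b 0 ω = 1 := by
  have hN := (h.cast_pos (Nat.zero_le n)).ne'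
  rw [rowSq, Finset.sum_congr rfl fun i hi => by rw [sum_wt_zero h b ω (Finset.mem_range.1 hi)]]
  simp
  field_simp

lemma wt_zero_le (h : Setup n G Np) (b : ℕ → Bool) (ω : (ℕ → ℕ → X) × (ℕ → ℕ → ℕ)) (i j : ℕ) :
    wt G Np b ω 0 i j ≤ (Np 0 : ℝ)⁻¹ := by
  have hN := h.cast_pos (Nat.zero_le n)
  have hN1 := h.one_lt (Nat.zero_le n)
  simp only [wt]
  split_ifs
  · exact le_rfl
  · gcongr
    nlinarith
  · positivity

lemma entSq_zero_le (h : Setup n G Np) (b : ℕ → Bool) (ω : (ℕ → ℕ → X) × (ℕ → ℕ → ℕ)) :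
    entSq G Np b 0 ω ≤ Np 0 := by
  have hN := h.cast_pos (Nat.zero_le n)
  have h1 : ∀ i ∈ Finset.range (Np 0), ∑ j ∈ Finset.range (Np 0), wt G Np b ω 0 i j ^ 2
      ≤ (Np 0 : ℝ)⁻¹ * (Np 0 : ℝ)⁻¹ := fun i hi => by
    nth_rw 2 [← sum_wt_zero h b ω (Finset.mem_range.1 hi)]
    rw [Finset.mul_sum]
    refine Finset.sum_le_sum fun j _ => ?_
    rw [sq]
    exact mul_le_mul_of_nonneg_right (wt_zero_le h b ω i j) (wt_nonneg h b ω (Nat.zero_le n) i j)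
  calc entSq G Np b 0 ω ≤ (Np 0 : ℝ) ^ 2 * ∑ i ∈ Finset.range (Np 0),
        (Np 0 : ℝ)⁻¹ * (Np 0 : ℝ)⁻¹ := by
        rw [entSq]
        gcongr ?_ * ?_
        exact Finset.sum_le_sum h1
    _ = Np 0 := by
        rw [Finset.sum_const, Finset.card_range, nsmul_eq_mul]
        field_simp

end Limit

section Moments

variable {n : ℕ} {G : ℕ → X → ℝ} {Np : ℕ → ℕ} (M0 : Measure X) [IsProbabilityMeasure M0]
  (M : ℕ → Kernel X X) [∀ p, IsMarkovKernel (M p)] [Nonempty X]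

lemma pairSum_zero (b : ℕ → Bool) (f : X × X → ℝ) (A : ℕ → ℕ → ℕ) (x : Fin (Np 0) → X) :
    pairSum G Np b 0 f (fun p => if p = 0 then padF x else fun _ => Classical.arbitrary X, A) =
      if b 0 then (Np 0 : ℝ)⁻¹ * ∑ i, f (x i, x i) else
        ((Np 0 : ℝ) * ((Np 0 : ℝ) - 1))⁻¹ *
          ∑ a ∈ (Finset.univ : Finset (Fin (Np 0))).offDiag, f (x a.1, x a.2) := by
  have hx : ∀ i : Fin (Np 0), padF x i = x i := fun i => by simp [padF]
  rw [← sum_sum_ite_eq_offDiag (fun i j => f (x i, x j))]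
  simp only [pairSum, Finset.sum_range (n := Np 0), wt, if_true, hx, Fin.is_lt, true_and,
    Fin.val_inj, Finset.mul_sum]
  cases b 0 with
  | true => simp
  | false =>
    simp only [Bool.false_eq_true, iff_false, if_false]
    refine Finset.sum_congr rfl fun i _ => Finset.sum_congr rfl fun j _ => ?_
    by_cases hij : i = j <;> simp [hij]

lemma integral_pairSum_zero (h : Setup n G Np) (b : ℕ → Bool) {f : X × X → ℝ} (hf : BddMeas f) :
    ∫ ω, pairSum G Np b 0 f ω ∂(pfLaw M0 M G Np 0) = ∫ q, f q ∂(pairInit M0 b) := by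
  have hN := (h.cast_pos (Nat.zero_le n)).ne'
  have hN1 : (Np 0 : ℝ) - 1 ≠ 0 := by
    have := h.one_lt (Nat.zero_le n)
    linarith
  rw [integral_pfLaw_zero M M0 (bddMeas_pairSum h b (Nat.zero_le n) hf).meas]
  simp_rw [pairSum_zero]
  cases hb : b 0 with
  | true =>
    simp only [if_true]
    rw [integral_const_mul, integral_sum_eval M0 (f := fun x => f (x, x))
      (hf.comp (u := fun x : X => (x, x)) (by fun_prop)), pairInit, if_pos hb,
      integral_map (by fun_prop) hf.meas.aestronglyMeasurable]
    field_simp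
  | false =>
    simp only [Bool.false_eq_true, if_false]
    rw [integral_const_mul, integral_sum_offDiag M0 hf, pairInit, hb]
    simp only [Bool.false_eq_true, if_false]
    field_simp

lemma integral_pairSum_zero_sq_le (h : Setup n G Np) (b : ℕ → Bool) {f : X × X → ℝ}
    (hf : BddMeas f) {K : ℝ} (hK : ∀ q, |f q| ≤ K) :
    ∫ ω, pairSum G Np b 0 f ω ^ 2 ∂(pfLaw M0 M G Np 0)
      ≤ (∫ q, f q ∂(pairInit M0 b)) ^ 2 + 24 * K ^ 2 / Np 0 := by
  have hN := h.cast_pos (Nat.zero_le n)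
  have hN1 := h.one_lt (Nat.zero_le n)
  have hN1' : (Np 0 : ℝ) - 1 ≠ 0 := by linarith
  have hK0 : 0 ≤ K := (abs_nonneg _).trans (hK (Classical.arbitrary _))
  have hK2 : ∀ q, f q ^ 2 ≤ K ^ 2 := fun q => sq_le_sq' (abs_le.1 (hK q)).1 (abs_le.1 (hK q)).2
  rw [integral_pfLaw_zero M M0 ((bddMeas_pairSum h b (Nat.zero_le n) hf).pow 2).meas]
  simp_rw [pairSum_zero]
  set N : ℝ := (Np 0 : ℝ) with hNdef
  cases hb : b 0 with
  | true =>
    have hf' : BddMeas fun x => f (x, x) := hf.comp (u := fun x : X => (x, x)) (by fun_prop)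
    simp only [if_true, mul_pow]
    rw [integral_const_mul, pairInit, if_pos hb,
      integral_map (by fun_prop) hf.meas.aestronglyMeasurable]
    have h1 := integral_sum_eval_sq_le M0 (N := Np 0) hf'
    have h2 : ∫ x, f (x, x) ^ 2 ∂M0 ≤ K ^ 2 := by
      have := integral_mono ((hf'.pow 2).integrable M0) (integrable_const (K ^ 2))
        fun x => hK2 (x, x)
      simpa using this
    calc N⁻¹ ^ 2 * _ ≤ N⁻¹ ^ 2 * ((N * ∫ x, f (x, x) ∂M0) ^ 2 + N * K ^ 2) := by
          gcongr
          exact h1.trans (by gcongr)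
      _ = (∫ x, f (x, x) ∂M0) ^ 2 + 1 * K ^ 2 / N := by
          field_simp
      _ ≤ _ := by
          gcongr
          norm_num
  | false =>
    simp only [Bool.false_eq_true, if_false, mul_pow _ (∑ i ∈ _, _)]
    rw [integral_const_mul, pairInit, hb]
    simp only [Bool.false_eq_true, if_false]
    have h1 := integral_sum_offDiag_sq_le M0 (N := Np 0) hf (BddMeas.const K) hK fun _ => rfl
    simp only [integral_const, probReal_univ, one_smul] at h1
    calc (N * (N - 1))⁻¹ ^ 2 * _
        ≤ (N * (N - 1))⁻¹ ^ 2 * ((N * (N - 1) * ∫ q, f q ∂(M0.prod M0)) ^ 2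
          + 4 * N ^ 3 * K ^ 2 + 2 * N ^ 2 * K ^ 2) := by
          gcongr
      _ = (∫ q, f q ∂(M0.prod M0)) ^ 2 + (N * (N - 1))⁻¹ ^ 2 *
          (4 * N ^ 3 * K ^ 2 + 2 * N ^ 2 * K ^ 2 * 1) := by
          field_simp
          ring
      _ ≤ (∫ q, f q ∂(M0.prod M0)) ^ 2 + 4 * (N ^ 4)⁻¹ *
          (4 * N ^ 3 * K ^ 2 + 2 * N ^ 2 * K ^ 2 * N) := by
          gcongr
          · exact inv_mul_sub_one_sq_le hN1
          · linarith
      _ = _ := by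
          field_simp
          ring

lemma integral_pairSum_eq (h : Setup n G Np) (b : ℕ → Bool) {p : ℕ} (hp : p ≤ n)
    {f : X × X → ℝ} (hf : BddMeas f) :
    ∫ ω, pairSum G Np b p f ω ∂(pfLaw M0 M G Np p) = muB M0 M G p b f := by
  induction p generalizing f with
  | zero => rw [integral_pairSum_zero M0 M h b hf, muB_zero M0 M b hf]
  | succ p ih =>
    rw [integral_pfLaw_succ M M0 h hp (bddMeas_pairSum h b hp hf), muB_succ M0 M h b hp hf,
      ← ih (by omega) (bddMeas_pairQ M h b (by omega) hf)]
    simp_rw [integral_pairSum_append M h b hp hf]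

variable {L D Γ : ℝ}

lemma integral_rowSq_add_entSq_le (h : Setup n G Np) (b : ℕ → Bool) (hL : 0 < L) (hD : 0 ≤ D)
    (hNp : ∀ q ≤ n, L ≤ Np q ∧ (Np q : ℝ) ≤ D * L) (hΓ : ∀ q ≤ n, ∀ x, G q x ≤ Γ) {p : ℕ}
    (hp : p ≤ n) :
    ∫ ω, (rowSq G Np b p ω + entSq G Np b p ω / L) ∂(pfLaw M0 M G Np p)
      ≤ (4 * Γ ^ 4 * (2 + D)) ^ p * (1 + D) := by
  have hE : ∀ {q}, q ≤ n → BddMeas fun ω => entSq G Np b q ω / L := fun hq => by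
    simp_rw [div_eq_mul_inv]
    exact (bddMeas_entSq h b hq).mul (BddMeas.const _)
  induction p with
  | zero =>
    have := isProbabilityMeasure_pfLaw M M0 h (Nat.zero_le n)
    have h1 : ∀ ω, rowSq G Np b 0 ω + entSq G Np b 0 ω / L ≤ 1 + D := fun ω => by
      rw [rowSq_zero h]
      gcongr
      rw [div_le_iff₀ hL]
      exact (entSq_zero_le h b ω).trans (hNp 0 hp).2
    have h2 := integral_mono (((bddMeas_rowSq h b hp).add (hE hp)).integrable
      (pfLaw M0 M G Np 0)) (integrable_const (1 + D)) h1
    simpa using h2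
  | succ p ih =>
    have hp' : p ≤ n := by omega
    have := isProbabilityMeasure_pfLaw M M0 h hp'
    rw [integral_pfLaw_succ M M0 h hp ((bddMeas_rowSq h b hp).add (hE hp))]
    have hstep : ∀ ω, ∫ y, (rowSq G Np b (p + 1) (append p ω y)
          + entSq G Np b (p + 1) (append p ω y) / L)
          ∂(Measure.pi fun _ : Fin (Np (p + 1)) => newLaw M G Np p (ω.1 p))
        ≤ 4 * Γ ^ 4 * (2 + D) * (rowSq G Np b p ω + entSq G Np b p ω / L) := by
      intro ω
      have := isProbabilityMeasure_newLaw M h hp' (ω.1 p)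
      have hm : Measurable fun y : Fin (Np (p + 1)) → ℕ × X => append p ω y :=
        (measurable_append _ p).comp measurable_prodMk_left
      rw [integral_add (((bddMeas_rowSq h b hp).comp hm).integrable _)
        (((hE hp).comp hm).integrable _), integral_div]
      have hR := integral_rowSq_append_le M h b hp (hΓ p hp') ω
      have hS := integral_entSq_append_le M h b hp (hΓ p hp') ω
      have hR0 := rowSq_nonneg G Np b p ω
      have hE0 := entSq_nonneg G Np b p ω
      obtain ⟨hl, hu⟩ := hNp (p + 1) hp
      have hN := h.cast_pos hp
      calc _ ≤ 4 * Γ ^ 4 * (rowSq G Np b p ω + entSq G Np b p ω / L)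
            + 4 * Γ ^ 4 * (entSq G Np b p ω + (D * L) * rowSq G Np b p ω) / L := by
            refine add_le_add (hR.trans ?_) ?_
            · gcongr
            · gcongr
              exact hS.trans (by gcongr)
        _ = 4 * Γ ^ 4 * ((1 + D) * rowSq G Np b p ω + 2 * (entSq G Np b p ω / L)) := by
            field_simp
            ring
        _ ≤ 4 * Γ ^ 4 * ((2 + D) * rowSq G Np b p ω + (2 + D) * (entSq G Np b p ω / L)) := by
            gcongr
            · norm_num
            · linarith
        _ = _ := by ring
    have hB := (bddMeas_rowSq h b hp').add (hE hp')
    calc _ ≤ ∫ ω, 4 * Γ ^ 4 * (2 + D) * (rowSq G Np b p ω + entSq G Np b p ω / L)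
            ∂(pfLaw M0 M G Np p) := by
          refine integral_mono_of_nonneg (Eventually.of_forall fun ω => ?_)
            ((hB.integrable _).const_mul _) (Eventually.of_forall hstep)
          exact integral_nonneg fun _ => add_nonneg (rowSq_nonneg _ _ _ _ _)
            (div_nonneg (entSq_nonneg _ _ _ _ _) hL.le)
      _ ≤ 4 * Γ ^ 4 * (2 + D) * ((4 * Γ ^ 4 * (2 + D)) ^ p * (1 + D)) := by
          rw [integral_const_mul]
          gcongr
          exact ih hp'
      _ = _ := by ring

lemma exists_integral_pairSum_sq_le (h : Setup n G Np) (b : ℕ → Bool) (hD : 0 ≤ D)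
    (hΓ : ∀ q ≤ n, ∀ x, G q x ≤ Γ) {p : ℕ} (hp : p ≤ n) {f : X × X → ℝ} (hf : BddMeas f) :
    ∃ C : ℝ, ∀ (Np : ℕ → ℕ) (L : ℝ), Setup n G Np → 0 < L →
      (∀ q ≤ n, L ≤ Np q ∧ (Np q : ℝ) ≤ D * L) →
      ∫ ω, pairSum G Np b p f ω ^ 2 ∂(pfLaw M0 M G Np p) ≤ muB M0 M G p b f ^ 2 + C / L := by
  induction p generalizing f with
  | zero =>
    obtain ⟨K, hK0, hK⟩ := hf.exists_pos
    refine ⟨24 * K ^ 2, fun Np L h hL hNp => ?_⟩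
    refine (integral_pairSum_zero_sq_le M0 M h b hf hK).trans ?_
    rw [muB_zero M0 M b hf]
    gcongr
    exact (hNp 0 hp).1
  | succ p ih =>
    have hp' : p ≤ n := by omega
    obtain ⟨K, hK0, hK⟩ := hf.exists_pos
    obtain ⟨C, hC⟩ := ih hp' (bddMeas_pairQ M h b hp' hf)
    refine ⟨C + 16 * K ^ 2 * Γ ^ 4 * ((4 * Γ ^ 4 * (2 + D)) ^ p * (1 + D)),
      fun Np L h hL hNp => ?_⟩
    have := isProbabilityMeasure_pfLaw M M0 h hp'
    rw [integral_pfLaw_succ M M0 h hp ((bddMeas_pairSum h b hp hf).pow 2)]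
    have hN := h.cast_pos hp
    have hl := (hNp (p + 1) hp).1
    have hE : BddMeas fun ω => entSq G Np b p ω / L := by
      simp_rw [div_eq_mul_inv]
      exact (bddMeas_entSq h b hp').mul (BddMeas.const _)
    have hB := (bddMeas_rowSq h b hp').add hE
    have hQ := bddMeas_pairSum h b hp' (bddMeas_pairQ M h b hp' hf)
    have hstep : ∀ ω, ∫ y, pairSum G Np b (p + 1) f (append p ω y) ^ 2
          ∂(Measure.pi fun _ : Fin (Np (p + 1)) => newLaw M G Np p (ω.1 p))
        ≤ pairSum G Np b p (pairQ M G b p f) ω ^ 2 + 16 * K ^ 2 * Γ ^ 4 / L *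
          (rowSq G Np b p ω + entSq G Np b p ω / L) := by
      intro ω
      have hR0 := rowSq_nonneg G Np b p ω
      have hE0 := entSq_nonneg G Np b p ω
      refine (integral_pairSum_append_sq_le M h b hp (hΓ p hp') hf hK ω).trans ?_
      calc _ ≤ pairSum G Np b p (pairQ M G b p f) ω ^ 2 + 16 * K ^ 2 * Γ ^ 4 *
            (rowSq G Np b p ω / L + entSq G Np b p ω / L ^ 2) := by gcongr
        _ = _ := by field_simp
    calc _ ≤ ∫ ω, (pairSum G Np b p (pairQ M G b p f) ω ^ 2 + 16 * K ^ 2 * Γ ^ 4 / L *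
            (rowSq G Np b p ω + entSq G Np b p ω / L)) ∂(pfLaw M0 M G Np p) := by
          refine integral_mono_of_nonneg (Eventually.of_forall fun ω => ?_)
            (((hQ.pow 2).integrable _).add ((hB.integrable _).const_mul _))
            (Eventually.of_forall hstep)
          exact integral_nonneg fun _ => sq_nonneg _
      _ ≤ (muB M0 M G p b (pairQ M G b p f) ^ 2 + C / L) + 16 * K ^ 2 * Γ ^ 4 / L *
            ((4 * Γ ^ 4 * (2 + D)) ^ p * (1 + D)) := by
          rw [integral_add ((hQ.pow 2).integrable _) ((hB.integrable _).const_mul _),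
            integral_const_mul]
          exact add_le_add (hC Np L h hL hNp) (mul_le_mul_of_nonneg_left
            (integral_rowSq_add_entSq_le M0 M h b hL hD hNp hΓ hp') (by positivity))
      _ = _ := by
          rw [muB_succ M0 M h b hp hf]
          ring

end Moments

section Marginal

variable {n : ℕ} {G : ℕ → X → ℝ} {Np : ℕ → ℕ} (M0 : Measure X) [IsProbabilityMeasure M0]
  (M : ℕ → Kernel X X) [∀ p, IsMarkovKernel (M p)]

/-- One step of the Feynman–Kac semigroup. -/
def stepQ (M : ℕ → Kernel X X) (G : ℕ → X → ℝ) (p : ℕ) (f : X → ℝ) (x : X) : ℝ :=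
  G p x * ∫ y, f y ∂(M (p + 1) x)

lemma bddMeas_integral_kernel {f : X → ℝ} (hf : BddMeas f) (p : ℕ) :
    BddMeas fun x => ∫ y, f y ∂(M p x) :=
  BddMeas.integral_kernel (F := fun q : X × X => f q.2) (hf.comp measurable_snd)
    (M p).measurable fun _ => inferInstance

lemma bddMeas_stepQ (h : Setup n G Np) {p : ℕ} (hp : p ≤ n) {f : X → ℝ} (hf : BddMeas f) :
    BddMeas (stepQ M G p f) :=
  (h.bddMeas hp).mul (bddMeas_integral_kernel M hf (p + 1))

lemma isFiniteMeasure_withDensity_gammaFK (h : Setup n G Np) {p : ℕ} (hp : p ≤ n)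
    [IsFiniteMeasure (gammaFK M0 M G p)] :
    IsFiniteMeasure ((gammaFK M0 M G p).withDensity fun x => ENNReal.ofReal (G p x)) :=
  isFiniteMeasure_withDensity_ofReal ((h.bddMeas hp).integrable _).2

lemma isFiniteMeasure_gammaFK (h : Setup n G Np) {p : ℕ} (hp : p ≤ n) :
    IsFiniteMeasure (gammaFK M0 M G p) := by
  induction p with
  | zero => exact inferInstanceAs (IsFiniteMeasure M0)
  | succ p ih =>
    have := ih (by omega)
    have := isFiniteMeasure_withDensity_gammaFK M0 M h (p := p) (by omega)
    refine ⟨?_⟩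
    rw [gammaFK, Measure.bind_apply MeasurableSet.univ (M (p + 1)).measurable.aemeasurable]
    simpa using measure_lt_top ((gammaFK M0 M G p).withDensity fun x => ENNReal.ofReal (G p x))
      Set.univ

lemma gInt_zero (f : X → ℝ) : gInt M0 M G 0 f = ∫ x, f x ∂M0 := rfl

lemma gInt_succ (h : Setup n G Np) {p : ℕ} (hp : p + 1 ≤ n) {f : X → ℝ} (hf : BddMeas f) :
    gInt M0 M G (p + 1) f = gInt M0 M G p (stepQ M G p f) := by
  have := isFiniteMeasure_gammaFK M0 M h (p := p) (by omega)
  have := isFiniteMeasure_withDensity_gammaFK M0 M h (p := p) (by omega)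
  rw [gInt, gammaFK, integral_bind_of_bddMeas (M (p + 1)).measurable (fun _ => inferInstance) hf,
    integral_withDensity_eq_integral_toReal_smul (h.meas p (by omega)).ennreal_ofReal
      (Eventually.of_forall fun _ => ENNReal.ofReal_lt_top)]
  refine integral_congr_ae (Eventually.of_forall fun x => ?_)
  simp only [ENNReal.toReal_ofReal (h.pos p (by omega) x).le, smul_eq_mul, stepQ]

lemma integral_pos_of_bddMeas {Y : Type*} [MeasurableSpace Y] (μ : Measure Y)
    [IsProbabilityMeasure μ] {f : Y → ℝ} (hf : BddMeas f) (hpos : ∀ x, 0 < f x) :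
    0 < ∫ x, f x ∂μ := by
  rw [integral_pos_iff_support_of_nonneg (fun x => (hpos x).le) (hf.integrable μ)]
  have : Function.support f = Set.univ := Set.eq_univ_of_forall fun x => (hpos x).ne'
  rw [this, measure_univ]
  exact one_pos

lemma gInt_pos (h : Setup n G Np) {p : ℕ} (hp : p ≤ n) {f : X → ℝ} (hf : BddMeas f)
    (hpos : ∀ x, 0 < f x) : 0 < gInt M0 M G p f := by
  induction p generalizing f with
  | zero => exact integral_pos_of_bddMeas M0 hf hpos
  | succ p ih =>
    rw [gInt_succ M0 M h hp hf]
    exact ih (by omega) (bddMeas_stepQ M h (by omega) hf) fun x =>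
      mul_pos (h.pos p (by omega) x) (integral_pos_of_bddMeas _ hf hpos)

lemma bddMeas_etaN (p : ℕ) {f : X → ℝ} (hf : BddMeas f) : BddMeas (etaN Np p f) :=
  (BddMeas.const _).mul (BddMeas.sum _ fun i _ =>
    hf.comp (u := fun ω : (ℕ → ℕ → X) × (ℕ → ℕ → ℕ) => ω.1 p i) (by fun_prop))

lemma bddMeas_gammaN (h : Setup n G Np) {p : ℕ} (hp : p ≤ n) {f : X → ℝ} (hf : BddMeas f) :
    BddMeas (gammaN G Np p f) :=
  (BddMeas.prod _ fun q hq => bddMeas_etaN q (h.bddMeas (by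
    have := Finset.mem_range.1 hq; omega))).mul (bddMeas_etaN p hf)

lemma etaN_pos (h : Setup n G Np) {p : ℕ} (hp : p ≤ n) {f : X → ℝ} (hpos : ∀ x, 0 < f x)
    (ω : (ℕ → ℕ → X) × (ℕ → ℕ → ℕ)) : 0 < etaN Np p f ω :=
  mul_pos (inv_pos.2 (h.cast_pos hp)) (Finset.sum_pos (fun _ _ => hpos _)
    ⟨0, Finset.mem_range.2 (by have := h.two p hp; omega)⟩)

lemma etaN_le (h : Setup n G Np) {p : ℕ} (hp : p ≤ n) {f : X → ℝ} {Γ : ℝ} (hΓ : ∀ x, f x ≤ Γ)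
    (ω : (ℕ → ℕ → X) × (ℕ → ℕ → ℕ)) : etaN Np p f ω ≤ Γ := by
  rw [etaN, inv_mul_le_iff₀ (h.cast_pos hp)]
  exact (Finset.sum_le_sum fun i _ => hΓ (ω.1 p i)).trans (by simp)

lemma gammaN_pos (h : Setup n G Np) {p : ℕ} (hp : p ≤ n) {f : X → ℝ} (hpos : ∀ x, 0 < f x)
    (ω : (ℕ → ℕ → X) × (ℕ → ℕ → ℕ)) : 0 < gammaN G Np p f ω :=
  mul_pos (Finset.prod_pos fun q hq => by
    have hq' : q ≤ n := by have := Finset.mem_range.1 hq; omega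
    exact etaN_pos h hq' (h.pos q hq') ω) (etaN_pos h hp hpos ω)

variable [Nonempty X]

lemma gammaN_append (p : ℕ) (f : X → ℝ) (ω : (ℕ → ℕ → X) × (ℕ → ℕ → ℕ))
    (y : Fin (Np (p + 1)) → ℕ × X) :
    gammaN G Np (p + 1) f (append p ω y) =
      (∏ q ∈ Finset.range (p + 1), etaN Np q (G q) ω) * (Np (p + 1) : ℝ)⁻¹ * ∑ i, f (y i).2 := by
  rw [gammaN, mul_assoc]
  congr 1
  · refine Finset.prod_congr rfl fun q hq => ?_
    rw [etaN, append_fst_of_ne (by have := Finset.mem_range.1 hq; omega), etaN]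
  · simp only [etaN, Finset.sum_range (n := Np (p + 1)), append_fst_self]

lemma integral_snd_newLaw (h : Setup n G Np) {p : ℕ} (hp : p ≤ n) {f : X → ℝ} (hf : BddMeas f)
    (ω : (ℕ → ℕ → X) × (ℕ → ℕ → ℕ)) :
    (∏ q ∈ Finset.range (p + 1), etaN Np q (G q) ω) * ∫ q, f q.2 ∂(newLaw M G Np p (ω.1 p))
      = gammaN G Np p (stepQ M G p f) ω := by
  rw [integral_newLaw M h hp (ω.1 p) (F := fun q => f q.2) (hf.comp measurable_snd),
    Finset.prod_range_succ, gammaN, mul_assoc]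
  congr 1
  simp only [etaN, stepQ]
  have := (h.sum_pos hp (ω.1 p)).ne'
  field_simp

lemma integral_gammaN_append (h : Setup n G Np) {p : ℕ} (hp : p + 1 ≤ n) {f : X → ℝ}
    (hf : BddMeas f) (ω : (ℕ → ℕ → X) × (ℕ → ℕ → ℕ)) :
    ∫ y, gammaN G Np (p + 1) f (append p ω y)
        ∂(Measure.pi fun _ : Fin (Np (p + 1)) => newLaw M G Np p (ω.1 p))
      = gammaN G Np p (stepQ M G p f) ω := by
  have hp' : p ≤ n := by omega
  have := isProbabilityMeasure_newLaw M h hp' (ω.1 p)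
  have hN := (h.cast_pos hp).ne'
  simp_rw [gammaN_append]
  rw [integral_const_mul, integral_sum_eval _ (f := fun q : ℕ × X => f q.2)
    (hf.comp measurable_snd), ← integral_snd_newLaw M h hp' hf]
  field_simp

lemma integral_gammaN_append_sq_le (h : Setup n G Np) {p : ℕ} (hp : p + 1 ≤ n) {Γ K : ℝ}
    (hΓ : ∀ q ≤ n, ∀ x, G q x ≤ Γ) {f : X → ℝ} (hf : BddMeas f) (hK : ∀ x, |f x| ≤ K)
    (ω : (ℕ → ℕ → X) × (ℕ → ℕ → ℕ)) :
    ∫ y, gammaN G Np (p + 1) f (append p ω y) ^ 2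
        ∂(Measure.pi fun _ : Fin (Np (p + 1)) => newLaw M G Np p (ω.1 p))
      ≤ gammaN G Np p (stepQ M G p f) ω ^ 2 + (Γ ^ (p + 1)) ^ 2 * K ^ 2 / Np (p + 1) := by
  have hp' : p ≤ n := by omega
  have := isProbabilityMeasure_newLaw M h hp' (ω.1 p)
  have hN := h.cast_pos hp
  have hf' : BddMeas fun q : ℕ × X => f q.2 := hf.comp measurable_snd
  set P := ∏ q ∈ Finset.range (p + 1), etaN Np q (G q) ω with hP
  have hq : ∀ q ∈ Finset.range (p + 1), q ≤ n := fun q hq => by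
    have := Finset.mem_range.1 hq; omega
  have hP0 : 0 ≤ P := Finset.prod_nonneg fun q hq' =>
    (etaN_pos h (hq q hq') (h.pos q (hq q hq')) ω).le
  have hP1 : P ≤ Γ ^ (p + 1) := by
    refine (Finset.prod_le_prod (fun q hq' => (etaN_pos h (hq q hq') (h.pos q (hq q hq')) ω).le)
      fun q hq' => etaN_le h (hq q hq') (hΓ q (hq q hq')) ω).trans ?_
    simp
  have h2 : ∫ q, f q.2 ^ 2 ∂(newLaw M G Np p (ω.1 p)) ≤ K ^ 2 := by
    have := integral_mono ((hf'.pow 2).integrable (newLaw M G Np p (ω.1 p)))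
      (integrable_const (K ^ 2)) fun q => sq_le_sq' (abs_le.1 (hK q.2)).1 (abs_le.1 (hK q.2)).2
    simpa using this
  have h1 := integral_sum_eval_sq_le (newLaw M G Np p (ω.1 p)) (N := Np (p + 1)) hf'
  rw [← integral_snd_newLaw M h hp' hf]
  simp_rw [gammaN_append, mul_pow _ (∑ i, _)]
  rw [integral_const_mul, ← hP]
  set N : ℝ := (Np (p + 1) : ℝ) with hNdef
  set I := ∫ q, f q.2 ∂(newLaw M G Np p (ω.1 p)) with hI
  calc (P * N⁻¹) ^ 2 * _ ≤ (P * N⁻¹) ^ 2 * ((N * I) ^ 2 + N * K ^ 2) := by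
        gcongr
        exact h1.trans (by gcongr)
    _ = (P * I) ^ 2 + P ^ 2 * K ^ 2 / N := by
        field_simp
    _ ≤ _ := by gcongr

lemma gammaN_zero (f : X → ℝ) (A : ℕ → ℕ → ℕ) (x : Fin (Np 0) → X) :
    gammaN G Np 0 f (fun p => if p = 0 then padF x else fun _ => Classical.arbitrary X, A)
      = (Np 0 : ℝ)⁻¹ * ∑ i, f (x i) := by
  have hx : ∀ i : Fin (Np 0), padF x i = x i := fun i => by simp [padF]
  simp [gammaN, etaN, Finset.sum_range (n := Np 0), hx]

lemma integral_gammaN_eq (h : Setup n G Np) {p : ℕ} (hp : p ≤ n) {f : X → ℝ} (hf : BddMeas f) :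
    ∫ ω, gammaN G Np p f ω ∂(pfLaw M0 M G Np p) = gInt M0 M G p f := by
  induction p generalizing f with
  | zero =>
    have hN := (h.cast_pos hp).ne'
    rw [integral_pfLaw_zero M M0 (bddMeas_gammaN h hp hf).meas, gInt_zero]
    simp_rw [gammaN_zero]
    rw [integral_const_mul, integral_sum_eval M0 hf]
    field_simp
  | succ p ih =>
    rw [integral_pfLaw_succ M M0 h hp (bddMeas_gammaN h hp hf), gInt_succ M0 M h hp hf,
      ← ih (by omega) (bddMeas_stepQ M h (by omega) hf)]
    simp_rw [integral_gammaN_append M h hp hf]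

lemma exists_integral_gammaN_sq_le (h : Setup n G Np) {Γ : ℝ} (hΓ : ∀ q ≤ n, ∀ x, G q x ≤ Γ)
    {p : ℕ} (hp : p ≤ n) {f : X → ℝ} (hf : BddMeas f) :
    ∃ C : ℝ, ∀ (Np : ℕ → ℕ) (L : ℝ), Setup n G Np → 0 < L → (∀ q ≤ n, L ≤ Np q) →
      ∫ ω, gammaN G Np p f ω ^ 2 ∂(pfLaw M0 M G Np p) ≤ gInt M0 M G p f ^ 2 + C / L := by
  induction p generalizing f with
  | zero =>
    obtain ⟨K, hK0, hK⟩ := hf.exists_pos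
    refine ⟨K ^ 2, fun Np L h hL hNp => ?_⟩
    have hN := h.cast_pos hp
    rw [integral_pfLaw_zero M M0 ((bddMeas_gammaN h hp hf).pow 2).meas, gInt_zero]
    simp_rw [gammaN_zero, mul_pow]
    rw [integral_const_mul]
    have h1 := integral_sum_eval_sq_le M0 (N := Np 0) hf
    have h2 : ∫ x, f x ^ 2 ∂M0 ≤ K ^ 2 := by
      have := integral_mono ((hf.pow 2).integrable M0)
        (integrable_const (K ^ 2)) fun x => sq_le_sq' (abs_le.1 (hK x)).1 (abs_le.1 (hK x)).2
      simpa using this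
    have hl := hNp 0 hp
    set N : ℝ := (Np 0 : ℝ) with hNdef
    calc N⁻¹ ^ 2 * _ ≤ N⁻¹ ^ 2 * ((N * ∫ x, f x ∂M0) ^ 2 + N * K ^ 2) := by
          gcongr
          exact h1.trans (by gcongr)
      _ = (∫ x, f x ∂M0) ^ 2 + K ^ 2 / N := by
          field_simp
      _ ≤ _ := by gcongr
  | succ p ih =>
    have hp' : p ≤ n := by omega
    obtain ⟨K, hK0, hK⟩ := hf.exists_pos
    obtain ⟨C, hC⟩ := ih hp' (bddMeas_stepQ M h hp' hf)
    refine ⟨C + (Γ ^ (p + 1)) ^ 2 * K ^ 2, fun Np L h hL hNp => ?_⟩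
    have := isProbabilityMeasure_pfLaw M M0 h hp'
    rw [integral_pfLaw_succ M M0 h hp ((bddMeas_gammaN h hp hf).pow 2)]
    have hl := hNp (p + 1) hp
    have hQ := (bddMeas_gammaN h hp' (bddMeas_stepQ M h hp' hf)).pow 2
    calc _ ≤ ∫ ω, (gammaN G Np p (stepQ M G p f) ω ^ 2 + (Γ ^ (p + 1)) ^ 2 * K ^ 2 / L)
            ∂(pfLaw M0 M G Np p) := by
          refine integral_mono_of_nonneg (Eventually.of_forall fun ω => ?_)
            ((hQ.integrable _).add (integrable_const _)) (Eventually.of_forall fun ω => ?_)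
          · exact integral_nonneg fun _ => sq_nonneg _
          · refine (integral_gammaN_append_sq_le M h hp hΓ hf hK ω).trans ?_
            exact add_le_add le_rfl (div_le_div_of_nonneg_left (by positivity) hL hl)
      _ ≤ (gInt M0 M G p (stepQ M G p f) ^ 2 + C / L) + (Γ ^ (p + 1)) ^ 2 * K ^ 2 / L := by
          rw [integral_add (hQ.integrable _) (integrable_const _)]
          simp only [integral_const, probReal_univ, one_smul]
          exact add_le_add (hC Np L h hL hNp) le_rfl
      _ = _ := by
          rw [gInt_succ M0 M h hp hf]
          ring

end Marginal

section Tracing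

variable {n : ℕ} {G : ℕ → X → ℝ} {Np : ℕ → ℕ}

lemma trace_self (A : ℕ → ℕ → ℕ) (n i : ℕ) : trace A n i n = i := by
  simp [trace, traceAux]

lemma trace_of_lt (A : ℕ → ℕ → ℕ) {n q : ℕ} (i : ℕ) (hq : q < n) :
    trace A n i q = A q (trace A n i (q + 1)) := by
  obtain ⟨j, rfl⟩ := Nat.exists_eq_add_of_lt hq
  have h1 : q + j + 1 - q = j + 1 := by omega
  have h2 : q + j + 1 - (q + 1) = j := by omega
  have h3 : q + j + 1 - (j + 1) = q := by omega
  simp only [trace, h1, h2, traceAux, h3]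

lemma measurable_update_const (p v : ℕ) :
    Measurable fun f : ℕ → ℕ => Function.update f p v :=
  measurable_update'.comp (measurable_id.prodMk measurable_const)

lemma isProbabilityMeasure_resample (h : Setup n G Np) {p : ℕ} (hp : p ≤ n)
    (ω : (ℕ → ℕ → X) × (ℕ → ℕ → ℕ)) (P : Prop) [Decidable P] (v : ℕ) :
    IsProbabilityMeasure (if P then cat (Np p) fun j => G p (ω.1 p j)
      else Measure.dirac (ω.2 p v)) := by
  split_ifs
  · exact isProbabilityMeasure_cat (h.sum_pos hp _)
  · infer_instance

lemma isProbabilityMeasure_k2Law (h : Setup n G Np) (ω : (ℕ → ℕ → X) × (ℕ → ℕ → ℕ))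
    (K : ℕ → ℕ) {p : ℕ} (hp : p ≤ n) (v : ℕ) : IsProbabilityMeasure (k2Law G Np ω K p v) := by
  induction p generalizing v with
  | zero => exact inferInstanceAs (IsProbabilityMeasure (Measure.dirac _))
  | succ p ih =>
    have := isProbabilityMeasure_resample h (p := p) (by omega) ω (v = K (p + 1)) v
    refine isProbabilityMeasure_bind Measurable.of_discrete fun w => ?_
    have := ih (by omega) w
    exact Measure.isProbabilityMeasure_map (measurable_update_const _ _).aemeasurable

lemma integral_k2Law_zero (ω : (ℕ → ℕ → X) × (ℕ → ℕ → ℕ)) (K : ℕ → ℕ) (v : ℕ)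
    {F : (ℕ → ℕ) → ℝ} (hF : BddMeas F) :
    ∫ k, F k ∂(k2Law G Np ω K 0 v) = F fun q => if q = 0 then v else 0 :=
  integral_dirac' _ _ hF.meas.stronglyMeasurable

lemma integral_k2Law_succ (h : Setup n G Np) (ω : (ℕ → ℕ → X) × (ℕ → ℕ → ℕ))
    (K : ℕ → ℕ) {p : ℕ} (hp : p + 1 ≤ n) (v : ℕ) {F : (ℕ → ℕ) → ℝ} (hF : BddMeas F) :
    ∫ k, F k ∂(k2Law G Np ω K (p + 1) v)
      = ∫ w, ∫ k, F (Function.update k (p + 1) v) ∂(k2Law G Np ω K p w)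
        ∂(if v = K (p + 1) then cat (Np p) fun j => G p (ω.1 p j)
          else Measure.dirac (ω.2 p v)) := by
  have := isProbabilityMeasure_resample h (p := p) (by omega) ω (v = K (p + 1)) v
  rw [k2Law, integral_bind_of_bddMeas Measurable.of_discrete (fun w => by
    have := isProbabilityMeasure_k2Law h ω K (p := p) (by omega) w
    exact Measure.isProbabilityMeasure_map (measurable_update_const _ _).aemeasurable) hF]
  refine integral_congr_ae (Eventually.of_forall fun w => ?_)
  exact integral_map (measurable_update_const _ _).aemeasurable hF.meas.aestronglyMeasurable

lemma integral_k2Law_mul_apply (h : Setup n G Np) (ω : (ℕ → ℕ → X) × (ℕ → ℕ → ℕ))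
    (K : ℕ → ℕ) {p : ℕ} (hp : p ≤ n) (v : ℕ) {F : (ℕ → ℕ) → ℝ} (hF : BddMeas F)
    {g : ℕ → ℝ} (hg : BddMeas g) :
    ∫ k, F k * g (k p) ∂(k2Law G Np ω K p v) = (∫ k, F k ∂(k2Law G Np ω K p v)) * g v := by
  have hFg : BddMeas fun k : ℕ → ℕ => F k * g (k p) := hF.mul (hg.comp (measurable_pi_apply p))
  cases p with
  | zero => rw [integral_k2Law_zero ω K v hFg, integral_k2Law_zero ω K v hF]; rfl
  | succ p =>
    rw [integral_k2Law_succ h ω K hp v hFg, integral_k2Law_succ h ω K hp v hF]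
    simp only [Function.update_self, integral_mul_const]

/-- The two traces meet up to time `p` exactly where `b` says so. -/
def meetInd (Np : ℕ → ℕ) (p : ℕ) (b : ℕ → Bool) (K k : ℕ → ℕ) : ℝ :=
  if inI Np p b (K, k) then 1 else 0

lemma bddMeas_inI (Np : ℕ → ℕ) (p : ℕ) (b : ℕ → Bool) :
    BddMeas fun k : (ℕ → ℕ) × (ℕ → ℕ) => if inI Np p b k then (1 : ℝ) else 0 := by
  refine (BddMeas.const 1).ite_set ?_
  simp only [inI, Set.ofPred_forall]
  refine MeasurableSet.iInter fun q => MeasurableSet.iInter fun _ => ?_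
  exact measurableSet_preimage (f := fun k : (ℕ → ℕ) × (ℕ → ℕ) => (k.1 q, k.2 q)) (by fun_prop)
    (MeasurableSet.of_discrete (s := {r : ℕ × ℕ |
      r.1 < Np q ∧ r.2 < Np q ∧ (r.1 = r.2 ↔ b q = true)}))

lemma bddMeas_meetInd (Np : ℕ → ℕ) (p : ℕ) (b : ℕ → Bool) (K : ℕ → ℕ) :
    BddMeas (meetInd Np p b K) :=
  (bddMeas_inI Np p b).comp (u := fun k : ℕ → ℕ => (K, k)) measurable_prodMk_left

lemma meetInd_update (Np : ℕ → ℕ) (p : ℕ) (b : ℕ → Bool) (K k : ℕ → ℕ) (v : ℕ) :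
    meetInd Np (p + 1) b K (Function.update k (p + 1) v) =
      (if K (p + 1) < Np (p + 1) ∧ v < Np (p + 1) ∧ (K (p + 1) = v ↔ b (p + 1) = true) then 1
        else 0) * meetInd Np p b K k := by
  have key : inI Np (p + 1) b (K, Function.update k (p + 1) v) ↔
      (K (p + 1) < Np (p + 1) ∧ v < Np (p + 1) ∧ (K (p + 1) = v ↔ b (p + 1) = true)) ∧
        inI Np p b (K, k) := by
    constructor
    · intro hI
      refine ⟨by simpa using hI (p + 1) le_rfl, fun q hq => ?_⟩
      have := hI q (by omega)
      simpa [Function.update_of_ne (show q ≠ p + 1 by omega)] using this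
    · rintro ⟨h1, h2⟩ q hq
      rcases Nat.lt_or_ge p q with hpq | hpq
      · obtain rfl : q = p + 1 := by omega
        simpa using h1
      · simpa [Function.update_of_ne (show q ≠ p + 1 by omega)] using h2 q hpq
  simp only [meetInd, key, ite_and, ite_mul, one_mul, zero_mul]

/-- The normalizing factor of `μ_b^N` up to time `p`. -/
def pairFac (Np : ℕ → ℕ) (b : ℕ → Bool) (p : ℕ) : ℝ :=
  ∏ q ∈ Finset.range (p + 1), if b q then (Np q : ℝ) else (Np q : ℝ) / ((Np q : ℝ) - 1)

lemma gammaN_one (h : Setup n G Np) {p : ℕ} (hp : p ≤ n) (ω : (ℕ → ℕ → X) × (ℕ → ℕ → ℕ)) :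
    gammaN G Np p 1 ω = ∏ q ∈ Finset.range p, etaN Np q (G q) ω := by
  have := (h.cast_pos hp).ne'
  simp [gammaN, etaN, this]

lemma integral_meetInd (h : Setup n G Np) (b : ℕ → Bool) (ω : (ℕ → ℕ → X) × (ℕ → ℕ → ℕ))
    (K : ℕ → ℕ) {p : ℕ} (hp : p ≤ n) (hK : ∀ q < p, K q = ω.2 q (K (q + 1))) (v : ℕ) :
    pairFac Np b p * gammaN G Np p 1 ω ^ 2 * ((Np p : ℝ) ^ 2)⁻¹ *
      ∫ k, meetInd Np p b K k ∂(k2Law G Np ω K p v) = wt G Np b ω p (K p) v := by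
  have hN := (h.cast_pos hp).ne'
  have hN1 : (Np p : ℝ) - 1 ≠ 0 := by
    have := h.one_lt hp
    linarith
  induction p generalizing v with
  | zero =>
    rw [integral_k2Law_zero ω K v (bddMeas_meetInd Np 0 b K), gammaN_one h hp]
    have : inI Np 0 b (K, fun q => if q = 0 then v else 0) ↔
        (K 0 < Np 0 ∧ v < Np 0 ∧ (K 0 = v ↔ b 0 = true)) := by simp [inI]
    simp only [meetInd, this, wt, pairFac, zero_add, Finset.range_one, Finset.prod_singleton,
      Finset.range_zero, Finset.prod_empty]
    split_ifs <;> first | (field_simp; done) | simp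
  | succ p ih =>
    have hp' : p ≤ n := by omega
    have hNp := (h.cast_pos hp').ne'
    have hNp1 : (Np p : ℝ) - 1 ≠ 0 := by
      have := h.one_lt hp'
      linarith
    have ih := ih hp' (fun q hq => hK q (by omega)) (hN := hNp) (hN1 := hNp1)
    have hS := (h.sum_pos hp' (ω.1 p)).ne'
    rw [integral_k2Law_succ h ω K hp v (bddMeas_meetInd Np (p + 1) b K)]
    simp only [meetInd_update, integral_const_mul]
    by_cases hc : K (p + 1) < Np (p + 1) ∧ v < Np (p + 1) ∧ (K (p + 1) = v ↔ b (p + 1) = true)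
    swap
    · simp [wt, hc]
    have hg : gammaN G Np (p + 1) 1 ω = gammaN G Np p 1 ω *
        ((Np p : ℝ)⁻¹ * ∑ l ∈ Finset.range (Np p), G p (ω.1 p l)) := by
      rw [gammaN_one h hp, gammaN_one h hp', Finset.prod_range_succ, etaN]
    rw [hg, pairFac, Finset.prod_range_succ, ← pairFac]
    simp only [wt, if_pos hc, one_mul, ← hK p (by omega)]
    cases hb : b (p + 1) with
    | true =>
      have hv : v = K (p + 1) := (hc.2.2.2 hb).symm
      simp only [if_pos hv, if_true]
      rw [integral_cat (fun j _ => (h.pos p hp' _).le)]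
      set S := ∑ l ∈ Finset.range (Np p), G p (ω.1 p l)
      simp_rw [← ih, Finset.mul_sum]
      refine Finset.sum_congr rfl fun l _ => ?_
      field_simp
    | false =>
      have hv : v ≠ K (p + 1) := fun hv => by simpa [hb] using hc.2.2.1 hv.symm
      simp only [if_neg hv, Bool.false_eq_true, if_false]
      rw [integral_dirac, ← ih]
      field_simp

lemma integral_kLaw (h : Setup n G Np) (ω : (ℕ → ℕ → X) × (ℕ → ℕ → ℕ))
    {F : (ℕ → ℕ) × (ℕ → ℕ) → ℝ} (hF : BddMeas F) :
    ∫ k, F k ∂(kLaw G Np n ω) = ((Np n : ℝ) ^ 2)⁻¹ * ∑ i ∈ Finset.range (Np n),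
      ∑ j ∈ Finset.range (Np n),
        ∫ k, F (trace ω.2 n i, k) ∂(k2Law G Np ω (trace ω.2 n i) n j) := by
  have hu : 0 < ∑ j ∈ Finset.range (Np n), (fun _ : ℕ => (1 : ℝ)) j := by
    simpa using h.cast_pos le_rfl
  have := isProbabilityMeasure_cat hu
  have hm : ∀ i : ℕ, Measurable fun k : ℕ → ℕ => (trace ω.2 n i, k) := fun i =>
    measurable_prodMk_left
  have h2 : ∀ i j, IsProbabilityMeasure
      ((k2Law G Np ω (trace ω.2 n i) n j).map fun k => (trace ω.2 n i, k)) := fun i j => by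
    have := isProbabilityMeasure_k2Law h ω (trace ω.2 n i) le_rfl j
    exact Measure.isProbabilityMeasure_map (hm i).aemeasurable
  rw [kLaw, unif, integral_bind_of_bddMeas Measurable.of_discrete
    (fun i => isProbabilityMeasure_bind Measurable.of_discrete (h2 i)) hF,
    integral_cat fun _ _ => zero_le_one]
  simp_rw [integral_bind_of_bddMeas Measurable.of_discrete (h2 _) hF,
    integral_cat (m := Np n) (w := fun _ => (1 : ℝ)) fun _ _ => zero_le_one,
    integral_map (hm _).aemeasurable hF.meas.aestronglyMeasurable]
  simp only [Finset.sum_const, Finset.card_range, nsmul_eq_mul, mul_one, one_mul,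
    ← Finset.mul_sum]
  rw [← mul_assoc, ← mul_inv, sq]

lemma muBN_eq_pairSum (h : Setup n G Np) (b : ℕ → Bool) {f : X × X → ℝ} (hf : BddMeas f)
    (ω : (ℕ → ℕ → X) × (ℕ → ℕ → ℕ)) : muBN G Np n b f ω = pairSum G Np b n f ω := by
  have hg : BddMeas fun k : ℕ × ℕ => f (ω.1 n k.1, ω.1 n k.2) := by
    obtain ⟨C, hC⟩ := hf.bdd
    exact ⟨Measurable.of_discrete, C, fun k => hC _⟩
  rw [muBN, integral_kLaw h ω ((bddMeas_inI Np n b).mul (hg.comp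
    (u := fun k : (ℕ → ℕ) × (ℕ → ℕ) => (k.1 n, k.2 n)) (by fun_prop))), ← pairFac, ← mul_assoc,
    pairSum, Finset.mul_sum]
  refine Finset.sum_congr rfl fun i _ => ?_
  rw [Finset.mul_sum]
  refine Finset.sum_congr rfl fun j _ => ?_
  have h1 := integral_k2Law_mul_apply h ω (trace ω.2 n i) le_rfl j
    (bddMeas_meetInd Np n b (trace ω.2 n i))
    (hg.comp (u := fun l : ℕ => (i, l)) measurable_prodMk_left)
  have h2 := integral_meetInd h b ω (trace ω.2 n i) le_rfl
    (fun q hq => trace_of_lt ω.2 i hq) j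
  simp only [trace_self] at h2 ⊢
  simp only [meetInd] at h1 h2
  rw [h1, ← mul_assoc, h2]

end Tracing

section ConvergenceInProbability

variable {Ω : Type*} [MeasurableSpace Ω]

/-- The filter of events of `ℕ × Ω` whose complementary sections have vanishing probability. -/
def probFilter (P : ℕ → Measure Ω) : Filter (ℕ × Ω) where
  sets := {S | Tendsto (fun N => P N {ω | (N, ω) ∉ S}) atTop (nhds 0)}
  univ_sets := by simp
  sets_of_superset := by
    intro S T hS hST
    exact tendsto_of_tendsto_of_tendsto_of_le_of_le tendsto_const_nhds hS (fun _ => zero_le)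
      fun N => measure_mono fun ω hω hS' => hω (hST hS')
  inter_sets := by
    intro S T hS hT
    have h := Tendsto.add hS hT
    rw [add_zero] at h
    refine tendsto_of_tendsto_of_tendsto_of_le_of_le tendsto_const_nhds h (fun _ => zero_le)
      fun N => ?_
    refine le_trans (measure_mono ?_) (measure_union_le _ _)
    intro ω hω
    by_cases hS' : (N, ω) ∈ S
    · exact Or.inr fun hT' => hω ⟨hS', hT'⟩
    · exact Or.inl hS'

lemma eventually_probFilter {P : ℕ → Measure Ω} {p : ℕ → Ω → Prop}
    (h : ∀ᶠ N in atTop, ∀ ω, p N ω) : ∀ᶠ q in probFilter P, p q.1 q.2 := by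
  change Tendsto (fun N => P N {ω | ¬ p N ω}) atTop (nhds 0)
  refine tendsto_const_nhds.congr' ?_
  filter_upwards [h] with N hN
  simp [hN]

lemma tendsto_probFilter_iff {P : ℕ → Measure Ω} {Y : ℕ → Ω → ℝ} {y : ℝ} :
    Tendsto (fun q => Y q.1 q.2) (probFilter P) (nhds y) ↔
      ∀ ε : ℝ, 0 < ε → Tendsto (fun N => P N {ω | ε ≤ |Y N ω - y|}) atTop (nhds 0) := by
  rw [Metric.tendsto_nhds]
  refine forall₂_congr fun ε _ => ?_
  change Tendsto (fun N => P N {ω | ¬ dist (Y N ω) y < ε}) atTop (nhds 0) ↔ _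
  simp only [not_lt, Real.dist_eq]

lemma tendsto_probFilter_of_sq_le {P : ℕ → Measure Ω} {Y : ℕ → Ω → ℝ} {m C a : ℝ} (ha : 0 < a)
    (h : ∀ᶠ N in atTop, IsProbabilityMeasure (P N) ∧ BddMeas (Y N) ∧ ∫ ω, Y N ω ∂(P N) = m ∧
      ∫ ω, Y N ω ^ 2 ∂(P N) ≤ m ^ 2 + C / (a * N)) :
    Tendsto (fun q => Y q.1 q.2) (probFilter P) (nhds m) := by
  rw [tendsto_probFilter_iff]
  intro ε hε
  have h1 : Tendsto (fun N : ℕ => C / (a * N) / ε ^ 2) atTop (nhds 0) := by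
    have h2 : Tendsto (fun N : ℕ => a * (N : ℝ)) atTop atTop :=
      tendsto_natCast_atTop_atTop.const_mul_atTop ha
    simpa using (h2.const_div_atTop C).div_const (ε ^ 2)
  have h3 := ENNReal.tendsto_ofReal h1
  rw [ENNReal.ofReal_zero] at h3
  refine tendsto_of_tendsto_of_tendsto_of_le_of_le' tendsto_const_nhds h3
    (Eventually.of_forall fun _ => zero_le) ?_
  filter_upwards [h] with N hN
  have := hN.1
  exact measure_abs_sub_ge_le hN.2.1 hN.2.2.1 hN.2.2.2 hε

end ConvergenceInProbability

section ParticleNumbers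

lemma exists_forall_le_of_forall_exists {n : ℕ} {Y : Type*} {F : ℕ → Y → ℝ}
    (h : ∀ p ≤ n, ∃ C, ∀ y, F p y ≤ C) : ∃ C, ∀ p ≤ n, ∀ y, F p y ≤ C := by
  choose! C hC using h
  obtain ⟨B, hB⟩ := Finset.exists_le ((Finset.range (n + 1)).image C)
  exact ⟨B, fun p hp y => (hC p hp y).trans
    (hB _ (Finset.mem_image_of_mem C (Finset.mem_range.2 (by omega))))⟩

lemma exists_npart_bounds {n : ℕ} {c : ℕ → ℝ} (hc : ∀ p ≤ n, 0 < c p) :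
    ∃ a D : ℝ, 0 < a ∧ 0 ≤ D ∧ (∀ᶠ N : ℕ in atTop, ∀ q ≤ n, 2 ≤ npart c N q) ∧
      ∀ N : ℕ, 1 ≤ N → ∀ q ≤ n, a * N ≤ npart c N q ∧ (npart c N q : ℝ) ≤ D * (a * N) := by
  obtain ⟨p, hp, hmin⟩ := Finset.exists_min_image (Finset.range (n + 1)) c ⟨0, by simp⟩
  obtain ⟨r, hr, hmax⟩ := Finset.exists_max_image (Finset.range (n + 1)) c ⟨0, by simp⟩
  have ha : 0 < c p := hc p (by have := Finset.mem_range.1 hp; omega)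
  have hb : 0 < c r := hc r (by have := Finset.mem_range.1 hr; omega)
  have hlow : ∀ N : ℕ, ∀ q ≤ n, c p * N ≤ npart c N q := fun N q hq =>
    (mul_le_mul_of_nonneg_right (hmin q (Finset.mem_range.2 (by omega)))
      (Nat.cast_nonneg N)).trans (Nat.le_ceil _)
  refine ⟨c p, (c r + 1) / c p, ha, by positivity, ?_, fun N hN q hq => ⟨hlow N q hq, ?_⟩⟩
  · have h2 : Tendsto (fun N : ℕ => c p * (N : ℝ)) atTop atTop :=
      tendsto_natCast_atTop_atTop.const_mul_atTop ha
    filter_upwards [h2.eventually_ge_atTop 2] with N hN q hq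
    exact_mod_cast hN.trans (hlow N q hq)
  · have h1 : (1 : ℝ) ≤ N := by exact_mod_cast hN
    have h2 : c q * N ≤ c r * N :=
      mul_le_mul_of_nonneg_right (hmax q (Finset.mem_range.2 (by omega))) (Nat.cast_nonneg N)
    have h3 := (Nat.ceil_lt_add_one (mul_nonneg (hc q hq).le (Nat.cast_nonneg (α := ℝ) N))).le
    have h4 : (c r + 1) / c p * (c p * N) = (c r + 1) * N := by field_simp
    rw [h4, npart]
    linarith

end ParticleNumbers

section Algebra

variable {n : ℕ} {G : ℕ → X → ℝ} {Np : ℕ → ℕ}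

lemma hatf_one (G : ℕ → X → ℝ) (n : ℕ) : hatf G n 1 = G n := by
  ext x
  simp [hatf]

lemma BddMeas.tens {f : X → ℝ} (hf : BddMeas f) : BddMeas (tens f) :=
  (hf.comp measurable_fst).mul (hf.comp measurable_snd)

/-- The symmetrized tensor product of two functions. -/
def symTens (f g : X → ℝ) (q : X × X) : ℝ := f q.1 * g q.2 + g q.1 * f q.2

lemma BddMeas.symTens {f g : X → ℝ} (hf : BddMeas f) (hg : BddMeas g) : BddMeas (symTens f g) :=
  ((hf.comp measurable_fst).mul (hg.comp measurable_snd)).add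
    ((hg.comp measurable_fst).mul (hf.comp measurable_snd))

lemma tens_hatf_sub (φ : X → ℝ) (m : ℝ) (q : X × X) :
    tens (hatf G n fun x => φ x - m) q = tens (hatf G n φ) q
      + (-m) * symTens (hatf G n φ) (G n) q + m ^ 2 * tens (G n) q := by
  simp only [tens, hatf, symTens]
  ring

lemma pairSum_tens_hatf_sub (b : ℕ → Bool) (φ : X → ℝ) (m : ℝ)
    (ω : (ℕ → ℕ → X) × (ℕ → ℕ → ℕ)) :
    pairSum G Np b n (tens (hatf G n fun x => φ x - m)) ω = pairSum G Np b n (tens (hatf G n φ)) ω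
      + (-m) * pairSum G Np b n (symTens (hatf G n φ) (G n)) ω
      + m ^ 2 * pairSum G Np b n (tens (G n)) ω := by
  simp only [pairSum, Finset.mul_sum, ← Finset.sum_add_distrib, tens_hatf_sub]
  refine Finset.sum_congr rfl fun i _ => Finset.sum_congr rfl fun j _ => ?_
  ring

variable (M0 : Measure X) [IsProbabilityMeasure M0] (M : ℕ → Kernel X X) [∀ p, IsMarkovKernel (M p)]

lemma muB_tens_hatf_sub (h : Setup n G Np) (b : ℕ → Bool) {φ : X → ℝ} (hφ : BddMeas φ) (m : ℝ) :
    muB M0 M G n b (tens (hatf G n fun x => φ x - m)) = muB M0 M G n b (tens (hatf G n φ))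
      + (-m) * muB M0 M G n b (symTens (hatf G n φ) (G n)) + m ^ 2 * muB M0 M G n b (tens (G n)) := by
  have := isProbabilityMeasure_markovPath M0 M b n
  have hG := h.bddMeas le_rfl
  have hf : BddMeas (hatf G n φ) := hG.mul hφ
  have h1 := (bddMeas_tail h le_rfl hf.tens).integrable
    (markovPath (pairInit M0 b) (pairKer M b) n)
  have h2 := (bddMeas_tail h le_rfl (hf.symTens hG)).integrable
    (markovPath (pairInit M0 b) (pairKer M b) n)
  have h3 := (bddMeas_tail h le_rfl hG.tens).integrable
    (markovPath (pairInit M0 b) (pairKer M b) n)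
  have h12 : Integrable (fun ω => tens (hatf G n φ) (ω n) *
        ∏ q ∈ Finset.range n, G q (ω q).1 * G q (ω q).2 +
      -m * (symTens (hatf G n φ) (G n) (ω n) * ∏ q ∈ Finset.range n, G q (ω q).1 * G q (ω q).2))
      (markovPath (pairInit M0 b) (pairKer M b) n) := h1.add (h2.const_mul _)
  simp only [muB]
  rw [← integral_const_mul, ← integral_const_mul, ← integral_add h1 (h2.const_mul _),
    ← integral_add h12 (h3.const_mul _)]
  refine integral_congr_ae (Eventually.of_forall fun ω => ?_)
  simp only [tens_hatf_sub]
  ring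

lemma gammaN_one_mul_etaN (h : Setup n G Np) (f : X → ℝ) (ω : (ℕ → ℕ → X) × (ℕ → ℕ → ℕ)) :
    gammaN G Np n 1 ω * etaN Np n f ω = gammaN G Np n f ω := by
  rw [gammaN_one h le_rfl, gammaN]

lemma vpnHatN_eq (h : Setup n G Np) (p : ℕ) {φ : X → ℝ} (hφ : BddMeas φ)
    (ω : (ℕ → ℕ → X) × (ℕ → ℕ → ℕ)) :
    vpnHatN G Np n p φ ω = (pairSum G Np (eVec p) n (tens (hatf G n φ)) ω
      - pairSum G Np zeroVec n (tens (hatf G n φ)) ω) / gammaN G Np n (G n) ω ^ 2 := by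
  have hf : BddMeas (hatf G n φ) := (h.bddMeas le_rfl).mul hφ
  rw [vpnHatN, vpnN, muBN_eq_pairSum h _ hf.tens, muBN_eq_pairSum h _ hf.tens, div_div, ← mul_pow,
    gammaN_one_mul_etaN h]

lemma gammaHatN_sq_mul_vpnHatN (h : Setup n G Np) (p : ℕ) {φ : X → ℝ} (hφ : BddMeas φ)
    (ω : (ℕ → ℕ → X) × (ℕ → ℕ → ℕ)) :
    gammaHatN G Np n 1 ω ^ 2 * vpnHatN G Np n p φ ω =
      pairSum G Np (eVec p) n (tens (hatf G n φ)) ω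
        - pairSum G Np zeroVec n (tens (hatf G n φ)) ω := by
  have := (gammaN_pos h le_rfl (h.pos n le_rfl) ω).ne'
  rw [vpnHatN_eq h p hφ, gammaHatN, hatf_one]
  field_simp

lemma vpnHat_eq (h : Setup n G Np) (p : ℕ) (φ : X → ℝ) :
    vpnHat M0 M G n p φ = (muB M0 M G n (eVec p) (tens (hatf G n φ))
      - muB M0 M G n zeroVec (tens (hatf G n φ))) / gInt M0 M G n (G n) ^ 2 := by
  have h1 : gInt M0 M G n 1 ≠ 0 :=
    (gInt_pos M0 M h le_rfl (BddMeas.const 1) fun _ => one_pos).ne'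
  rw [vpnHat, vpn, eInt, div_div, ← mul_pow, mul_div_cancel₀ _ h1]

lemma gHatInt_sq_mul_vpnHat (h : Setup n G Np) (p : ℕ) (φ : X → ℝ) :
    gHatInt M0 M G n 1 ^ 2 * vpnHat M0 M G n p φ =
      muB M0 M G n (eVec p) (tens (hatf G n φ)) - muB M0 M G n zeroVec (tens (hatf G n φ)) := by
  have := (gInt_pos M0 M h le_rfl (h.bddMeas le_rfl) (h.pos n le_rfl)).ne'
  rw [vpnHat_eq M0 M h, gHatInt, hatf_one]
  field_simp

variable [Nonempty X]

lemma integral_gammaHatN_sq_mul_vnHatN (h : Setup n G Np) (c : ℕ → ℝ) {φ : X → ℝ}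
    (hφ : BddMeas φ) :
    ∫ ω, gammaHatN G Np n 1 ω ^ 2 * vnHatN G Np c n φ ω ∂(pfLaw M0 M G Np n)
      = gHatInt M0 M G n 1 ^ 2 * sigma2Hat M0 M G c n φ := by
  have := isProbabilityMeasure_pfLaw M M0 h le_rfl
  have hf : BddMeas (hatf G n φ) := (h.bddMeas le_rfl).mul hφ
  have hi : ∀ b, Integrable (pairSum G Np b n (tens (hatf G n φ))) (pfLaw M0 M G Np n) :=
    fun b => (bddMeas_pairSum h b le_rfl hf.tens).integrable _
  simp only [vnHatN, sigma2Hat, Finset.mul_sum, mul_left_comm _ (c _)⁻¹,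
    gammaHatN_sq_mul_vpnHatN h _ hφ, gHatInt_sq_mul_vpnHat M0 M h]
  have hs : ∀ p, Integrable (fun ω => (c p)⁻¹ *
      (pairSum G Np (eVec p) n (tens (hatf G n φ)) ω
        - pairSum G Np zeroVec n (tens (hatf G n φ)) ω)) (pfLaw M0 M G Np n) :=
    fun p => ((hi _).sub (hi _)).const_mul _
  rw [integral_finsetSum _ fun p _ => hs p]
  refine Finset.sum_congr rfl fun p _ => ?_
  rw [integral_const_mul, integral_sub (hi _) (hi _), integral_pairSum_eq M0 M h _ le_rfl hf.tens,
    integral_pairSum_eq M0 M h _ le_rfl hf.tens]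

lemma integral_gammaHatN_sq_mul_vpnHatN (h : Setup n G Np) (p : ℕ) {φ : X → ℝ}
    (hφ : BddMeas φ) :
    ∫ ω, gammaHatN G Np n 1 ω ^ 2 * vpnHatN G Np n p φ ω ∂(pfLaw M0 M G Np n)
      = gHatInt M0 M G n 1 ^ 2 * vpnHat M0 M G n p φ := by
  have := isProbabilityMeasure_pfLaw M M0 h le_rfl
  have hf : BddMeas (hatf G n φ) := (h.bddMeas le_rfl).mul hφ
  have hi : ∀ b, Integrable (pairSum G Np b n (tens (hatf G n φ))) (pfLaw M0 M G Np n) :=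
    fun b => (bddMeas_pairSum h b le_rfl hf.tens).integrable _
  simp only [gammaHatN_sq_mul_vpnHatN h _ hφ, gHatInt_sq_mul_vpnHat M0 M h]
  rw [integral_sub (hi _) (hi _), integral_pairSum_eq M0 M h _ le_rfl hf.tens,
    integral_pairSum_eq M0 M h _ le_rfl hf.tens]

end Algebra

section Consistency

variable {n : ℕ} {G : ℕ → X → ℝ} (M0 : Measure X) [IsProbabilityMeasure M0]
  (M : ℕ → Kernel X X) [∀ p, IsMarkovKernel (M p)] [Nonempty X]

/-- The laws of the particle systems, indexed by `N`. -/
abbrev pfSeq (M0 : Measure X) (M : ℕ → Kernel X X) (G : ℕ → X → ℝ) (c : ℕ → ℝ) (n N : ℕ) :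
    Measure ((ℕ → ℕ → X) × (ℕ → ℕ → ℕ)) := pfLaw M0 M G (npart c N) n

variable (h : Setup n G fun _ => 2) {c : ℕ → ℝ} (hc : ∀ p ≤ n, 0 < c p)

include h hc

lemma eventually_setup : ∀ᶠ N in atTop, Setup n G (npart c N) := by
  obtain ⟨a, D, ha, hD, h2, hb⟩ := exists_npart_bounds hc
  filter_upwards [h2] with N hN
  exact ⟨h.meas, h.pos, h.bd, hN⟩

lemma tendsto_pairSum (b : ℕ → Bool) {f : X × X → ℝ} (hf : BddMeas f) :
    Tendsto (fun q => pairSum G (npart c q.1) b n f q.2) (probFilter (pfSeq M0 M G c n))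
      (nhds (muB M0 M G n b f)) := by
  obtain ⟨a, D, ha, hD, h2, hb⟩ := exists_npart_bounds hc
  obtain ⟨Γ, hΓ⟩ := exists_forall_le_of_forall_exists h.bd
  obtain ⟨C, hC⟩ := exists_integral_pairSum_sq_le M0 M h b hD hΓ le_rfl hf
  refine tendsto_probFilter_of_sq_le (Y := fun N => pairSum G (npart c N) b n f) (C := C) ha ?_
  filter_upwards [eventually_setup h hc, eventually_ge_atTop 1] with N hs hN
  have hN' : (0 : ℝ) < N := by exact_mod_cast hN
  exact ⟨isProbabilityMeasure_pfLaw M M0 hs le_rfl, bddMeas_pairSum hs b le_rfl hf,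
    integral_pairSum_eq M0 M hs b le_rfl hf, hC _ _ hs (mul_pos ha hN') (hb N hN)⟩

lemma tendsto_gammaN {f : X → ℝ} (hf : BddMeas f) :
    Tendsto (fun q => gammaN G (npart c q.1) n f q.2) (probFilter (pfSeq M0 M G c n))
      (nhds (gInt M0 M G n f)) := by
  obtain ⟨a, D, ha, hD, h2, hb⟩ := exists_npart_bounds hc
  obtain ⟨Γ, hΓ⟩ := exists_forall_le_of_forall_exists h.bd
  obtain ⟨C, hC⟩ := exists_integral_gammaN_sq_le M0 M h hΓ le_rfl hf
  refine tendsto_probFilter_of_sq_le (Y := fun N => gammaN G (npart c N) n f) (C := C) ha ?_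
  filter_upwards [eventually_setup h hc, eventually_ge_atTop 1] with N hs hN
  have hN' : (0 : ℝ) < N := by exact_mod_cast hN
  exact ⟨isProbabilityMeasure_pfLaw M M0 hs le_rfl, bddMeas_gammaN hs le_rfl hf,
    integral_gammaN_eq M0 M hs le_rfl hf, hC _ _ hs (mul_pos ha hN') fun q hq => (hb N hN q hq).1⟩

lemma tendsto_vpnHatN (p : ℕ) {φ : X → ℝ} (hφ : BddMeas φ) :
    Tendsto (fun q => vpnHatN G (npart c q.1) n p φ q.2) (probFilter (pfSeq M0 M G c n))
      (nhds (vpnHat M0 M G n p φ)) := by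
  have hG := h.bddMeas le_rfl
  have hf : BddMeas (hatf G n φ) := hG.mul hφ
  have hg : gInt M0 M G n (G n) ^ 2 ≠ 0 :=
    (pow_pos (gInt_pos M0 M h le_rfl hG (h.pos n le_rfl)) 2).ne'
  rw [vpnHat_eq M0 M h]
  refine (((tendsto_pairSum M0 M h hc (eVec p) hf.tens).sub
    (tendsto_pairSum M0 M h hc zeroVec hf.tens)).div
      ((tendsto_gammaN M0 M h hc hG).pow 2) hg).congr' ?_
  refine eventually_probFilter (p := fun N ω =>
    (pairSum G (npart c N) (eVec p) n (tens (hatf G n φ)) ω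
      - pairSum G (npart c N) zeroVec n (tens (hatf G n φ)) ω) / gammaN G (npart c N) n (G n) ω ^ 2
      = vpnHatN G (npart c N) n p φ ω) ?_
  filter_upwards [eventually_setup h hc] with N hs ω
  exact (vpnHatN_eq hs p hφ ω).symm

lemma tendsto_etaHatN {φ : X → ℝ} (hφ : BddMeas φ) :
    Tendsto (fun q => etaHatN G (npart c q.1) n φ q.2) (probFilter (pfSeq M0 M G c n))
      (nhds (eHatInt M0 M G n φ)) := by
  have hG := h.bddMeas le_rfl
  have hf : BddMeas (hatf G n φ) := hG.mul hφ
  have hg : gInt M0 M G n (G n) ≠ 0 := (gInt_pos M0 M h le_rfl hG (h.pos n le_rfl)).ne'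
  simp only [etaHatN, gammaHatN, eHatInt, gHatInt, hatf_one]
  exact (tendsto_gammaN M0 M h hc hf).div (tendsto_gammaN M0 M h hc hG) hg

lemma tendsto_pairSum_centered (b : ℕ → Bool) {φ : X → ℝ} (hφ : BddMeas φ) :
    Tendsto (fun q => pairSum G (npart c q.1) b n
        (tens (hatf G n fun x => φ x - etaHatN G (npart c q.1) n φ q.2)) q.2)
      (probFilter (pfSeq M0 M G c n))
      (nhds (muB M0 M G n b (tens (hatf G n fun x => φ x - eHatInt M0 M G n φ)))) := by
  have hG := h.bddMeas le_rfl
  have hf : BddMeas (hatf G n φ) := hG.mul hφ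
  have hm := tendsto_etaHatN M0 M h hc hφ
  rw [muB_tens_hatf_sub M0 M h b hφ]
  simp only [pairSum_tens_hatf_sub]
  exact ((tendsto_pairSum M0 M h hc b hf.tens).add
    (hm.neg.mul (tendsto_pairSum M0 M h hc b (hf.symTens hG)))).add
      ((hm.pow 2).mul (tendsto_pairSum M0 M h hc b hG.tens))

lemma tendsto_vpnHatN_centered (p : ℕ) {φ : X → ℝ} (hφ : BddMeas φ) :
    Tendsto (fun q => vpnHatN G (npart c q.1) n p
        (fun x => φ x - etaHatN G (npart c q.1) n φ q.2) q.2) (probFilter (pfSeq M0 M G c n))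
      (nhds (vpnHat M0 M G n p fun x => φ x - eHatInt M0 M G n φ)) := by
  have hG := h.bddMeas le_rfl
  have hg : gInt M0 M G n (G n) ^ 2 ≠ 0 :=
    (pow_pos (gInt_pos M0 M h le_rfl hG (h.pos n le_rfl)) 2).ne'
  rw [vpnHat_eq M0 M h]
  refine (((tendsto_pairSum_centered M0 M h hc (eVec p) hφ).sub
    (tendsto_pairSum_centered M0 M h hc zeroVec hφ)).div
      ((tendsto_gammaN M0 M h hc hG).pow 2) hg).congr' ?_
  refine eventually_probFilter (p := fun N ω =>
    (pairSum G (npart c N) (eVec p) n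
        (tens (hatf G n fun x => φ x - etaHatN G (npart c N) n φ ω)) ω
      - pairSum G (npart c N) zeroVec n
        (tens (hatf G n fun x => φ x - etaHatN G (npart c N) n φ ω)) ω)
        / gammaN G (npart c N) n (G n) ω ^ 2
      = vpnHatN G (npart c N) n p (fun x => φ x - etaHatN G (npart c N) n φ ω) ω) ?_
  filter_upwards [eventually_setup h hc] with N hs ω
  exact (vpnHatN_eq hs p (by simpa only [sub_eq_add_neg] using hφ.add (BddMeas.const _)) ω).symm

lemma tendsto_vnHatN {φ : X → ℝ} (hφ : BddMeas φ) :
    Tendsto (fun q => vnHatN G (npart c q.1) c n φ q.2) (probFilter (pfSeq M0 M G c n))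
      (nhds (sigma2Hat M0 M G c n φ)) :=
  tendsto_finsetSum _ fun p _ => (tendsto_vpnHatN M0 M h hc p hφ).const_mul _

end Consistency

theorem statement18
    {X : Type*} [MeasurableSpace X] [Nonempty X] (hX : ∃ x y : X, x ≠ y) (n : ℕ)
    (M0 : Measure X) [IsProbabilityMeasure M0]
    (M : ℕ → Kernel X X) [∀ p, IsMarkovKernel (M p)]
    (G : ℕ → X → ℝ) (hGm : ∀ p ≤ n, Measurable (G p))
    (hGpos : ∀ p ≤ n, ∀ x, 0 < G p x) (hGbd : ∀ p ≤ n, ∃ C, ∀ x, G p x ≤ C)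
    (c : ℕ → ℝ) (hc : ∀ p ≤ n, 0 < c p)
    (φ : X → ℝ) (hφm : Measurable φ) (hφb : ∃ C, ∀ x, |φ x| ≤ C) :
    (∀ p ≤ n,
      (∀ N : ℕ, 1 ≤ N → (∀ q ≤ n, 2 ≤ npart c N q) →
        ∫ ω, gammaHatN G (npart c N) n (1 : X → ℝ) ω ^ 2 * vpnHatN G (npart c N) n p φ ω
            ∂(pfLaw M0 M G (npart c N) n)
          = gHatInt M0 M G n 1 ^ 2 * vpnHat M0 M G n p φ) ∧
      (∀ ε : ℝ, 0 < ε →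
        Tendsto (fun N : ℕ =>
            pfLaw M0 M G (npart c N) n
              {ω | ε ≤ |vpnHatN G (npart c N) n p φ ω - vpnHat M0 M G n p φ|})
          atTop (nhds 0)) ∧
      (∀ ε : ℝ, 0 < ε →
        Tendsto (fun N : ℕ =>
            pfLaw M0 M G (npart c N) n
              {ω | ε ≤ |vpnHatN G (npart c N) n p
                    (fun x => φ x - etaHatN G (npart c N) n φ ω) ω
                  - vpnHat M0 M G n p fun x => φ x - eHatInt M0 M G n φ|})
          atTop (nhds 0))) ∧
    (∀ N : ℕ, 1 ≤ N → (∀ q ≤ n, 2 ≤ npart c N q) →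
      ∫ ω, gammaHatN G (npart c N) n (1 : X → ℝ) ω ^ 2 * vnHatN G (npart c N) c n φ ω
          ∂(pfLaw M0 M G (npart c N) n)
        = gHatInt M0 M G n 1 ^ 2 * sigma2Hat M0 M G c n φ) ∧
    (∀ ε : ℝ, 0 < ε →
      Tendsto (fun N : ℕ =>
          pfLaw M0 M G (npart c N) n
            {ω | ε ≤ |vnHatN G (npart c N) c n φ ω - sigma2Hat M0 M G c n φ|})
        atTop (nhds 0)) := by
  have hφ : BddMeas φ := ⟨hφm, hφb⟩
  have h : Setup n G fun _ => 2 := ⟨hGm, hGpos, hGbd, fun _ _ => le_rfl⟩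
  refine ⟨fun p _ => ⟨fun N _ h2 => ?_, ?_, ?_⟩, fun N _ h2 => ?_, ?_⟩
  · exact integral_gammaHatN_sq_mul_vpnHatN M0 M ⟨hGm, hGpos, hGbd, h2⟩ p hφ
  · exact tendsto_probFilter_iff.1 (tendsto_vpnHatN M0 M h hc p hφ)
  · exact tendsto_probFilter_iff.1 (tendsto_vpnHatN_centered M0 M h hc p hφ)
  · exact integral_gammaHatN_sq_mul_vnHatN M0 M ⟨hGm, hGpos, hGbd, h2⟩ c hφ
  · exact tendsto_probFilter_iff.1 (tendsto_vnHatN M0 M h hc hφ)
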